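/- Weil's descent theorem (quasi-projective case): Let k be a field of characteristic zero and K an algebraically closed field extension of k of infinite transcendence degree over k. Let Y be an integral scheme that is quasi-projective over K, equipped with a continuous descent datum with respect to K/k. Then the descent datum is effective, and the scheme X over k realizing it is quasi-projective over k; moreover X can be taken affine (respectively quasi-affine of finite type) over k whenever Y is affine (respectively quasi-affine) over K. -/

import Mathlib

open AlgebraicGeometry CategoryTheory CategoryTheory.Limits

noncomputable section

section
namespace WD
open IntermediateField

section Ext
variable {N K : Type} [Field N] [Field K] [Algebra N K] [IsAlgClosed K]

theorem ext_aut {ι : Type} (v : ι → K) (hv : IsTranscendenceBasis N v) (φ : N ≃+* N)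
    (π : Equiv.Perm ι) :
    ∃ ρ : K ≃+* K, (∀ a : N, ρ (algebraMap N K a) = algebraMap N K (φ a)) ∧
      ∀ i, ρ (v i) = v (π i) := by
  letI := IsAlgClosed.isAlgClosure_of_transcendence_basis v hv
  let m : MvPolynomial ι N ≃+* MvPolynomial ι N :=
    (MvPolynomial.mapEquiv ι φ).trans (MvPolynomial.renameEquiv N π).toRingEquiv
  let e : Algebra.adjoin N (Set.range v) ≃+* Algebra.adjoin N (Set.range v) :=
    hv.1.aevalEquiv.symm.toRingEquiv.trans (m.trans hv.1.aevalEquiv.toRingEquiv)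
  have he : ∀ p, e (hv.1.aevalEquiv p) = hv.1.aevalEquiv (m p) := by
    intro p
    simp [e]
  have key : ∀ p, IsAlgClosure.equivOfEquiv K K e (MvPolynomial.aeval v p)
      = MvPolynomial.aeval v (m p) := by
    intro p
    have h1 := IsAlgClosure.equivOfEquiv_algebraMap K K e (hv.1.aevalEquiv p)
    rw [he] at h1
    simpa using h1
  refine ⟨IsAlgClosure.equivOfEquiv K K e, fun a => ?_, fun i => ?_⟩
  · have := key (MvPolynomial.C a)
    simpa [m] using this
  · have := key (MvPolynomial.X i)
    simpa [m] using this

end Ext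

variable {k K : Type} [Field k] [Field K] [Algebra k K]

theorem ind_mono {N N' : IntermediateField k K} (h : N ≤ N') {ι : Type} {x : ι → K}
    (hx : AlgebraicIndependent N' x) : AlgebraicIndependent N x := by
  letI : Algebra N N' := (IntermediateField.inclusion h).toAlgebra
  haveI : IsScalarTower N N' K := .of_algebraMap_eq fun _ => rfl
  exact hx.restrictScalars (IntermediateField.inclusion h).injective

theorem sup_adjoin (N : IntermediateField k K) (S : Set K) :
    N ⊔ adjoin k S = (adjoin N S).restrictScalars k := by
  apply le_antisymm
  · refine sup_le (fun a ha => ?_) ?_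
    · exact (adjoin N S).algebraMap_mem ⟨a, ha⟩
    · exact adjoin_le_iff.2 (subset_adjoin N S)
  · intro a ha
    have : adjoin N S ≤ IntermediateField.extendScalars (le_sup_left : N ≤ N ⊔ adjoin k S) :=
      adjoin_le_iff.2 fun s hs => (le_sup_right : adjoin k S ≤ N ⊔ adjoin k S) (subset_adjoin k S hs)
    exact this ha

theorem ind_sum_iff (N : IntermediateField k K) {ι κ : Type} {x : ι → K} {y : κ → K} :
    AlgebraicIndependent N (Sum.elim y x) ↔
      AlgebraicIndependent N x ∧ AlgebraicIndependent ↥(N ⊔ adjoin k (Set.range x)) y := by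
  rw [AlgebraicIndependent.sumElim_iff, sup_adjoin]
  refine and_congr_right fun _ => ?_
  change _ ↔ AlgebraicIndependent (adjoin N (Set.range x)) y
  open scoped IntermediateField.algebraAdjoinAdjoin in
  constructor
  · intro h
    exact h.extendScalars _
  · intro h
    exact h.restrictScalars (FaithfulSMul.algebraMap_injective _ _)

theorem ind_swap (N : IntermediateField k K) {ι κ : Type} {x : ι → K} {y : κ → K} 
    (h : AlgebraicIndependent N (Sum.elim y x)) : AlgebraicIndependent N (Sum.elim x y) := by
  have := h.comp Sum.swap Sum.swap_leftInverse.injective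
  convert! this using 1
  ext i; rcases i <;> rfl

theorem ind_map (N N' : IntermediateField k K) (σ : K ≃ₐ[k] K) {ι : Type} {x : ι → K} 
    (hN : ∀ a ∈ N', σ.symm a ∈ N) (h : AlgebraicIndependent N x) : AlgebraicIndependent N' (σ ∘ x) := by
  have h2 : ∀ p : MvPolynomial ι N', ∃ q : MvPolynomial ι N,
      MvPolynomial.aeval (σ ∘ x) p = σ (MvPolynomial.aeval x q) ∧ (q = 0 → p = 0) := by
    intro p
    let f : N' →+* N := ((σ.symm : K →+* K).comp N'.val.toRingHom).codRestrict N.toSubring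
      (fun a => hN _ a.2)
    have hf : ∀ a, ((f a : N) : K) = σ.symm a := fun _ => rfl
    refine ⟨MvPolynomial.map f p, ?_, ?_⟩
    · rw [MvPolynomial.aeval_def, MvPolynomial.aeval_def, MvPolynomial.eval₂_map]
      have := MvPolynomial.eval₂_comp_left (σ : K →+* K) ((algebraMap N K).comp f) x p
      refine Eq.trans ?_ this.symm
      congr 1
      ext a
      change (a : K) = σ ((f a : N) : K)
      rw [hf, AlgEquiv.apply_symm_apply]
    · intro h
      exact (MvPolynomial.map_injective f f.injective) (by simpa using h)
  rw [algebraicIndependent_iff]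
  intro p hp
  obtain ⟨q, hq, hq'⟩ := h2 p
  rw [hq] at hp
  exact hq' (algebraicIndependent_iff.1 h q ((map_eq_zero_iff σ σ.injective).1 hp))

variable [IsAlgClosed K]

theorem exists_swap (N : IntermediateField k K) {ι : Type} {x y : ι → K}
    (h : AlgebraicIndependent N (Sum.elim y x)) :
    ∃ σ : K ≃ₐ[k] K, (∀ a ∈ N, σ a = a) ∧ (∀ i, σ (x i) = y i) ∧ ∀ i, σ (y i) = x i := by
  let R := Algebra.adjoin N (Set.range (Sum.elim y x))
  obtain ⟨s, w, hw⟩ := exists_isTranscendenceBasis' R K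
  have hb : IsTranscendenceBasis N
      (fun i => (⟨Sum.elim y x i, Algebra.subset_adjoin ⟨i, rfl⟩⟩ : R)) := by
    have := (IsTranscendenceBasis.mvPolynomial (ι ⊕ ι) N)
    have h2 := (h.aevalEquiv.isTranscendenceBasis this)
    convert! h2 using 1
    ext i
    simp
  have hb2 := hb.sumElim_comp hw
  obtain ⟨ρ, h1, h2⟩ := ext_aut _ hb2 (RingEquiv.refl N)
    (Equiv.sumCongr (Equiv.refl _) (Equiv.sumComm _ _))
  have h1' : ∀ a ∈ N, ρ a = a := fun a ha => h1 ⟨a, ha⟩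
  refine ⟨AlgEquiv.ofRingEquiv (f := ρ) (fun a => h1' _ (N.algebraMap_mem a)), h1', ?_, ?_⟩
  · intro i
    exact h2 (Sum.inr (Sum.inr i))
  · intro i
    exact h2 (Sum.inr (Sum.inl i))

end WD
end

section
namespace WD
open IntermediateField

variable {k K : Type} [Field k] [Field K] [Algebra k K]

theorem ind_bot {ι : Type} {x : ι → K} :
    AlgebraicIndependent (⊥ : IntermediateField k K) x ↔ AlgebraicIndependent k x :=
  ⟨fun h => h.restrictScalars (FaithfulSMul.algebraMap_injective k (⊥ : IntermediateField k K)),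
    fun h => h.extendScalars _⟩

theorem fg_range {ι : Type} [Finite ι] (x : ι → K) : (adjoin k (Set.range x)).FG :=
  fg_adjoin_of_finite (Set.finite_range x)

theorem adjoin_fixed {S : Set K} (σ : K ≃ₐ[k] K) (h : ∀ a ∈ S, σ a = a) :
    ∀ a ∈ adjoin k S, σ a = a := by
  intro a ha
  have : adjoin k S ≤ fixedField (Subgroup.zpowers σ) := by
    rw [adjoin_le_iff]
    rintro b hb
    rintro ⟨_, n, rfl⟩
    have : σ ∈ MulAction.stabilizer (K ≃ₐ[k] K) b := h b hb
    exact Subgroup.zpow_mem _ this n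
  exact this ha ⟨σ, Subgroup.mem_zpowers σ⟩

variable (htr : ∀ L : IntermediateField k K, L.FG → ∃ x : K, Transcendental L x)

include htr in
theorem exists_ind_fin (N : IntermediateField k K) (hN : N.FG) (n : ℕ) :
    ∃ z : Fin n → K, AlgebraicIndependent N z := by
  induction n with
  | zero =>
    refine ⟨Fin.elim0, ?_⟩
    rw [algebraicIndependent_empty_type_iff]
    exact (algebraMap N K).injective
  | succ n ih =>
    obtain ⟨z, hz⟩ := ih
    obtain ⟨a, ha⟩ := htr (N ⊔ adjoin k (Set.range z)) (fg_sup hN (fg_range z))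
    have h1 : AlgebraicIndependent ↥(N ⊔ adjoin k (Set.range z)) (fun _ : Fin 1 => a) :=
      algebraicIndependent_unique_type_iff.2 ha
    have h2 := (ind_sum_iff N).2 ⟨hz, h1⟩
    exact ⟨_, h2.comp (finSumFinEquiv.symm ∘ finCongr (Nat.add_comm n 1))
      (finSumFinEquiv.symm.injective.comp (finCongr _).injective)⟩

include htr in
theorem exists_ind (N : IntermediateField k K) (hN : N.FG) (ι : Type) [Finite ι] :
    ∃ z : ι → K, AlgebraicIndependent N z := by
  obtain ⟨n, ⟨e⟩⟩ := Finite.exists_equiv_fin ι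
  obtain ⟨z, hz⟩ := exists_ind_fin htr N hN n
  exact ⟨z ∘ e, hz.comp e e.injective⟩

variable [IsAlgClosed K]

include htr in
theorem exists_move (N : IntermediateField k K) (hN : N.FG) {ι : Type} [Finite ι] {x y : ι → K}
    (hx : AlgebraicIndependent N x) (hy : AlgebraicIndependent N y) :
    ∃ σ : K ≃ₐ[k] K, (∀ a ∈ N, σ a = a) ∧ ∀ i, σ (x i) = y i := by
  obtain ⟨z, hz⟩ := exists_ind htr (N ⊔ (adjoin k (Set.range x) ⊔ adjoin k (Set.range y)))
    (fg_sup hN (fg_sup (fg_range x) (fg_range y))) ι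
  obtain ⟨σ, h1, h2, -⟩ := exists_swap N ((ind_sum_iff N).2
    ⟨hx, ind_mono (sup_le_sup_left le_sup_left _) hz⟩)
  obtain ⟨τ, h3, -, h4⟩ := exists_swap N ((ind_sum_iff N).2
    ⟨hy, ind_mono (sup_le_sup_left le_sup_right _) hz⟩)
  refine ⟨σ.trans τ, fun a ha => ?_, fun i => ?_⟩
  · simp [h1 a ha, h3 a ha]
  · simp [h2, h4]

include htr in
theorem fixed_mem [CharZero k] (L : IntermediateField k K) (hL : L.FG) (a : K)
    (ha : ∀ σ : K ≃ₐ[k] K, (∀ b ∈ L, σ b = b) → σ a = a) : a ∈ L := by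
  by_cases h : IsAlgebraic L a
  · let M := algebraicClosure L K
    have : CharZero L := charZero_of_injective_algebraMap (algebraMap k L).injective
    have : IsGalois L M := ⟨⟩
    let a' : M := ⟨a, mem_algebraicClosure_iff.2 h⟩
    have h1 : a' ∈ (⊥ : IntermediateField L M) := by
      rw [InfiniteGalois.mem_bot_iff_fixed]
      intro φ
      obtain ⟨s, w, hw⟩ := exists_isTranscendenceBasis' M K
      obtain ⟨ρ, h1, -⟩ := ext_aut w hw φ.toRingEquiv (Equiv.refl _)
      have h2 : ∀ b ∈ L, ρ b = b := fun b hb => by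
        have := h1 (algebraMap L M ⟨b, hb⟩)
        change ρ b = algebraMap M K (φ (algebraMap L M ⟨b, hb⟩)) at this
        rw [AlgEquiv.commutes] at this
        exact this
      have h3 := ha (AlgEquiv.ofRingEquiv (f := ρ) (fun a => h2 _ (L.algebraMap_mem a))) h2
      apply Subtype.ext
      have h4 := h1 a'
      exact h4.symm.trans h3
    obtain ⟨b, hb⟩ := IntermediateField.mem_bot.1 h1
    have : a = (b : K) := congrArg (algebraMap M K) hb.symm
    rw [this]; exact b.2
  · exfalso
    have h' : AlgebraicIndependent L (fun _ : Fin 1 => a) :=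
      algebraicIndependent_unique_type_iff.2 h
    obtain ⟨z, hz⟩ := exists_ind htr _ (fg_sup hL (fg_range (fun _ : Fin 1 => a))) (Fin 1)
    obtain ⟨σ, h1, h2, -⟩ := exists_swap L ((ind_sum_iff L).2 ⟨h', hz⟩)
    have h3 := h2 0
    rw [ha σ h1] at h3
    apply hz.transcendental 0
    rw [← h3]
    exact isAlgebraic_algebraMap (⟨a, (le_sup_right : _ ≤ L ⊔ adjoin k (Set.range fun _ : Fin 1 => a))
      (subset_adjoin _ _ ⟨0, rfl⟩)⟩ : ↥(L ⊔ adjoin k (Set.range fun _ : Fin 1 => a)))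

include htr in
theorem gen_top {ι : Type} [Finite ι] (t : ι → K) (ht : AlgebraicIndependent k t)
    (S : Subgroup (K ≃ₐ[k] K)) (hS : ∀ σ : K ≃ₐ[k] K, (∀ i, σ (t i) = t i) → σ ∈ S)
    (τ : K ≃ₐ[k] K) (hτ : τ ∈ S)
    (hτt : AlgebraicIndependent (adjoin k (Set.range t)) (τ ∘ t)) : S = ⊤ := by
  rw [eq_top_iff]
  rintro g -
  have bs : ∀ N : IntermediateField k K, ⊥ ⊔ N = N := fun N => bot_sup_eq N
  let s := τ ∘ t
  let y := g ∘ t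
  have ht0 : AlgebraicIndependent (⊥ : IntermediateField k K) t := ind_bot.2 ht
  obtain ⟨z, hz⟩ := exists_ind htr (adjoin k (Set.range t) ⊔ adjoin k (Set.range y))
    (fg_sup (fg_range t) (fg_range y)) ι
  obtain ⟨ρ, h1, h2⟩ := exists_move htr _ (fg_range t) (ind_mono le_sup_left hz) hτt
  -- t indep over k(s)
  have e1 : AlgebraicIndependent (adjoin k (Set.range s)) t := by
    have := ind_swap _ ((ind_sum_iff ⊥).2 ⟨ht0, by rw [bs]; exact hτt⟩)
    have := ((ind_sum_iff ⊥).1 this).2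
    rwa [bs] at this
  have e2 : AlgebraicIndependent (adjoin k (Set.range z)) y := by
    have hy : AlgebraicIndependent (⊥ : IntermediateField k K) y :=
      ind_map ⊥ ⊥ g (fun a ha => by
        obtain ⟨b, rfl⟩ := IntermediateField.mem_bot.1 ha
        simp [IntermediateField.algebraMap_mem]) ht0
    have := ind_swap _ ((ind_sum_iff ⊥).2 ⟨hy, by rw [bs]; exact ind_mono le_sup_right hz⟩)
    have := ((ind_sum_iff ⊥).1 this).2
    rwa [bs] at this
  have e3 : AlgebraicIndependent (adjoin k (Set.range s)) (ρ ∘ y) := by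
    refine ind_map _ _ ρ ?_ e2
    intro a ha
    have : adjoin k (Set.range s) ≤ (adjoin k (Set.range z)).map ρ.toAlgHom := by
      rw [adjoin_le_iff]
      rintro _ ⟨i, rfl⟩
      exact ⟨z i, subset_adjoin _ _ ⟨i, rfl⟩, h2 i⟩
    obtain ⟨b, hb, rfl⟩ := this ha
    simpa using hb
  obtain ⟨ρ', h3, h4⟩ := exists_move htr _ (fg_range s) e1 e3
  have m1 : ρ ∈ S := hS _ fun i => h1 _ (subset_adjoin _ _ ⟨i, rfl⟩)
  have m2 : ρ' ∈ S := by
    have : τ⁻¹ * ρ' * τ ∈ S := by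
      apply hS
      intro i
      have := h3 (s i) (subset_adjoin _ _ ⟨i, rfl⟩)
      change τ.symm (ρ' (τ (t i))) = _
      rw [show ρ' (τ (t i)) = τ (t i) from this]
      simp
    have := S.mul_mem (S.mul_mem hτ this) (S.inv_mem hτ)
    simpa [mul_assoc] using this
  have m3 : ρ'⁻¹ * (ρ * g) ∈ S := by
    apply hS
    intro i
    have := h4 i
    change ρ'.symm (ρ (g (t i))) = _
    rw [AlgEquiv.symm_apply_eq]
    exact this.symm
  have := S.mul_mem (S.inv_mem m1) (S.mul_mem m2 m3)
  simpa [mul_assoc] using this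

omit [IsAlgClosed K] in
theorem exists_cosets_aux (S B : Set K) (hS : S.Finite) (hB2 : B ⊆ S)
    (hB3 : ∀ x ∈ S, IsAlgebraic (Algebra.adjoin k B) x) :
    ∃ (Q : Type) (_ : Fintype Q) (g : Q → (K ≃ₐ[k] K)) (q₀ : Q), g q₀ = 1 ∧
      (∀ q (i : B), g q i = i) ∧
      (∀ γ : K ≃ₐ[k] K, (∀ i : B, γ i = i) →
        ∃ π : Equiv.Perm Q, ∀ q, ∀ a ∈ adjoin k S, γ (g q a) = g (π q) a) ∧
      ∀ q q', (∀ a ∈ adjoin k S, g q a = g q' a) → q = q' := by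
  classical
  let P := adjoin k B
  let M : IntermediateField P K := adjoin P S
  have : FiniteDimensional P M := by
    have := hS.to_subtype
    refine IntermediateField.finiteDimensional_adjoin fun x hx => ?_
    have := hB3 x hx
    open scoped IntermediateField.algebraAdjoinAdjoin in
    exact (IsAlgebraic.extendScalars (FaithfulSMul.algebraMap_injective _ (adjoin k B)) this).isIntegral
  have hSM : ∀ a, a ∈ adjoin k S ↔ a ∈ M := by
    intro a
    have h := sup_adjoin P S
    rw [sup_eq_right.2 (adjoin.mono _ _ _ hB2)] at h
    rw [h]; rfl
  let Γ : Subgroup (K ≃ₐ[k] K) := fixingSubgroup P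
  have hΓ : ∀ γ : K ≃ₐ[k] K, γ ∈ Γ ↔ ∀ i : B, γ i = i := by
    intro γ
    rw [IntermediateField.mem_fixingSubgroup_iff]
    exact ⟨fun h i => h _ (subset_adjoin _ _ i.2), fun h => adjoin_fixed γ (fun a ha => h ⟨a, ha⟩)⟩
  let res : Γ → (M →ₐ[P] K) := fun γ =>
    { (γ.1 : K →+* K).comp (M.val : M →+* K) with
      commutes' := fun r => (IntermediateField.mem_fixingSubgroup_iff _ _).1 γ.2 _ r.2 }
  have hres : ∀ γ a, res γ a = γ.1 a := fun _ _ => rfl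
  have hfin : Finite (M →ₐ[P] K) := inferInstance
  let Q := Set.range res
  let g0 : Q → Γ := fun q => if q.1 = res 1 then 1 else q.2.choose
  have hg0 : ∀ q, res (g0 q) = q.1 := by
    intro q
    by_cases h : q.1 = res 1
    · simp [g0, h]
    · simp only [g0, h, if_false]; exact q.2.choose_spec
  have hg1 : ∀ q, ∀ a (ha : a ∈ adjoin k S), (g0 q).1 a = q.1 ⟨a, (hSM a).1 ha⟩ := by
    intro q a ha
    rw [← hg0]
    rfl
  have act : ∀ γ ∈ Γ, ∀ q : Q, ∃ q' : Q, ∀ a (ha : a ∈ adjoin k S), q'.1 ⟨a, (hSM a).1 ha⟩ =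
      γ (q.1 ⟨a, (hSM a).1 ha⟩) := by
    intro γ hγ q
    refine ⟨⟨res (⟨γ, hγ⟩ * g0 q), _, rfl⟩, fun a ha => ?_⟩
    rw [← hg1 q a ha]
    rfl
  have inj : ∀ q q' : Q, (∀ a (ha : a ∈ adjoin k S), q.1 ⟨a, (hSM a).1 ha⟩ =
      q'.1 ⟨a, (hSM a).1 ha⟩) → q = q' := by
    intro q q' h
    apply Subtype.ext
    ext ⟨a, ha⟩
    exact h a ((hSM a).2 ha)
  have : Finite Q := inferInstance
  refine ⟨Q, Fintype.ofFinite _, fun q => (g0 q).1, ⟨res 1, 1, rfl⟩, by simp [g0], ?_, ?_, ?_⟩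
  · intro q i
    exact (hΓ _).1 (g0 q).2 i
  · intro γ hγ
    choose f hf using act γ ((hΓ γ).2 hγ)
    have finj : Function.Injective f := by
      intro q q' h
      apply inj
      intro a ha
      apply γ.injective
      rw [← hf q a ha, ← hf q' a ha, h]
    refine ⟨Equiv.ofBijective f (Finite.injective_iff_bijective.1 finj), fun q a ha => ?_⟩
    rw [hg1 _ a ha, hg1 _ a ha]
    exact (hf q a ha).symm
  · intro q q' h
    apply inj
    intro a ha
    rw [← hg1 _ a ha, ← hg1 _ a ha]
    exact h a ha

omit [IsAlgClosed K] in
theorem exists_cosets (L₀ : IntermediateField k K) (hL : L₀.FG) :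
    ∃ (ι : Type) (_ : Finite ι) (t : ι → K), AlgebraicIndependent k t ∧
    ∃ L : IntermediateField k K, L.FG ∧ L₀ ≤ L ∧
      (∀ γ : K ≃ₐ[k] K, (∀ i, γ (t i) = t i) → ∀ a ∈ L, γ a ∈ L) ∧
    ∃ (Q : Type) (_ : Fintype Q) (g : Q → (K ≃ₐ[k] K)) (q₀ : Q), g q₀ = 1 ∧
      (∀ q i, g q (t i) = t i) ∧
      (∀ γ : K ≃ₐ[k] K, (∀ i, γ (t i) = t i) →
        ∃ π : Equiv.Perm Q, ∀ q, ∀ a ∈ L, γ (g q a) = g (π q) a) ∧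
      ∀ q q', (∀ a ∈ L, g q a = g q' a) → q = q' := by
  classical
  obtain ⟨S, hS, rfl⟩ := fg_def.1 hL
  obtain ⟨B, hB⟩ := (AlgebraicIndependent.matroid k K).exists_isBasis S
  rw [AlgebraicIndependent.matroid_isBasis_iff] at hB
  obtain ⟨hB1, hB2, hB3⟩ := hB
  have fB : Finite B := hS.subset hB2
  obtain ⟨Q, _, g, q₀, hq, hg, hπ, -⟩ := exists_cosets_aux S B hS hB2 hB3
  let S' : Set K := ⋃ q, (g q) '' S
  have hS' : S'.Finite := Set.finite_iUnion fun q => hS.image _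
  have hSS' : S ⊆ S' := by
    intro a ha
    exact Set.mem_iUnion.2 ⟨q₀, a, ha, by rw [hq]; rfl⟩
  have hfix : ∀ γ : K ≃ₐ[k] K, (∀ i : B, γ i = i) → ∀ a ∈ Algebra.adjoin k B, γ a = a := by
    intro γ hγ a ha
    exact adjoin_fixed γ (fun b hb => hγ ⟨b, hb⟩) a (algebra_adjoin_le_adjoin k B ha)
  have halg : ∀ x ∈ S', IsAlgebraic (Algebra.adjoin k B) x := by
    intro x hx
    obtain ⟨q, y, hy, rfl⟩ := Set.mem_iUnion.1 hx
    obtain ⟨P, hP0, hP⟩ := hB3 y hy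
    refine ⟨P, hP0, ?_⟩
    have h1 := congrArg (g q) hP
    rw [map_zero, Polynomial.aeval_def, Polynomial.eval₂_eq_sum, Polynomial.sum_def, map_sum] at h1
    rw [← h1, Polynomial.aeval_def, Polynomial.eval₂_eq_sum, Polynomial.sum_def]
    refine Finset.sum_congr rfl fun i _ => ?_
    rw [map_mul, map_pow]
    congr 1
    exact (hfix _ (hg q) _ (P.coeff i).2).symm
  refine ⟨B, fB, (↑), hB1, adjoin k S', fg_adjoin_of_finite hS', adjoin.mono _ _ _ hSS', ?_,
    exists_cosets_aux S' B hS' (hB2.trans hSS') halg⟩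
  intro γ hγ a ha
  have hle : adjoin k S' ≤ (adjoin k S').comap γ.toAlgHom := by
    rw [adjoin_le_iff]
    intro b hb
    obtain ⟨q, y, hy, rfl⟩ := Set.mem_iUnion.1 hb
    obtain ⟨π, h⟩ := hπ γ hγ
    change γ (g q y) ∈ adjoin k S'
    rw [h q y (subset_adjoin _ _ hy)]
    exact subset_adjoin _ _ (Set.mem_iUnion.2 ⟨π q, y, hy, rfl⟩)
  exact hle ha

end WD
end

section
namespace WD

theorem exists_specialization {k L K R : Type} [Field k] [Infinite k] [Field L] [Algebra k L]
    [Field K] [Algebra L K] [IsAlgClosed K] [CommRing R] [IsDomain R] [Algebra L R]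
    [Algebra.FiniteType L R] {ι : Type} [Finite ι] (s : ι → R) (hs : AlgebraicIndependent L s) :
    ∃ (s₀ : ι → k) (ev : R →ₐ[L] K), ∀ i, ev (s i) = algebraMap L K (algebraMap k L (s₀ i)) := by
  let f : (MvPolynomial ι L) →ₐ[L] R := MvPolynomial.aeval s
  have hf : Function.Injective f := algebraicIndependent_iff_injective_aeval.1 hs
  have fp : f.toRingHom.FinitePresentation := by
    refine (RingHom.FinitePresentation.of_finiteType).1 ?_
    exact RingHom.FiniteType.of_comp_finiteType (f := algebraMap L (MvPolynomial ι L))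
      (by rw [show (f.toRingHom).comp (algebraMap L (MvPolynomial ι L)) = algebraMap L R from f.comp_algebraMap]
          exact RingHom.finiteType_algebraMap.2 ‹_›)
  obtain ⟨S, hS⟩ := PrimeSpectrum.exists_constructibleSetData_iff.2
    (PrimeSpectrum.isConstructible_range_comap fp)
  have h0 : (⊥ : PrimeSpectrum (MvPolynomial ι L)) ∈ S.toSet := by
    rw [hS]
    refine ⟨⊥, ?_⟩
    ext a
    simpa using map_eq_zero_iff f hf
  simp only [PrimeSpectrum.ConstructibleSetData.toSet, Set.mem_iUnion] at h0
  obtain ⟨C, hC, h1, h2⟩ := h0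
  have h3 : C.f ≠ 0 := by
    intro h
    apply h2
    simp [h]
  have h4 : ∀ P : PrimeSpectrum (MvPolynomial ι L), C.f ∉ P.asIdeal → P ∈ S.toSet := by
    intro P hP
    simp only [PrimeSpectrum.ConstructibleSetData.toSet, Set.mem_iUnion]
    refine ⟨C, hC, ?_, by simpa [PrimeSpectrum.mem_zeroLocus] using hP⟩
    rw [PrimeSpectrum.mem_zeroLocus] at h1 ⊢
    intro a ha
    have : a = 0 := by simpa using h1 ha
    rw [this]; exact zero_mem _
  obtain ⟨s₀, hs₀⟩ : ∃ s₀ : ι → k, MvPolynomial.eval (fun i => algebraMap k L (s₀ i)) C.f ≠ 0 := by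
    by_contra! hcon
    apply h3
    refine MvPolynomial.funext_set (fun _ => Set.range (algebraMap k L))
      (fun _ => Set.infinite_range_of_injective (algebraMap k L).injective) ?_
    intro x hx
    simp only [Set.mem_pi, Set.mem_univ, forall_const, Set.mem_range] at hx
    choose y hy using hx
    have : x = fun i => algebraMap k L (y i) := funext fun i => (hy i).symm
    rw [this, hcon]; simp
  let ev0 : (MvPolynomial ι L) →+* L := MvPolynomial.eval (fun i => algebraMap k L (s₀ i))
  have : (RingHom.ker ev0).IsPrime := RingHom.ker_isPrime _
  obtain ⟨q, hq⟩ := by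
    have := h4 ⟨RingHom.ker ev0, this⟩ hs₀
    rw [hS] at this
    exact this
  obtain ⟨m, hm, hqm⟩ := Ideal.exists_le_maximal q.asIdeal q.2.ne_top
  have hmem : ∀ i, s i - algebraMap L R (algebraMap k L (s₀ i)) ∈ m := by
    intro i
    apply hqm
    have h5 : (MvPolynomial.X i - MvPolynomial.C (algebraMap k L (s₀ i)) : (MvPolynomial ι L)) ∈ RingHom.ker ev0 := by
      simp [ev0, RingHom.mem_ker]
    have h6 : (PrimeSpectrum.comap f.toRingHom q).asIdeal = RingHom.ker ev0 :=
      congrArg PrimeSpectrum.asIdeal hq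
    rw [← h6] at h5
    have h7 : f (MvPolynomial.X i - MvPolynomial.C (algebraMap k L (s₀ i))) ∈ q.asIdeal := h5
    simpa [f, MvPolynomial.algebraMap_eq] using h7
  let := Ideal.Quotient.field m
  have : Algebra.FiniteType L (R ⧸ m) :=
    Algebra.FiniteType.of_surjective (Ideal.Quotient.mkₐ L m) Ideal.Quotient.mk_surjective
  have : Module.Finite L (R ⧸ m) := finite_of_finite_type_of_isJacobsonRing L (R ⧸ m)
  let φ : (R ⧸ m) →ₐ[L] K := IsAlgClosed.lift
  refine ⟨s₀, φ.comp (Ideal.Quotient.mkₐ L m), fun i => ?_⟩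
  have h8 := Ideal.Quotient.eq.2 (hmem i)
  have h9 : Ideal.Quotient.mkₐ L m (s i) = algebraMap L (R ⧸ m) (algebraMap k L (s₀ i)) := h8
  rw [AlgHom.comp_apply, h9, AlgHom.commutes]

end WD
end

section
namespace WD
open IntermediateField

variable {k K F : Type} [Field k] [Field K] [Algebra k K] [Field F] [Algebra K F]

/-- The fixed subfield. -/
def FF (ρ : (K ≃ₐ[k] K) →* RingAut F) (Γ : Subgroup (K ≃ₐ[k] K)) : Subfield F where
  carrier := {f | ∀ σ ∈ Γ, ρ σ f = f}
  mul_mem' ha hb σ hσ := by rw [map_mul, ha σ hσ, hb σ hσ]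
  one_mem' σ _ := map_one _
  add_mem' ha hb σ hσ := by rw [map_add, ha σ hσ, hb σ hσ]
  zero_mem' σ _ := map_zero _
  neg_mem' ha σ hσ := by rw [map_neg, ha σ hσ]
  inv_mem' _ ha σ hσ := by rw [map_inv₀, ha σ hσ]

theorem mem_FF {ρ : (K ≃ₐ[k] K) →* RingAut F} {Γ : Subgroup (K ≃ₐ[k] K)} {f : F} :
    f ∈ FF ρ Γ ↔ ∀ σ ∈ Γ, ρ σ f = f := Iff.rfl

theorem FF_anti {ρ : (K ≃ₐ[k] K) →* RingAut F} {Γ Γ' : Subgroup (K ≃ₐ[k] K)} (h : Γ ≤ Γ') :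
    FF ρ Γ' ≤ FF ρ Γ := fun _ hf σ hσ => hf σ (h hσ)

variable (ρ : (K ≃ₐ[k] K) →* RingAut F)
  (hρ : ∀ σ c, ρ σ (algebraMap K F c) = algebraMap K F (σ c))

include hρ in
theorem rho_smul (σ : K ≃ₐ[k] K) (c : K) (v : F) : ρ σ (c • v) = σ c • ρ σ v := by
  rw [Algebra.smul_def, map_mul, hρ, Algebra.smul_def]

variable (Γ : Subgroup (K ≃ₐ[k] K)) {N : Type} [Field N] [Algebra N K] [Algebra N F]
  [IsScalarTower N K F]
  (hN : ∀ a : K, (∀ σ ∈ Γ, σ a = a) → a ∈ Set.range (algebraMap N K))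

include hρ hN in
theorem linInd_of_fixed {ι : Type} (v : ι → F) (hv : ∀ i, v i ∈ FF ρ Γ)
    (hl : LinearIndependent N v) : LinearIndependent K v := by
  classical
  rw [linearIndependent_iff']
  intro s
  induction s using Finset.induction_on with
  | empty => simp
  | insert j s hj ih =>
    intro c hc
    by_cases h0 : c j = 0
    · rw [Finset.sum_insert hj, h0, zero_smul, zero_add] at hc
      intro i hi
      rcases Finset.mem_insert.1 hi with rfl | hi
      · exact h0
      · exact ih c hc i hi
    · exfalso
      let d : ι → K := fun i => (c j)⁻¹ * c i
      have hd : ∑ i ∈ insert j s, d i • v i = 0 := by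
        simp only [d, mul_smul, ← Finset.smul_sum, hc, smul_zero]
      have hdj : d j = 1 := inv_mul_cancel₀ h0
      have hfix : ∀ σ ∈ Γ, ∀ i ∈ insert j s, σ (d i) = d i := by
        intro σ hσ
        have h1 : ∑ i ∈ insert j s, σ (d i) • v i = 0 := by
          have := congrArg (ρ σ) hd
          rw [map_sum, map_zero] at this
          rw [← this]
          refine Finset.sum_congr rfl fun i _ => ?_
          rw [rho_smul ρ hρ, hv i σ hσ]
        have h2 : ∑ i ∈ s, (σ (d i) - d i) • v i = 0 := by
          have h3 : ∑ i ∈ insert j s, (σ (d i) - d i) • v i = 0 := by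
            simp only [sub_smul, Finset.sum_sub_distrib, h1, hd, sub_zero]
          rw [Finset.sum_insert hj, hdj] at h3
          simpa using h3
        have h4 := ih _ h2
        intro i hi
        rcases Finset.mem_insert.1 hi with rfl | hi
        · rw [hdj, map_one]
        · exact sub_eq_zero.1 (h4 i hi)
      have h5 : ∀ i, ∃ n : N, i ∈ insert j s → algebraMap N K n = d i := by
        intro i
        by_cases hi : i ∈ insert j s
        · obtain ⟨n, hn⟩ := hN (d i) (fun σ hσ => hfix σ hσ i hi)
          exact ⟨n, fun _ => hn⟩
        · exact ⟨0, fun h => (hi h).elim⟩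
      choose e he using h5
      have h6 : ∑ i ∈ insert j s, e i • v i = 0 := by
        rw [← hd]
        refine Finset.sum_congr rfl fun i hi => ?_
        rw [← he i hi, algebraMap_smul]
      have h7 := linearIndependent_iff'.1 hl _ _ h6 j (Finset.mem_insert_self _ _)
      have h8 := he j (Finset.mem_insert_self _ _)
      rw [h7, map_zero, hdj] at h8
      exact zero_ne_one h8

include hρ hN in
theorem span_fixed (W : Submodule K F) (hW : ∀ σ ∈ Γ, ∀ w ∈ W, ρ σ w ∈ W)
    (S : Set F) (hS : ∀ v ∈ S, v ∈ FF ρ Γ) (hWS : W ≤ Submodule.span K S) :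
    W ≤ Submodule.span K {w | w ∈ W ∧ w ∈ Submodule.span N S} := by
  obtain ⟨b, hbS, hbspan, hbind⟩ := exists_linearIndependent K (W.mkQ '' S)
  have hch : ∀ x : b, ∃ v, v ∈ S ∧ W.mkQ v = x := fun x => hbS x.2
  choose v hvS hv using hch
  have hind : ∀ l : b →₀ K, l.sum (fun i c => c • v i) ∈ W → l = 0 := by
    intro l hl
    rw [linearIndependent_iff] at hbind
    apply hbind
    have : W.mkQ (l.sum (fun i c => c • v i)) = 0 := by
      simpa using hl
    rw [Finsupp.linearCombination_apply, ← this, Finsupp.sum, Finsupp.sum, map_sum]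
    refine Finset.sum_congr rfl fun i _ => ?_
    rw [map_smul, hv]
  -- every vector of `S` is congruent to an `N`-combination of the `v i`
  have hred : ∀ s ∈ S, ∃ w, (w ∈ W ∧ w ∈ Submodule.span N S) ∧
      ∃ l : b →₀ K, s = w + l.sum (fun i c => c • v i) := by
    intro s hs
    have h1 : W.mkQ s ∈ Submodule.span K b := by
      rw [hbspan]; exact Submodule.subset_span ⟨s, hs, rfl⟩
    rw [← Subtype.range_coe (s := b), Finsupp.mem_span_range_iff_exists_finsupp] at h1
    obtain ⟨l, hl⟩ := h1
    have h2 : s - l.sum (fun i c => c • v i) ∈ W := by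
      refine (Submodule.Quotient.mk_eq_zero W).1 ?_
      change W.mkQ _ = 0
      rw [map_sub, ← hl, Finsupp.sum, Finsupp.sum, map_sum, sub_eq_zero]
      refine Finset.sum_congr rfl fun i _ => ?_
      rw [map_smul, hv]
    have h3 : ∀ σ ∈ Γ, ∀ i, σ (l i) = l i := by
      intro σ hσ
      have h4 := hW σ hσ _ h2
      rw [map_sub, hS s hs σ hσ, Finsupp.sum, map_sum] at h4
      have h5 : ∑ i ∈ l.support, (σ (l i) - l i) • v i ∈ W := by
        have := W.sub_mem h2 h4
        convert! this using 1
        simp only [sub_smul, Finset.sum_sub_distrib, rho_smul ρ hρ, hS _ (hvS _) σ hσ, Finsupp.sum]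
        ring
      let l' : b →₀ K := l.mapRange (fun c => σ c - c) (by simp)
      have h6 : l' = 0 := by
        apply hind
        rw [Finsupp.sum_mapRange_index (by simp)]
        exact h5
      intro i
      have := DFunLike.congr_fun h6 i
      exact sub_eq_zero.1 (by simpa [l'] using this)
    refine ⟨_, ⟨h2, ?_⟩, l, by ring⟩
    refine Submodule.sub_mem _ (Submodule.subset_span hs) (Submodule.sum_mem _ fun i _ => ?_)
    obtain ⟨n, hn⟩ := hN (l i) (fun σ hσ => h3 σ hσ i)
    dsimp only
    rw [← hn, algebraMap_smul]
    exact Submodule.smul_mem _ _ (Submodule.subset_span (hvS i))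
  intro x hx
  have key : ∀ y ∈ Submodule.span K S, ∃ w ∈ Submodule.span K {w | w ∈ W ∧ w ∈ Submodule.span N S},
      ∃ l : b →₀ K, y = w + l.sum (fun i c => c • v i) := by
    intro y hy
    induction hy using Submodule.span_induction with
    | mem y hy =>
      obtain ⟨w, hw, l, hl⟩ := hred y hy
      exact ⟨w, Submodule.subset_span hw, l, hl⟩
    | zero => exact ⟨0, zero_mem _, 0, by simp⟩
    | add y z _ _ h1 h2 =>
      obtain ⟨w, hw, l, rfl⟩ := h1
      obtain ⟨w', hw', l', rfl⟩ := h2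
      refine ⟨w + w', add_mem hw hw', l + l', ?_⟩
      rw [Finsupp.sum_add_index' (by simp) (by intros; rw [add_smul])]
      ring
    | smul a y _ h1 =>
      obtain ⟨w, hw, l, rfl⟩ := h1
      refine ⟨a • w, Submodule.smul_mem _ _ hw, a • l, ?_⟩
      rw [Finsupp.sum_smul_index' (by simp), smul_add, Finsupp.smul_sum]
      simp only [smul_assoc]
  obtain ⟨w, hw, l, rfl⟩ := key x (hWS hx)
  have hw' : w ∈ W := Submodule.span_le.2 (fun _ h => h.1) hw
  have : l = 0 := hind l (by simpa using W.sub_mem hx hw')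
  rw [this]
  simpa using hw

include hρ in
theorem speiser (L : IntermediateField k K) {Q : Type} [Fintype Q] (g : Q → (K ≃ₐ[k] K)) (q₀ : Q)
    (hq₀ : g q₀ = 1) (hinj : ∀ q q', (∀ a ∈ L, g q a = g q' a) → q = q') (v : F) :
    v ∈ Submodule.span K {w | ∃ c ∈ L, w = ∑ q, ρ (g q) (algebraMap K F c * v)} := by
  classical
  let u : L → (Q → K) := fun c q => g q c
  have hspan : Submodule.span K (Set.range u) = ⊤ := by
    by_contra hne
    obtain ⟨f, hf0, hf⟩ := Submodule.exists_le_ker_of_lt_top _ (lt_top_iff_ne_top.2 hne)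
    apply hf0
    have hlin := (linearIndependent_monoidHom L K)
    let m : Q → (L →* K) := fun q => ((g q : K →+* K) : K →* K).comp (L.val : L →* K)
    have hm : Function.Injective m := by
      intro q q' h
      exact hinj q q' fun a ha => DFunLike.congr_fun h ⟨a, ha⟩
    have h1 := hlin.comp m hm
    rw [Fintype.linearIndependent_iff] at h1
    have h2 := h1 (fun q => f (Pi.single q 1)) (by
      ext c
      have h3 : f (u c) = 0 := hf (Submodule.subset_span ⟨c, rfl⟩)
      rw [pi_eq_sum_univ' (u c), map_sum] at h3
      rw [Pi.zero_apply, ← h3, Finset.sum_apply]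
      refine Finset.sum_congr rfl fun q _ => ?_
      rw [map_smul]
      simp [m, u, mul_comm])
    refine LinearMap.pi_ext' fun q => ?_
    ext
    simpa using h2 q
  let T : (Q → K) →ₗ[K] F :=
    { toFun := fun a => ∑ q, a q • ρ (g q) v
      map_add' := fun a b => by simp [add_smul, Finset.sum_add_distrib]
      map_smul' := fun c a => by simp [mul_smul, Finset.smul_sum] }
  have h4 : T (Pi.single q₀ 1) = v := by
    simp only [T, LinearMap.coe_mk, AddHom.coe_mk]
    rw [Finset.sum_eq_single q₀]
    · simp [hq₀]
    · intro q _ hq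
      simp [hq]
    · simp
  have h5 : T (Pi.single q₀ 1) ∈ (Submodule.span K (Set.range u)).map T := by
    rw [hspan]; exact ⟨_, trivial, rfl⟩
  rw [h4, Submodule.map_span] at h5
  refine Submodule.span_mono ?_ h5
  rintro _ ⟨_, ⟨c, rfl⟩, rfl⟩
  refine ⟨c, c.2, ?_⟩
  simp only [T, LinearMap.coe_mk, AddHom.coe_mk, u]
  refine Finset.sum_congr rfl fun q _ => ?_
  rw [map_mul, hρ, Algebra.smul_def]

end WD
end

section
namespace WD
open IntermediateField

section Rings
variable (K : Type) {F : Type} [Field K] [Field F] [Algebra K F]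

/-- The `K`-subalgebra generated by `S`, as a subring. -/
def Kc (S : Set F) : Subring F := Subring.closure (Set.range (algebraMap K F) ∪ S)

/-- The chart ring `K[f / e : f ∈ S]`. -/
def BE (S : Set F) (e : F) : Subring F := Kc K ((fun f => f / e) '' S)

/-- The localization `B[1/a]` inside `F`. -/
def loc (B : Subring F) (a : F) : Subring F := B ⊔ Subring.closure {a⁻¹}

variable {K}

theorem algebraMap_mem_Kc (S : Set F) (c : K) : algebraMap K F c ∈ Kc K S :=
  Subring.subset_closure (Or.inl ⟨c, rfl⟩)

theorem subset_Kc (S : Set F) : S ⊆ Kc K S :=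
  fun _ h => Subring.subset_closure (Or.inr h)

theorem Kc_le {S : Set F} {B : Subring F} (h1 : ∀ c, algebraMap K F c ∈ B) (h2 : S ⊆ B) :
    Kc K S ≤ B := by
  rw [Kc, Subring.closure_le]
  rintro x (⟨c, rfl⟩ | h)
  · exact h1 c
  · exact h2 h

theorem algebraMap_mem_BE (S : Set F) (e : F) (c : K) : algebraMap K F c ∈ BE K S e :=
  algebraMap_mem_Kc _ c

theorem div_mem_BE {S : Set F} (e : F) {f : F} (hf : f ∈ S) : f / e ∈ BE K S e :=
  subset_Kc _ ⟨f, hf, rfl⟩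

theorem BE_le {S : Set F} {e : F} {B : Subring F} (h1 : ∀ c, algebraMap K F c ∈ B)
    (h2 : ∀ f ∈ S, f / e ∈ B) : BE K S e ≤ B := by
  refine Kc_le h1 ?_
  rintro _ ⟨f, hf, rfl⟩
  exact h2 f hf

theorem BE_span (S : Set F) (e : F) : BE K (Submodule.span K S : Set F) e = BE K S e := by
  apply le_antisymm
  · refine BE_le (algebraMap_mem_BE S e) ?_
    intro f hf
    induction hf using Submodule.span_induction with
    | mem f hf => exact div_mem_BE e hf
    | zero => rw [zero_div]; exact zero_mem _
    | add f g _ _ hf hg => rw [add_div]; exact add_mem hf hg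
    | smul c f _ hf =>
      rw [Algebra.smul_def, mul_div_assoc]
      exact mul_mem (algebraMap_mem_BE S e c) hf
  · exact BE_le (algebraMap_mem_BE _ e) fun f hf => div_mem_BE e (Submodule.subset_span hf)

theorem le_loc (B : Subring F) (a : F) : B ≤ loc B a := le_sup_left

theorem inv_mem_loc (B : Subring F) (a : F) : a⁻¹ ∈ loc B a :=
  (le_sup_right : _ ≤ loc B a) (Subring.subset_closure rfl)

theorem loc_le {B C : Subring F} {a : F} (h1 : B ≤ C) (h2 : a⁻¹ ∈ C) : loc B a ≤ C :=
  sup_le h1 (by rw [Subring.closure_le]; rintro _ rfl; exact h2)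

theorem mem_loc {B : Subring F} {a : F} (ha : a ∈ B) (ha0 : a ≠ 0) {f : F} (hf : f ∈ loc B a) :
    ∃ n : ℕ, a ^ n * f ∈ B := by
  let R : Subring F :=
    { carrier := {f | ∃ n : ℕ, a ^ n * f ∈ B}
      mul_mem' := by
        rintro x y ⟨n, hn⟩ ⟨m, hm⟩
        refine ⟨n + m, ?_⟩
        have := mul_mem hn hm
        rwa [show a ^ (n + m) * (x * y) = a ^ n * x * (a ^ m * y) by ring]
      one_mem' := ⟨0, by simp⟩
      add_mem' := by
        rintro x y ⟨n, hn⟩ ⟨m, hm⟩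
        refine ⟨n + m, ?_⟩
        have := add_mem (mul_mem (pow_mem ha m) hn) (mul_mem (pow_mem ha n) hm)
        rwa [show a ^ (n + m) * (x + y) = a ^ m * (a ^ n * x) + a ^ n * (a ^ m * y) by ring]
      zero_mem' := ⟨0, by simp⟩
      neg_mem' := by
        rintro x ⟨n, hn⟩
        exact ⟨n, by rw [mul_neg]; exact neg_mem hn⟩ }
  have : loc B a ≤ R := loc_le (fun x hx => ⟨0, by simpa using hx⟩) ⟨1, by
    rw [pow_one, mul_inv_cancel₀ ha0]; exact one_mem _⟩
  exact this hf

theorem loc_BE (E : Set F) {e d : F} (he : e ∈ E) (hd : d ∈ E) (he0 : e ≠ 0) (hd0 : d ≠ 0) :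
    loc (BE K E d) (e / d) = loc (BE K E e) (d / e) := by
  have key : ∀ {e d : F}, e ∈ E → d ∈ E → e ≠ 0 → d ≠ 0 →
      loc (BE K E d) (e / d) ≤ loc (BE K E e) (d / e) := by
    intro e d he hd he0 hd0
    refine loc_le (BE_le (fun c => le_loc _ _ (algebraMap_mem_BE _ _ c)) fun f hf => ?_) ?_
    · have := mul_mem (le_loc _ (d / e) (div_mem_BE (K := K) e hf)) (inv_mem_loc (BE K E e) (d / e))
      rwa [show f / e * (d / e)⁻¹ = f / d by field_simp] at this
    · rw [inv_div]
      exact le_loc _ _ (div_mem_BE e hd)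
  exact le_antisymm (key he hd he0 hd0) (key hd he hd0 he0)

/-- Membership is local for a family generating the unit ideal. -/
theorem mem_of_loc {B : Subring F} {ι : Type} [Fintype ι] {a c : ι → F} (ha : ∀ i, a i ∈ B)
    (ha0 : ∀ i, a i ≠ 0) (hc : ∀ i, c i ∈ B) (h1 : ∑ i, c i * a i = 1) {f : F}
    (hf : ∀ i, f ∈ loc B (a i)) : f ∈ B := by
  let I : Ideal B :=
    { carrier := {b | (b : F) * f ∈ B}
      add_mem' := by
        intro x y hx hy
        change ((x + y : B) : F) * f ∈ B
        rw [Subring.coe_add, add_mul]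
        exact add_mem hx hy
      zero_mem' := by
        change ((0 : B) : F) * f ∈ B
        rw [Subring.coe_zero, zero_mul]; exact zero_mem _
      smul_mem' := by
        intro x y hy
        change ((x * y : B) : F) * f ∈ B
        rw [Subring.coe_mul, mul_assoc]
        exact mul_mem x.2 hy }
  have hI : I = ⊤ := by
    by_contra hne
    obtain ⟨M, hM, hIM⟩ := Ideal.exists_le_maximal I hne
    apply hM.ne_top
    rw [Ideal.eq_top_iff_one]
    have h2 : (1 : B) = ∑ i, (⟨c i, hc i⟩ : B) * ⟨a i, ha i⟩ := by
      apply Subtype.ext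
      push_cast
      exact h1.symm
    rw [h2]
    refine Ideal.sum_mem _ fun i _ => Ideal.mul_mem_left _ _ ?_
    obtain ⟨n, hn⟩ := mem_loc (ha i) (ha0 i) (hf i)
    refine hM.isPrime.mem_of_pow_mem n (hIM ?_)
    change (((⟨a i, ha i⟩ : B) ^ n : B) : F) * f ∈ B
    push_cast
    exact hn
  have : (1 : B) ∈ I := by rw [hI]; trivial
  have h : ((1 : B) : F) * f ∈ B := this
  simpa using h

end Rings

variable {k K F : Type} [Field k] [Field K] [Algebra k K] [Field F] [Algebra K F]

/-- Abstract properties of the affine opens of an integral separated scheme with group action: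
`P B y` says that `B` is the coordinate ring of an affine open containing `y`. -/
structure ChartSys (ρ : (K ≃ₐ[k] K) →* RingAut F) where
  pt : Type
  P : Subring F → pt → Prop
  act : (K ≃ₐ[k] K) → pt → pt
  act_surj : ∀ σ, Function.Surjective (act σ)
  frac : ∀ B y, P B y → ∀ f : F, ∃ a ∈ B, ∃ b ∈ B, b ≠ 0 ∧ f = a / b
  basic : ∀ B, (∃ y, P B y) → ∀ a ∈ B, a ≠ 0 → ∃ y, P (loc B a) y
  basic_le : ∀ B, (∃ y, P B y) → ∀ a ∈ B, a ≠ 0 → ∀ y, P (loc B a) y → P B y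
  cover : ∀ B y, P B y → ∀ {ι : Type} [Fintype ι] (a c : ι → F), (∀ i, a i ∈ B) →
    (∀ i, a i ≠ 0) → (∀ i, c i ∈ B) → ∑ i, c i * a i = 1 → ∃ i, P (loc B (a i)) y
  glue : ∀ B : Subring F, (∀ c, algebraMap K F c ∈ B) → ∀ {ι : Type} [Fintype ι] (a c : ι → F),
    (∀ i, a i ∈ B) →
    (∀ i, a i ≠ 0) → (∀ i, c i ∈ B) → ∑ i, c i * a i = 1 → (∀ i, ∃ y, P (loc B (a i)) y) →
    ∃ y, P B y
  equi : ∀ σ B y, P B y → P (B.map (ρ σ : F →+* F)) (act σ y)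
  inter : ∀ B B' y, P B y → P B' y → P (B ⊔ B') y
  inter_ne : ∀ B B', (∃ y, P B y) → (∃ y, P B' y) → ∃ y, P (B ⊔ B') y
  cert : ∀ A, (∃ y, P A y) → ∀ J : Set (Subring F), (∀ y, P A y → ∃ B ∈ J, P B y) →
    ∃ (ι : Type) (_ : Fintype ι) (a c : ι → F), (∀ i, a i ∈ A) ∧ (∀ i, a i ≠ 0) ∧
      (∀ i, c i ∈ A) ∧ ∑ i, c i * a i = 1 ∧
      ∀ i, ∃ B ∈ J, ∃ b ∈ B, b ≠ 0 ∧ loc A (a i) = loc B b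

variable {ρ : (K ≃ₐ[k] K) →* RingAut F}

/-- Chart systems on `Y` made from `S` with denominators `J`. -/
structure Geo (C : ChartSys ρ) (S J : Set F) : Prop where
  sub : J ⊆ S
  nz : ∀ e ∈ J, e ≠ 0
  ch : ∀ e ∈ J, ∃ y, C.P (BE K S e) y
  cov : ∀ y, ∃ e ∈ J, C.P (BE K S e) y

/-- The elements of `S` are regular. -/
def Reg (K : Type) [Field K] [Algebra K F] (S J : Set F) : Prop := ∀ e ∈ J, S ⊆ BE K S e

/-- Subgroup fixing the tuple `t`. -/
def H {ι : Type} (t : ι → K) : Subgroup (K ≃ₐ[k] K) where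
  carrier := {σ | ∀ i, σ (t i) = t i}
  mul_mem' := by
    intro a b ha hb i
    rw [AlgEquiv.mul_apply, hb i, ha i]
  one_mem' := fun i => rfl
  inv_mem' := by
    intro a ha i
    rw [AlgEquiv.aut_inv, AlgEquiv.symm_apply_eq, ha i]

theorem mem_H {ι : Type} {t : ι → K} {σ : K ≃ₐ[k] K} : σ ∈ H t ↔ ∀ i, σ (t i) = t i := Iff.rfl

theorem BE_map (hρ : ∀ σ c, ρ σ (algebraMap K F c) = algebraMap K F (σ c)) (σ : K ≃ₐ[k] K)
    (S : Set F) (e : F) :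
    (BE K S e).map (ρ σ : F →+* F) = BE K (ρ σ '' S) (ρ σ e) := by
  rw [BE, BE, Kc, Kc, RingHom.map_closure]
  congr 1
  ext x
  constructor
  · rintro ⟨_, (⟨c, rfl⟩ | ⟨f, hf, rfl⟩), rfl⟩
    · exact Or.inl ⟨σ c, (hρ σ c).symm⟩
    · exact Or.inr ⟨ρ σ f, ⟨f, hf, rfl⟩, (map_div₀ (ρ σ : F →+* F) f e).symm⟩
  · rintro (⟨c, rfl⟩ | ⟨_, ⟨f, hf, rfl⟩, rfl⟩)
    · refine ⟨algebraMap K F (σ.symm c), Or.inl ⟨_, rfl⟩, ?_⟩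
      change ρ σ _ = _
      rw [hρ, AlgEquiv.apply_symm_apply]
    · exact ⟨f / e, Or.inr ⟨f, hf, rfl⟩, map_div₀ (ρ σ : F →+* F) f e⟩

/-- Sets of products. -/
def Nm (ρ : (K ≃ₐ[k] K) →* RingAut F) {Q : Type} [Fintype Q] (g : Q → (K ≃ₐ[k] K)) (S : Set F) :
    Set F := {u | ∃ φ : Q → F, (∀ q, φ q ∈ S) ∧ u = ∏ q, ρ (g q) (φ q)}

theorem BE_Nm (hρ : ∀ σ c, ρ σ (algebraMap K F c) = algebraMap K F (σ c))
    {Q : Type} [Fintype Q] (g : Q → (K ≃ₐ[k] K)) (S : Set F)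
    (ψ : Q → F) (hψ : ∀ q, ψ q ∈ S) (hψ0 : ∀ q, ψ q ≠ 0) (q₀ : Q) :
    BE K (Nm ρ g S) (∏ q, ρ (g q) (ψ q)) =
      ⨆ q, (BE K S (ψ q)).map (ρ (g q) : F →+* F) := by
  classical
  have h0 : ∀ q, ρ (g q) (ψ q) ≠ 0 := fun q => by
    rw [Ne, EmbeddingLike.map_eq_zero_iff]; exact hψ0 q
  have le : ∀ q, (BE K S (ψ q)).map (ρ (g q) : F →+* F) ≤
      ⨆ q, (BE K S (ψ q)).map (ρ (g q) : F →+* F) := le_iSup _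
  apply le_antisymm
  · refine BE_le ?_ ?_
    · intro c
      refine le q₀ ?_
      rw [BE_map hρ]
      exact algebraMap_mem_BE _ _ c
    · rintro _ ⟨φ, hφ, rfl⟩
      rw [← Finset.prod_div_distrib]
      refine Subring.prod_mem _ fun q _ => le q ?_
      exact ⟨φ q / ψ q, div_mem_BE _ (hφ q), map_div₀ (ρ (g q) : F →+* F) _ _⟩
  · refine iSup_le fun q => ?_
    rw [BE_map hρ]
    refine BE_le (algebraMap_mem_BE _ _) ?_
    rintro _ ⟨f, hf, rfl⟩
    have : ρ (g q) f / ρ (g q) (ψ q) =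
        (∏ q', ρ (g q') (Function.update ψ q f q')) / ∏ q', ρ (g q') (ψ q') := by
      rw [← Finset.prod_div_distrib, Finset.prod_eq_single q]
      · simp
      · intro q' _ hq'
        rw [Function.update_of_ne hq', div_self (h0 q')]
      · simp
    rw [this]
    refine div_mem_BE _ ⟨_, ?_, rfl⟩
    intro q'
    by_cases h : q' = q
    · subst h; simpa using hf
    · rw [Function.update_of_ne h]; exact hψ q'

theorem inter_fin (C : ChartSys ρ) {Q : Type} [Fintype Q] (q₀ : Q) (B : Q → Subring F) :
    (∀ y, (∀ q, C.P (B q) y) → C.P (⨆ q, B q) y) ∧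
    ((∀ q, ∃ y, C.P (B q) y) → ∃ y, C.P (⨆ q, B q) y) := by
  classical
  have key : ∀ s : Finset Q, s.Nonempty →
      (∀ y, (∀ q, C.P (B q) y) → C.P (⨆ q ∈ s, B q) y) ∧
      ((∀ q, ∃ y, C.P (B q) y) → ∃ y, C.P (⨆ q ∈ s, B q) y) := by
    intro s hs
    induction hs using Finset.Nonempty.cons_induction with
    | singleton a => simpa using ⟨fun y h => h a, fun h => h a⟩
    | cons a s ha hs ih =>
      simp only [Finset.mem_cons, iSup_or, iSup_sup_eq, iSup_iSup_eq_left]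
      exact ⟨fun y h => C.inter _ _ _ (h a) (ih.1 y h), fun h => C.inter_ne _ _ (h a) (ih.2 h)⟩
  simpa using key Finset.univ ⟨q₀, Finset.mem_univ _⟩

theorem norm_geo (C : ChartSys ρ)
    (hρ : ∀ σ c, ρ σ (algebraMap K F c) = algebraMap K F (σ c))
    {Q : Type} [Fintype Q] (g : Q → (K ≃ₐ[k] K)) (q₀ : Q) {S J : Set F} (hG : Geo C S J) :
    Geo C (Nm ρ g S) (Nm ρ g J) ∧ (Reg K S J → Reg K (Nm ρ g S) (Nm ρ g J)) ∧
    (1 ∈ S → 1 ∈ Nm ρ g S) ∧ (1 ∈ J → 1 ∈ Nm ρ g J) := by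
  refine ⟨⟨?_, ?_, ?_, ?_⟩, ?_, fun h => ⟨fun _ => 1, fun _ => h, by simp⟩,
    fun h => ⟨fun _ => 1, fun _ => h, by simp⟩⟩
  · rintro _ ⟨φ, hφ, rfl⟩
    exact ⟨φ, fun q => hG.sub (hφ q), rfl⟩
  · rintro _ ⟨φ, hφ, rfl⟩
    refine Finset.prod_ne_zero_iff.2 fun q _ => ?_
    rw [Ne, EmbeddingLike.map_eq_zero_iff]
    exact hG.nz _ (hφ q)
  · rintro _ ⟨φ, hφ, rfl⟩
    rw [BE_Nm hρ g S φ (fun q => hG.sub (hφ q)) (fun q => hG.nz _ (hφ q)) q₀]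
    refine (inter_fin C q₀ _).2 fun q => ?_
    obtain ⟨y, hy⟩ := hG.ch _ (hφ q)
    exact ⟨_, C.equi _ _ _ hy⟩
  · intro y
    choose z hz using fun q => C.act_surj (g q) y
    choose φ hφ hP using fun q => hG.cov (z q)
    refine ⟨_, ⟨φ, hφ, rfl⟩, ?_⟩
    rw [BE_Nm hρ g S φ (fun q => hG.sub (hφ q)) (fun q => hG.nz _ (hφ q)) q₀]
    refine (inter_fin C q₀ _).1 y fun q => ?_
    have := C.equi (g q) _ _ (hP q)
    rwa [hz] at this
  · rintro hR _ ⟨φ, hφ, rfl⟩ _ ⟨ψ, hψ, rfl⟩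
    rw [BE_Nm hρ g S φ (fun q => hG.sub (hφ q)) (fun q => hG.nz _ (hφ q)) q₀]
    refine Subring.prod_mem _ fun q _ => ?_
    refine le_iSup (fun q => (BE K S (φ q)).map (ρ (g q) : F →+* F)) q ?_
    exact ⟨ψ q, hR _ (hφ q) (hψ q), rfl⟩

end WD
end

section
namespace WD
open IntermediateField

variable {k K F : Type} [Field k] [Field K] [Algebra k K] [Field F] [Algebra K F]
variable {ρ : (K ≃ₐ[k] K) →* RingAut F}

theorem exists_of_two (C : ChartSys ρ) (E : Submodule K F) {e d : F} (he : e ∈ E) (hd : d ∈ E)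
    (he0 : e ≠ 0) (hd0 : d ≠ 0) (h : ∃ y, C.P (BE K (E : Set F) e) y) :
    ∃ y, C.P (loc (BE K (E : Set F) d) (e / d)) y := by
  rw [loc_BE (E : Set F) he hd he0 hd0]
  exact C.basic _ h _ (div_mem_BE e hd) (div_ne_zero hd0 he0)

/-- The space of admissible denominators. -/
def I1 (C : ChartSys ρ) (E : Submodule K F) (p : Prop) : Submodule K F where
  carrier := {e | e ∈ E ∧ (e ≠ 0 → (∃ y, C.P (BE K (E : Set F) e) y) ∧
    (p → (E : Set F) ⊆ BE K (E : Set F) e))}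
  zero_mem' := ⟨zero_mem _, fun h => (h rfl).elim⟩
  add_mem' := by
    rintro e e' ⟨he, he1⟩ ⟨he', he1'⟩
    by_cases h0 : e = 0
    · subst h0; rw [zero_add]; exact ⟨he', he1'⟩
    by_cases h0' : e' = 0
    · subst h0'; rw [add_zero]; exact ⟨he, he1⟩
    refine ⟨add_mem he he', fun hd0 => ?_⟩
    have hd : e + e' ∈ E := add_mem he he'
    generalize hdd : e + e' = d at *
    let a : Bool → F := fun b => cond b (e / d) (e' / d)
    let c : Bool → F := fun _ => 1
    have ha : ∀ i, a i ∈ BE K (E : Set F) d := by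
      rintro (_ | _)
      · exact div_mem_BE d he'
      · exact div_mem_BE d he
    have ha0 : ∀ i, a i ≠ 0 := by
      rintro (_ | _)
      · exact div_ne_zero h0' hd0
      · exact div_ne_zero h0 hd0
    have hc : ∀ i, c i ∈ BE K (E : Set F) d := fun _ => one_mem _
    have h1 : ∑ i, c i * a i = 1 := by
      simp only [c, a, Fintype.sum_bool, one_mul, cond_true, cond_false]
      rw [← add_div, hdd, div_self hd0]
    refine ⟨?_, fun hp f hf => ?_⟩
    · refine C.glue _ (algebraMap_mem_BE _ _) a c ha ha0 hc h1 ?_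
      rintro (_ | _)
      · exact exists_of_two C E he' hd h0' hd0 (he1' h0').1
      · exact exists_of_two C E he hd h0 hd0 (he1 h0).1
    · refine mem_of_loc ha ha0 hc h1 ?_
      rintro (_ | _)
      · change f ∈ loc _ (e' / d)
        rw [loc_BE (E : Set F) he' hd h0' hd0]
        exact le_loc _ _ ((he1' h0').2 hp hf)
      · change f ∈ loc _ (e / d)
        rw [loc_BE (E : Set F) he hd h0 hd0]
        exact le_loc _ _ ((he1 h0).2 hp hf)
  smul_mem' := by
    rintro c e ⟨he, he1⟩
    refine ⟨E.smul_mem c he, fun h => ?_⟩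
    have hc : c ≠ 0 := fun h' => h (by rw [h', zero_smul])
    have he0 : e ≠ 0 := fun h' => h (by rw [h', smul_zero])
    have key : BE K (E : Set F) (c • e) = BE K (E : Set F) e := by
      have hc' : algebraMap K F c ≠ 0 := by simpa using hc
      apply le_antisymm
      · refine BE_le (algebraMap_mem_BE _ _) fun f hf => ?_
        have := mul_mem (algebraMap_mem_BE (E : Set F) e c⁻¹) (div_mem_BE (K := K) e hf)
        rw [map_inv₀] at this
        rwa [Algebra.smul_def, show f / (algebraMap K F c * e) = (algebraMap K F c)⁻¹ * (f / e) by
          field_simp]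
      · refine BE_le (algebraMap_mem_BE _ _) fun f hf => ?_
        have := mul_mem (algebraMap_mem_BE (E : Set F) (c • e) c) (div_mem_BE (K := K) (c • e) hf)
        rw [Algebra.smul_def] at this ⊢
        rwa [show algebraMap K F c * (f / (algebraMap K F c * e)) = (f / e) by
          field_simp] at this
    rw [key]
    exact he1 he0

variable (hρ : ∀ σ c, ρ σ (algebraMap K F c) = algebraMap K F (σ c))
include hρ

theorem E_image {E : Submodule K F} {σ : K ≃ₐ[k] K} (h : ∀ e ∈ E, ρ σ e ∈ E)
    (h' : ∀ e ∈ E, ρ σ⁻¹ e ∈ E) : ρ σ '' (E : Set F) = E := by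
  ext x
  constructor
  · rintro ⟨e, he, rfl⟩; exact h e he
  · intro hx
    refine ⟨ρ σ⁻¹ x, h' x hx, ?_⟩
    rw [map_inv]
    exact (ρ σ).apply_symm_apply x

theorem I1_stable (C : ChartSys ρ) (E : Submodule K F) (p : Prop) (σ : K ≃ₐ[k] K)
    (h : ∀ e ∈ E, ρ σ e ∈ E) (h' : ∀ e ∈ E, ρ σ⁻¹ e ∈ E) : ∀ e ∈ I1 C E p, ρ σ e ∈ I1 C E p := by
  rintro e ⟨he, he1⟩
  refine ⟨h e he, fun h0 => ?_⟩
  have he0 : e ≠ 0 := fun hh => h0 (by rw [hh, map_zero])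
  obtain ⟨⟨y, hy⟩, h2⟩ := he1 he0
  have key := BE_map hρ σ (E : Set F) e
  rw [E_image hρ h h'] at key
  refine ⟨⟨_, key ▸ C.equi σ _ _ hy⟩, fun hp f hf => ?_⟩
  rw [← key]
  rw [← E_image hρ h h'] at hf
  obtain ⟨f', hf', rfl⟩ := hf
  exact ⟨f', h2 hp hf', rfl⟩

theorem step12 [IsAlgClosed K] [CharZero k]
    (htr : ∀ L : IntermediateField k K, L.FG → ∃ x : K, Transcendental L x)
    (C : ChartSys ρ) {S J : Set F} (hG : Geo C S J) (hS : S.Finite)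
    (hcont : ∀ f : F, ∃ L : IntermediateField k K, L.FG ∧
      ∀ σ : K ≃ₐ[k] K, (∀ x ∈ L, σ x = x) → ρ σ f = f) :
    ∃ (ι : Type) (_ : Finite ι) (t : ι → K), AlgebraicIndependent k t ∧
      ∃ S' J' : Set F, S'.Finite ∧ Geo C S' J' ∧ (∀ f ∈ S', f ∈ FF ρ (H t)) ∧
        (Reg K S J → Reg K S' J') ∧ (1 ∈ S → 1 ∈ S') ∧ (1 ∈ J → 1 ∈ J') := by
  classical
  -- a common field of definition
  have hL : ∃ L : IntermediateField k K, L.FG ∧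
      ∀ f ∈ S, ∀ σ : K ≃ₐ[k] K, (∀ x ∈ L, σ x = x) → ρ σ f = f := by
    choose L hL1 hL2 using hcont
    have : ∀ s : Finset F, ∃ M : IntermediateField k K, M.FG ∧ ∀ f ∈ s, L f ≤ M := by
      intro s
      induction s using Finset.induction_on with
      | empty => exact ⟨⊥, fg_bot, by simp⟩
      | insert a s _ ih =>
        obtain ⟨M, hM, h⟩ := ih
        refine ⟨L a ⊔ M, fg_sup (hL1 a) hM, ?_⟩
        intro f hf
        rcases Finset.mem_insert.1 hf with rfl | hf
        · exact le_sup_left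
        · exact (h f hf).trans le_sup_right
    obtain ⟨M, hM, h⟩ := this hS.toFinset
    exact ⟨M, hM, fun f hf σ hσ => hL2 f σ fun x hx => hσ x (h f (hS.mem_toFinset.2 hf) hx)⟩
  obtain ⟨L₀, hL₀, hSL₀⟩ := hL
  obtain ⟨ι, hι, t, ht, L, hLFG, hLL, hLst, Q, hQ, g, q₀, hq₀, hgt, hπ, hinj⟩ := exists_cosets L₀ hL₀
  have hSL : ∀ f ∈ S, ∀ σ : K ≃ₐ[k] K, (∀ x ∈ L, σ x = x) → ρ σ f = f :=
    fun f hf σ hσ => hSL₀ f hf σ fun x hx => hσ x (hLL hx)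
  refine ⟨ι, hι, t, ht, ?_⟩
  obtain ⟨hG1, hR1, h11, h12⟩ := norm_geo C hρ g q₀ hG
  generalize hS1 : Nm ρ g S = S1 at *
  generalize hJ1 : Nm ρ g J = J1 at *
  -- two automorphisms which agree on `L` agree on elements fixed by `Aut(K/L)`
  have agree : ∀ f : F, (∀ σ : K ≃ₐ[k] K, (∀ x ∈ L, σ x = x) → ρ σ f = f) → ∀ α β : K ≃ₐ[k] K,
      (∀ a ∈ L, α a = β a) → ρ α f = ρ β f := by
    intro f hf α β h
    have := hf (β⁻¹ * α) (fun x hx => by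
      rw [AlgEquiv.mul_apply, h x hx]; exact β.symm_apply_apply x)
    rw [map_mul, map_inv] at this
    have h2 := congrArg (ρ β) this
    rw [← h2]
    exact ((ρ β).apply_symm_apply _).symm
  have hstab : ∀ γ ∈ H t, ∀ f ∈ S1, ρ γ f ∈ S1 := by
    intro γ hγ f hf
    rw [← hS1] at hf ⊢
    obtain ⟨φ, hφ, rfl⟩ := hf
    obtain ⟨π, h⟩ := hπ γ hγ
    refine ⟨φ ∘ π.symm, fun q => hφ _, ?_⟩
    rw [map_prod]
    refine Eq.trans ?_ (Equiv.prod_comp π _)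
    refine Finset.prod_congr rfl fun q _ => ?_
    simp only [Function.comp, Equiv.symm_apply_apply]
    rw [← agree (φ q) (hSL _ (hφ q)) (γ * g q) (g (π q)) (h q), map_mul]
    rfl
  have hS1L : ∀ f ∈ S1, ∀ σ : K ≃ₐ[k] K, (∀ x ∈ L, σ x = x) → ρ σ f = f := by
    intro f hf σ hσ
    rw [← hS1] at hf
    obtain ⟨φ, hφ, rfl⟩ := hf
    rw [map_prod]
    refine Finset.prod_congr rfl fun q _ => ?_
    have := agree (φ q) (hSL _ (hφ q)) (σ * g q) (g q) ?_
    · rw [map_mul] at this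
      exact this
    · intro a ha
      exact hσ _ (hLst _ (hgt q) a ha)
  let E := Submodule.span K S1
  have hEstab : ∀ γ ∈ H t, ∀ f ∈ E, ρ γ f ∈ E := by
    intro γ hγ f hf
    induction hf using Submodule.span_induction with
    | mem f hf => exact Submodule.subset_span (hstab γ hγ f hf)
    | zero => rw [map_zero]; exact zero_mem _
    | add f g _ _ hf hg => rw [map_add]; exact add_mem hf hg
    | smul c f _ hf => rw [rho_smul ρ hρ]; exact Submodule.smul_mem _ _ hf
  let T : Set F := {w | w ∈ E ∧ w ∈ FF ρ (H t)}
  have hET : E ≤ Submodule.span K T := by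
    refine Submodule.span_le.2 fun f hf => ?_
    refine Submodule.span_mono ?_ (speiser ρ hρ L g q₀ hq₀ hinj f)
    rintro _ ⟨c, hc, rfl⟩
    refine ⟨Submodule.sum_mem _ fun q _ => hEstab _ (hgt q) _ ?_, fun γ hγ => ?_⟩
    · rw [← Algebra.smul_def]
      exact Submodule.smul_mem _ _ (Submodule.subset_span hf)
    · obtain ⟨π, h⟩ := hπ γ hγ
      rw [map_sum]
      refine Eq.trans ?_ (Equiv.sum_comp π _)
      refine Finset.sum_congr rfl fun q _ => ?_
      have := agree (algebraMap K F c * f) ?_ (γ * g q) (g (π q)) (h q)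
      · rw [map_mul ρ] at this
        exact this
      · intro σ hσ
        rw [map_mul, hρ, hσ c hc, hS1L f hf σ hσ]
  have hfgE : E.FG := by
    refine Submodule.fg_span ?_
    rw [← hS1]
    have h1 : {φ : Q → F | ∀ q, φ q ∈ S}.Finite := Set.Finite.pi' fun _ => hS
    refine (h1.image (fun φ => ∏ q, ρ (g q) (φ q))).subset ?_
    rintro _ ⟨φ, hφ, rfl⟩
    exact ⟨φ, hφ, rfl⟩
  let N := adjoin k (Set.range t)
  have hN : ∀ a : K, (∀ σ ∈ H (k := k) t, σ a = a) → a ∈ Set.range (algebraMap N K) := by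
    intro a ha
    have := fixed_mem htr N (fg_range t) a (fun σ hσ => ha σ fun i => hσ _ (subset_adjoin _ _ ⟨i, rfl⟩))
    exact ⟨⟨a, this⟩, rfl⟩
  let I := I1 C E (Reg K S J)
  have hIE : I ≤ E := fun e he => he.1
  have hJ1I : ∀ e ∈ J1, e ∈ I := by
    intro e he
    refine ⟨Submodule.subset_span (hG1.sub he), fun _ => ?_⟩
    rw [BE_span]
    refine ⟨hG1.ch e he, fun hp => ?_⟩
    intro f hf
    have hf' : f ∈ E := hf
    have hx := hR1 hp e he
    clear hf
    induction hf' using Submodule.span_induction with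
    | mem f hf => exact hx hf
    | zero => exact zero_mem _
    | add f g h1 h2 hf hg => exact add_mem hf hg
    | smul c f h1 hf =>
      rw [Algebra.smul_def]
      exact mul_mem (algebraMap_mem_BE _ _ c) hf
  let T' : Set F := {w | w ∈ I ∧ w ∈ FF ρ (H t)}
  have hIT : I ≤ Submodule.span K T' := by
    refine (span_fixed ρ hρ (H t) (N := N) hN I ?_ T (fun v hv => hv.2) (hIE.trans hET)).trans ?_
    · intro σ hσ
      exact I1_stable hρ C E _ σ (hEstab σ hσ) (hEstab _ (inv_mem hσ))
    · refine Submodule.span_mono ?_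
      rintro w ⟨hw, hw'⟩
      refine ⟨hw, fun σ hσ => ?_⟩
      clear hw
      induction hw' using Submodule.span_induction with
      | mem f hf => exact hf.2 σ hσ
      | zero => exact map_zero _
      | add f g _ _ hf hg => rw [map_add, hf, hg]
      | smul c f _ hf =>
        rw [Algebra.smul_def, map_mul, hf, IsScalarTower.algebraMap_apply N K F, hρ]
        congr 2
        exact adjoin_fixed σ (by rintro _ ⟨i, rfl⟩; exact hσ i) _ c.2
  have hET' : Submodule.span K T = E := le_antisymm (Submodule.span_le.2 fun _ h => h.1) hET
  have hIT' : Submodule.span K T' = I := le_antisymm (Submodule.span_le.2 fun _ h => h.1) hIT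
  have hfgI : I.FG := by
    have : FiniteDimensional K E := Module.Finite.iff_fg.2 hfgE
    have h2 : Module.Finite K I := FiniteDimensional.of_injective (Submodule.inclusion hIE)
      (Submodule.inclusion_injective hIE)
    exact Module.Finite.iff_fg.1 h2
  obtain ⟨TE, hTE, hTEs⟩ := (Submodule.fg_span_iff_fg_span_finset_subset T).1 (hET'.symm ▸ hfgE)
  obtain ⟨TI, hTI, hTIs⟩ := (Submodule.fg_span_iff_fg_span_finset_subset T').1 (hIT'.symm ▸ hfgI)
  let J2 : Set F := {e | e ≠ 0 ∧ (e ∈ TI ∨ e = 1 ∧ (1 : F) ∈ I)}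
  let S2 : Set F := {e | e ∈ TE ∨ e ∈ J2 ∨ e = 1 ∧ (1 : F) ∈ E}
  have hJ2 : ∀ e ∈ J2, e ∈ I ∧ e ∈ FF ρ (H t) := by
    rintro e ⟨-, he | ⟨rfl, he⟩⟩
    · exact hTI he
    · exact ⟨he, one_mem _⟩
  have hS2 : ∀ e ∈ S2, e ∈ E ∧ e ∈ FF ρ (H t) := by
    rintro e (he | he | ⟨rfl, he⟩)
    · exact hTE he
    · exact ⟨hIE (hJ2 e he).1, (hJ2 e he).2⟩
    · exact ⟨he, one_mem _⟩
  have hspan : Submodule.span K S2 = E := by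
    apply le_antisymm (Submodule.span_le.2 fun _ h => (hS2 _ h).1)
    rw [← hET', hTEs]
    exact Submodule.span_mono fun _ h => Or.inl h
  have hBE : ∀ e, BE K S2 e = BE K (E : Set F) e := by
    intro e; rw [← hspan, BE_span]
  refine ⟨S2, J2, ?_, ⟨?_, ?_, ?_, ?_⟩, fun f hf => (hS2 f hf).2, ?_, ?_, ?_⟩
  · refine ((TE ∪ TI ∪ {1} : Finset F).finite_toSet).subset ?_
    rintro e (he | ⟨-, he | ⟨rfl, -⟩⟩ | ⟨rfl, -⟩)
    · simp [Finset.mem_coe.1 he]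
    · simp [Finset.mem_coe.1 he]
    · simp
    · simp
  · exact fun e he => Or.inr (Or.inl he)
  · exact fun e he => he.1
  · intro e he
    rw [hBE]
    exact ((hJ2 e he).1.2 he.1).1
  · intro y
    obtain ⟨e, he, hy⟩ := hG1.cov y
    rw [← BE_span] at hy
    have heI : e ∈ Submodule.span K (TI : Set F) := by
      rw [← hTIs, hIT']; exact hJ1I e he
    have he0 := hG1.nz e he
    have heE : e ∈ E := hIE (hJ1I e he)
    obtain ⟨c, hc⟩ := Submodule.mem_span_finset.1 heI
    let TI' := TI.filter (· ≠ 0)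
    have hsum : ∑ i : TI', (algebraMap K F (c i)) * (i.1 / e) = 1 := by
      have h1 : ∑ i ∈ TI', c i • i = e := by
        rw [← hc.2]
        refine Finset.sum_subset (Finset.filter_subset _ _) ?_
        intro x hx hx'
        have : x = 0 := by
          by_contra h
          exact hx' (Finset.mem_filter.2 ⟨hx, h⟩)
        rw [this, smul_zero]
      rw [← Finset.sum_coe_sort] at h1
      rw [← div_self he0]
      nth_rewrite 2 [← h1]
      rw [Finset.sum_div]
      refine Finset.sum_congr rfl fun i _ => ?_
      rw [Algebra.smul_def, mul_div_assoc]
    have hi0 : ∀ i : TI', (i : F) ≠ 0 := fun i => (Finset.mem_filter.1 i.2).2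
    have hiI : ∀ i : TI', (i : F) ∈ I := fun i => (hTI (Finset.mem_filter.1 i.2).1).1
    obtain ⟨i, hi⟩ := C.cover _ y hy (fun i : TI' => i.1 / e) (fun i => algebraMap K F (c i))
      (fun i => div_mem_BE e (hIE (hiI i))) (fun i => div_ne_zero (hi0 i) he0)
      (fun i => algebraMap_mem_BE _ _ _) hsum
    have heE' : e ∈ (Submodule.span K S1 : Set F) := heE
    rw [loc_BE _ (hIE (hiI i)) heE' (hi0 i) he0] at hi
    refine ⟨i, ⟨hi0 i, Or.inl (Finset.mem_filter.1 i.2).1⟩, ?_⟩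
    rw [hBE]
    exact C.basic_le _ ((hiI i).2 (hi0 i)).1 _ (div_mem_BE _ heE') (div_ne_zero he0 (hi0 i)) _ hi
  · intro hR e he f hf
    rw [hBE]
    exact ((hJ2 e he).1.2 he.1).2 hR (hS2 f hf).1
  · intro h
    exact Or.inr (Or.inr ⟨rfl, Submodule.subset_span (h11 h)⟩)
  · intro h
    exact ⟨one_ne_zero, Or.inr ⟨rfl, hJ1I 1 (h12 h)⟩⟩

end WD
end

section
namespace WD
open IntermediateField

variable {k K F : Type} [Field k] [Field K] [Algebra k K] [Field F] [Algebra K F]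
variable {ρ : (K ≃ₐ[k] K) →* RingAut F}

/-- `k(t)` -/
abbrev kt (k : Type) {K : Type} [Field k] [Field K] [Algebra k K] {ι : Type} (t : ι → K) :
    IntermediateField k K := adjoin k (Set.range t)

theorem H_fix {ι : Type} {t : ι → K} {σ : K ≃ₐ[k] K} (hσ : σ ∈ H t) : ∀ a ∈ kt k t, σ a = a :=
  adjoin_fixed σ (by rintro _ ⟨i, rfl⟩; exact hσ i)

theorem H_mem [IsAlgClosed K] [CharZero k]
    (htr : ∀ L : IntermediateField k K, L.FG → ∃ x : K, Transcendental L x)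
    {ι : Type} [Finite ι] (t : ι → K) :
    ∀ a : K, (∀ σ ∈ H (k := k) t, σ a = a) → a ∈ Set.range (algebraMap (kt k t) K) := by
  intro a ha
  have := fixed_mem htr (kt k t) (fg_range t) a
    (fun σ hσ => ha σ fun i => hσ _ (subset_adjoin _ _ ⟨i, rfl⟩))
  exact ⟨⟨a, this⟩, rfl⟩

section
variable (hρ : ∀ σ c, ρ σ (algebraMap K F c) = algebraMap K F (σ c))
include hρ

theorem algebraMap_mem_FF {ι : Type} {t : ι → K} {a : K} (ha : a ∈ kt k t) :
    algebraMap K F a ∈ FF ρ (H t) := by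
  intro σ hσ
  rw [hρ, H_fix hσ a ha]

theorem span_mem_FF {ι : Type} {t : ι → K} {S : Set F} (hS : ∀ f ∈ S, f ∈ FF ρ (H t)) {f : F}
    (hf : f ∈ Submodule.span (kt k t) S) : f ∈ FF ρ (H t) := by
  induction hf using Submodule.span_induction with
  | mem f hf => exact hS f hf
  | zero => exact zero_mem _
  | add f g _ _ hf hg => exact add_mem hf hg
  | smul c f _ hf =>
    rw [Algebra.smul_def, IsScalarTower.algebraMap_apply (kt k t) K F]
    exact mul_mem (algebraMap_mem_FF hρ c.2) hf

/-- Linear disjointness: tuples algebraically independent over `k(u)` are so over `F^{H u}`. -/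
theorem poly_eq_zero [IsAlgClosed K] [CharZero k]
    (htr : ∀ L : IntermediateField k K, L.FG → ∃ x : K, Transcendental L x)
    {ι κ : Type} [Finite κ] (u : κ → K) (s : ι → K) (hs : AlgebraicIndependent (kt k u) s)
    (P : MvPolynomial ι F) (hP : ∀ m, P.coeff m ∈ FF ρ (H u))
    (h0 : P.eval (fun i => algebraMap K F (s i)) = 0) : P = 0 := by
  classical
  let V := Submodule.span (kt k u) (P.support.image P.coeff : Set F)
  let b := Module.Basis.ofVectorSpace (kt k u) V
  have hfin : Module.Finite (kt k u) V := Module.Finite.span_of_finite _ (Finset.finite_toSet _)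
  have : Fintype (Module.Basis.ofVectorSpaceIndex (kt k u) V) :=
    FiniteDimensional.fintypeBasisIndex b
  have hbF : ∀ i, (b i : F) ∈ FF ρ (H u) := by
    intro i
    refine span_mem_FF hρ ?_ (b i).2
    intro f hf
    obtain ⟨m, -, rfl⟩ := Finset.mem_image.1 hf
    exact hP m
  have hbind : LinearIndependent K (fun i => (b i : F)) := by
    refine linInd_of_fixed ρ hρ (H u) (H_mem htr u) _ hbF ?_
    exact b.linearIndependent.map' V.subtype (by simp)
  have hc : ∀ m : ι →₀ ℕ, P.coeff m ∈ V := by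
    intro m
    by_cases hm : m ∈ P.support
    · exact Submodule.subset_span (Finset.mem_coe.2 (Finset.mem_image_of_mem _ hm))
    · rw [MvPolynomial.notMem_support_iff.1 hm]; exact zero_mem _
  let n : (ι →₀ ℕ) → _ → kt k u := fun m i => b.repr ⟨P.coeff m, hc m⟩ i
  have hn : ∀ m, P.coeff m = ∑ i, (n m i : K) • (b i : F) := by
    intro m
    have := congrArg Subtype.val (b.sum_repr ⟨P.coeff m, hc m⟩)
    refine Eq.trans this.symm ?_
    simp only [Submodule.coe_sum, Submodule.coe_smul]
    rfl
  let Pi : _ → MvPolynomial ι (kt k u) := fun i => ∑ m ∈ P.support, MvPolynomial.monomial m (n m i)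
  have h1 : ∑ i, (MvPolynomial.aeval s (Pi i)) • (b i : F) = 0 := by
    rw [← h0, MvPolynomial.eval_eq]
    simp only [Pi, map_sum, MvPolynomial.aeval_monomial, Finset.sum_smul, hn, Finset.sum_mul]
    rw [Finset.sum_comm]
    refine Finset.sum_congr rfl fun m _ => Finset.sum_congr rfl fun i _ => ?_
    rw [Finsupp.prod, Algebra.smul_def, Algebra.smul_def, map_mul, map_prod]
    simp only [map_pow]
    change algebraMap K F (n m i : K) * _ * _ = _
    ring
  have h2 : ∀ i, Pi i = 0 := by
    intro i
    have h3 := Fintype.linearIndependent_iff.1 hbind _ h1 i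
    exact (algebraicIndependent_iff.1 hs) _ h3
  have h3 : ∀ m ∈ P.support, ∀ i, n m i = 0 := by
    intro m hm i
    have := congrArg (MvPolynomial.coeff m) (h2 i)
    rw [MvPolynomial.coeff_zero, MvPolynomial.coeff_sum] at this
    simp only [MvPolynomial.coeff_monomial] at this
    rw [Finset.sum_ite_eq' ] at this
    simpa [hm] using this
  ext m
  rw [MvPolynomial.coeff_zero]
  by_cases hm : m ∈ P.support
  · rw [hn]; simp [h3 m hm]
  · exact MvPolynomial.notMem_support_iff.1 hm

end

theorem Kc_eq_span (A : Subring F) : ∀ f, f ∈ Kc K (A : Set F) → f ∈ Submodule.span K (A : Set F) := by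
  intro f hf
  have hmul : ∀ x y, x ∈ Submodule.span K (A : Set F) → y ∈ Submodule.span K (A : Set F) →
      x * y ∈ Submodule.span K (A : Set F) := by
    intro x y hx hy
    have := Submodule.mul_mem_mul hx hy
    rw [Submodule.span_mul_span] at this
    refine Submodule.span_mono ?_ this
    rintro _ ⟨a, ha, b, hb, rfl⟩
    exact A.mul_mem ha hb
  have h1 : (1 : F) ∈ Submodule.span K (A : Set F) := Submodule.subset_span A.one_mem
  induction hf using Subring.closure_induction with
  | mem x hx =>
    rcases hx with ⟨c, rfl⟩ | hx
    · rw [Algebra.algebraMap_eq_smul_one]; exact Submodule.smul_mem _ _ h1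
    · exact Submodule.subset_span hx
  | zero => exact zero_mem _
  | one => exact h1
  | add x y _ _ hx hy => exact add_mem hx hy
  | neg x _ hx => exact neg_mem hx
  | mul x y _ _ hx hy => exact hmul x y hx hy

/-- A rational function fixed by `H s` is a rational function in `s` over `F^{H t}`. -/
theorem mem_closure_of_fixed (hρ : ∀ σ c, ρ σ (algebraMap K F c) = algebraMap K F (σ c))
    [IsAlgClosed K] [CharZero k]
    (htr : ∀ L : IntermediateField k K, L.FG → ∃ x : K, Transcendental L x)
    {ι : Type} [Finite ι] (t s : ι → K)
    (hfrac : ∀ f : F, ∃ a ∈ Submodule.span K (FF ρ (H t) : Set F),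
      ∃ b ∈ Submodule.span K (FF ρ (H t) : Set F), b ≠ 0 ∧ f = a / b)
    (x : F) (hx : x ∈ FF ρ (H s)) :
    x ∈ Subfield.closure ((FF ρ (H t) : Set F) ∪ Set.range (fun i => algebraMap K F (s i))) := by
  let u : ι ⊕ ι → K := Sum.elim t s
  let V := Submodule.span K (FF ρ (H t) : Set F)
  have hut : ∀ σ ∈ H (k := k) u, σ ∈ H t := fun σ hσ i => hσ (Sum.inl i)
  have hus : ∀ σ ∈ H (k := k) u, σ ∈ H s := fun σ hσ i => hσ (Sum.inr i)
  have hVst : ∀ σ ∈ H u, ∀ w ∈ V, ρ σ w ∈ V := by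
    intro σ hσ w hw
    induction hw using Submodule.span_induction with
    | mem f hf => rw [hf σ (hut σ hσ)]; exact Submodule.subset_span hf
    | zero => rw [map_zero]; exact zero_mem _
    | add f g _ _ hf hg => rw [map_add]; exact add_mem hf hg
    | smul c f _ hf => rw [rho_smul ρ hρ]; exact Submodule.smul_mem _ _ hf
  let W : Submodule K F :=
    { carrier := {w | w ∈ V ∧ w * x ∈ V}
      add_mem' := by
        rintro a b ⟨h1, h2⟩ ⟨h3, h4⟩
        exact ⟨add_mem h1 h3, by rw [add_mul]; exact add_mem h2 h4⟩
      zero_mem' := ⟨zero_mem _, by rw [zero_mul]; exact zero_mem _⟩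
      smul_mem' := by
        rintro c a ⟨h1, h2⟩
        exact ⟨V.smul_mem c h1, by rw [smul_mul_assoc]; exact V.smul_mem c h2⟩ }
  have hfix : ∀ v ∈ (FF ρ (H t) : Set F), v ∈ FF ρ (H u) := fun v hv σ hσ => hv σ (hut σ hσ)
  have hWst : ∀ σ ∈ H u, ∀ w ∈ W, ρ σ w ∈ W := by
    rintro σ hσ w ⟨h1, h2⟩
    refine ⟨hVst σ hσ w h1, ?_⟩
    have := hVst σ hσ _ h2
    rwa [map_mul, hx σ (hus σ hσ)] at this
  let N := kt k u
  -- elements fixed by `H u`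
  have key : ∀ v ∈ V, v ∈ FF ρ (H u) → v ∈ Submodule.span N (FF ρ (H t) : Set F) := by
    intro v hv hvu
    by_cases hv0 : v = 0
    · rw [hv0]; exact zero_mem _
    have h1 := span_fixed ρ hρ (H u) (N := N) (H_mem htr u) (Submodule.span K {v}) (by
      intro σ hσ w hw
      obtain ⟨c, rfl⟩ := Submodule.mem_span_singleton.1 hw
      rw [rho_smul ρ hρ, hvu σ hσ]
      exact Submodule.smul_mem _ _ (Submodule.mem_span_singleton_self v)) (FF ρ (H t) : Set F) hfix
      (by rw [Submodule.span_singleton_le_iff_mem]; exact hv)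
    have h2 : ∃ w ≠ 0, w ∈ Submodule.span K {v} ∧ w ∈ Submodule.span N (FF ρ (H t) : Set F) := by
      by_contra hcon
      push Not at hcon
      apply hv0
      have h3 := h1 (Submodule.mem_span_singleton_self v)
      have h4 : Submodule.span K {w | w ∈ Submodule.span K {v} ∧
          w ∈ Submodule.span N (FF ρ (H t) : Set F)} ≤ ⊥ := by
        refine Submodule.span_le.2 fun w hw => ?_
        by_contra hw0
        exact hcon w hw0 hw.1 hw.2
      simpa using h4 h3
    obtain ⟨w, hw0, hw1, hw2⟩ := h2
    obtain ⟨c, rfl⟩ := Submodule.mem_span_singleton.1 hw1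
    have hc0 : c ≠ 0 := fun h => hw0 (by rw [h, zero_smul])
    have hcf : ∀ σ ∈ H (k := k) u, σ c = c := by
      intro σ hσ
      have h5 := span_mem_FF hρ hfix hw2 σ hσ
      rw [rho_smul ρ hρ, hvu σ hσ] at h5
      exact smul_left_injective K hv0 h5
    obtain ⟨n, hn⟩ := H_mem htr u c hcf
    have h6 := Submodule.smul_mem _ n⁻¹ hw2
    rw [← hn, algebraMap_smul, smul_smul, inv_mul_cancel₀, one_smul] at h6
    · exact h6
    · rintro rfl
      exact hc0 (by rw [← hn, map_zero])
  let Φ := Subfield.closure ((FF ρ (H t) : Set F) ∪ Set.range (fun i => algebraMap K F (s i)))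
  have hΦ1 : (FF ρ (H t) : Set F) ⊆ Φ := fun f hf => Subfield.subset_closure (Or.inl hf)
  have hNΦ : ∀ n ∈ N, algebraMap K F n ∈ Φ := by
    let Ψ : IntermediateField k K :=
      { Φ.comap (algebraMap K F) with
        algebraMap_mem' := fun c => hΦ1 fun σ _ => by rw [hρ, AlgEquiv.commutes] }
    have : N ≤ Ψ := by
      rw [adjoin_le_iff]
      rintro _ ⟨i | i, rfl⟩
      · exact hΦ1 (algebraMap_mem_FF hρ (subset_adjoin k _ ⟨i, rfl⟩))
      · exact Subfield.subset_closure (Or.inr ⟨i, rfl⟩)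
    exact fun n hn => this hn
  have hspanΦ : ∀ f ∈ Submodule.span N (FF ρ (H t) : Set F), f ∈ Φ := by
    intro f hf
    induction hf using Submodule.span_induction with
    | mem f hf => exact hΦ1 hf
    | zero => exact zero_mem _
    | add f g _ _ hf hg => exact add_mem hf hg
    | smul c f _ hf =>
      rw [Algebra.smul_def, IsScalarTower.algebraMap_apply N K F]
      exact mul_mem (hNΦ _ c.2) hf
  obtain ⟨a, ha, b, hb, hb0, hab⟩ := hfrac x
  have hbW : b ∈ W := ⟨hb, by rw [hab, mul_div_cancel₀ _ hb0]; exact ha⟩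
  have h7 := span_fixed ρ hρ (H u) (N := N) (H_mem htr u) W hWst (FF ρ (H t) : Set F) hfix
    (fun w hw => hw.1) hbW
  have h8 : ∃ q ≠ 0, q ∈ W ∧ q ∈ Submodule.span N (FF ρ (H t) : Set F) := by
    by_contra hcon
    push Not at hcon
    apply hb0
    have h4 : Submodule.span K {w | w ∈ W ∧
        w ∈ Submodule.span N (FF ρ (H t) : Set F)} ≤ ⊥ := by
      refine Submodule.span_le.2 fun w hw => ?_
      by_contra hw0
      exact hcon w hw0 hw.1 hw.2
    simpa using h4 h7
  obtain ⟨q, hq0, hqW, hqN⟩ := h8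
  have hp := key _ hqW.2 (mul_mem (span_mem_FF hρ hfix hqN) fun σ hσ => hx σ (hus σ hσ))
  have h9 := div_mem (hspanΦ _ hp) (hspanΦ _ hqN)
  rwa [mul_comm, mul_div_cancel_right₀ _ hq0] at h9

/-- Elements of `F^{H t}[s]` as values of polynomials. -/
theorem exists_poly {ι : Type} (A : Subring F) (s : ι → F) (f : F)
    (hf : f ∈ Subring.closure ((A : Set F) ∪ Set.range s)) :
    ∃ P : MvPolynomial ι F, (∀ m, P.coeff m ∈ A) ∧ P.eval s = f := by
  let θ : MvPolynomial ι A →+* F := MvPolynomial.eval₂Hom A.subtype s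
  have : Subring.closure ((A : Set F) ∪ Set.range s) ≤ θ.range := by
    rw [Subring.closure_le]
    rintro _ (h | ⟨i, rfl⟩)
    · exact ⟨MvPolynomial.C ⟨_, h⟩, by simp [θ]⟩
    · exact ⟨MvPolynomial.X i, by simp [θ]⟩
  obtain ⟨P, hP⟩ := this hf
  refine ⟨P.map A.subtype, fun m => ?_, ?_⟩
  · rw [MvPolynomial.coeff_map]; exact (P.coeff m).2
  · rw [MvPolynomial.eval_map]; exact hP

end WD
end

section
namespace WD
open IntermediateField TensorProduct

section spec0
variable {k L K F : Type} [Field k] [Infinite k] [Field L] [Algebra k L] [Field K] [Algebra L K]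
  [IsAlgClosed K] [Field F] [Algebra K F] [Algebra L F] [IsScalarTower L K F]

/-- the inclusion of `R ⊗ A` into `F`. -/
def muH (A : Subalgebra L F) (R : Subalgebra L K) : (R ⊗[L] A) →ₐ[L] F :=
  Algebra.TensorProduct.lift ((IsScalarTower.toAlgHom L K F).comp R.val) A.val
    (fun _ _ => Commute.all _ _)

/-- the specialization of `R ⊗ A` to `F`. -/
def laH (A : Subalgebra L F) (R : Subalgebra L K) (ev : R →ₐ[L] K) : (R ⊗[L] A) →ₐ[L] F :=
  Algebra.TensorProduct.lift ((IsScalarTower.toAlgHom L K F).comp ev) A.val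
    (fun _ _ => Commute.all _ _)

theorem muH_tmul (A : Subalgebra L F) (R : Subalgebra L K) (r : R) (a : A) :
    muH A R (r ⊗ₜ a) = algebraMap K F r * a := by
  simp [muH]

theorem laH_tmul (A : Subalgebra L F) (R : Subalgebra L K) (ev : R →ₐ[L] K) (r : R) (a : A) :
    laH A R ev (r ⊗ₜ a) = algebraMap K F (ev r) * a := by
  simp [laH]

variable (A : Subalgebra L F)
  (hA : ∀ {ι : Type} (v : ι → F), (∀ i, v i ∈ A) → LinearIndependent L v → LinearIndependent K v)
include hA

theorem muH_inj (R : Subalgebra L K) : Function.Injective (muH A R) := by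
  classical
  let b := Module.Basis.ofVectorSpace L A
  have hb : LinearIndependent K (fun i => (b i : F)) := by
    refine hA _ (fun i => (b i).2) ?_
    exact b.linearIndependent.map' A.val.toLinearMap (LinearMap.ker_eq_bot.2 Subtype.val_injective)
  let B := Algebra.TensorProduct.basis R b
  rw [injective_iff_map_eq_zero]
  intro x hx
  have h1 := B.linearCombination_repr x
  rw [← h1, Finsupp.linearCombination_apply, Finsupp.sum, map_sum] at hx
  have h2 : ∀ i, muH A R (B.repr x i • B i) = (B.repr x i : K) • (b i : F) := by
    intro i
    rw [Algebra.TensorProduct.basis_apply, TensorProduct.smul_tmul', smul_eq_mul, mul_one,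
      muH_tmul, Algebra.smul_def]
  simp only [h2] at hx
  have h3 := linearIndependent_iff'.1 hb _ _ hx
  have h4 : B.repr x = 0 := by
    ext i
    by_cases hi : i ∈ (B.repr x).support
    · exact h3 i hi
    · simpa using hi
  exact B.repr.map_eq_zero_iff.1 h4

theorem exists_W (v : F) (hv : v ∈ Submodule.span K (A : Set F)) (hv0 : v ≠ 0) :
    ∃ W : Set K, W.Finite ∧ ∀ R : Subalgebra L K, W ⊆ R → ∀ ev : R →ₐ[L] K,
      ∃ m, muH A R m = v ∧ laH A R ev m ≠ 0 := by
  classical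
  let b := Module.Basis.ofVectorSpace L A
  have hb : LinearIndependent K (fun i => (b i : F)) := by
    refine hA _ (fun i => (b i).2) ?_
    exact b.linearIndependent.map' A.val.toLinearMap (LinearMap.ker_eq_bot.2 Subtype.val_injective)
  have hsp : v ∈ Submodule.span K (Set.range fun i => (b i : F)) := by
    refine (Submodule.span_le.2 ?_) hv
    intro a ha
    have := b.linearCombination_repr ⟨a, ha⟩
    rw [Finsupp.linearCombination_apply, Finsupp.sum] at this
    have h2 := congrArg Subtype.val this
    change a ∈ Submodule.span K _
    rw [show a = _ from h2.symm]
    rw [AddSubmonoidClass.coe_finset_sum]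
    refine Submodule.sum_mem _ fun i _ => ?_
    change (b.repr ⟨a, ha⟩ i) • (b i : F) ∈ _
    rw [← algebraMap_smul K]
    exact Submodule.smul_mem _ _ (Submodule.subset_span ⟨i, rfl⟩)
  obtain ⟨l, rfl⟩ := (Finsupp.mem_span_range_iff_exists_finsupp).1 hsp
  obtain ⟨j, hj⟩ : ∃ j, l j ≠ 0 := by
    by_contra hcon
    push Not at hcon
    exact hv0 (by rw [show l = 0 from Finsupp.ext hcon]; simp)
  refine ⟨(l.support.image l : Set K) ∪ {(l j)⁻¹}, (Finset.finite_toSet _).union (Set.finite_singleton _), ?_⟩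
  intro R hR ev
  have hlR : ∀ i, l i ∈ R := by
    intro i
    by_cases hi : i ∈ l.support
    · exact hR (Or.inl (Finset.mem_coe.2 (Finset.mem_image_of_mem _ hi)))
    · rw [Finsupp.notMem_support_iff.1 hi]; exact zero_mem _
  refine ⟨∑ i ∈ l.support, (⟨l i, hlR i⟩ : R) ⊗ₜ b i, ?_, ?_⟩
  · rw [map_sum, Finsupp.sum]
    refine Finset.sum_congr rfl fun i _ => ?_
    rw [muH_tmul, Algebra.smul_def]
  · rw [map_sum]
    intro h
    simp only [laH_tmul, ← Algebra.smul_def] at h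
    have h3 := linearIndependent_iff'.1 hb _ _ h j (by simpa using hj)
    have h4 : (⟨l j, hlR j⟩ : R) * ⟨(l j)⁻¹, hR (Or.inr rfl)⟩ = 1 := by
      apply Subtype.ext
      exact mul_inv_cancel₀ hj
    have h5 := congrArg ev h4
    rw [map_mul, h3, zero_mul, map_one] at h5
    exact zero_ne_one h5

theorem spec0 (hfrac : ∀ f : F, ∃ a ∈ Submodule.span K (A : Set F),
      ∃ b ∈ Submodule.span K (A : Set F), b ≠ 0 ∧ f = a / b)
    {ι : Type} [Finite ι] (s : ι → K) (hs : AlgebraicIndependent L s)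
    (T : Set K) (hT : T.Finite) (Z : Set F) (hZ : Z.Finite) :
    ∃ (M : Subring F) (l : F → F) (s₀ : ι → k), l 1 = 1 ∧
      (∀ x ∈ M, ∀ y ∈ M, l (x + y) = l x + l y) ∧
      (∀ x ∈ M, ∀ y ∈ M, l (x * y) = l x * l y) ∧
      (∀ a ∈ A, a ∈ M ∧ l a = a) ∧
      (∀ c ∈ T, algebraMap K F c ∈ M ∧ ∃ c', l (algebraMap K F c) = algebraMap K F c') ∧
      (∀ z ∈ Z, z ≠ 0 → z ∈ M ∧ z⁻¹ ∈ M) ∧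
      (∀ i, algebraMap K F (s i) ∈ M ∧
        l (algebraMap K F (s i)) = algebraMap L F (algebraMap k L (s₀ i))) := by
  classical
  have hz : ∀ z : F, ∃ W : Set K, W.Finite ∧ (z ≠ 0 → ∀ R : Subalgebra L K, W ⊆ R →
      ∀ ev : R →ₐ[L] K, ∃ n d, muH A R n = z * muH A R d ∧ laH A R ev n ≠ 0 ∧
        laH A R ev d ≠ 0) := by
    intro z
    by_cases hz0 : z = 0
    · exact ⟨∅, Set.finite_empty, fun h => (h hz0).elim⟩
    obtain ⟨a, ha, b, hb, hb0, rfl⟩ := hfrac z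
    have ha0 : a ≠ 0 := by rintro rfl; simp at hz0
    obtain ⟨W1, hW1, h1⟩ := exists_W A hA a ha ha0
    obtain ⟨W2, hW2, h2⟩ := exists_W A hA b hb hb0
    refine ⟨W1 ∪ W2, hW1.union hW2, fun _ R hR ev => ?_⟩
    obtain ⟨n, hn, hn0⟩ := h1 R (Set.subset_union_left.trans hR) ev
    obtain ⟨d, hd, hd0⟩ := h2 R (Set.subset_union_right.trans hR) ev
    exact ⟨n, d, by rw [hn, hd, div_mul_cancel₀ _ hb0], hn0, hd0⟩
  choose W hWf hW using hz
  let W0 : Set K := T ∪ Set.range s ∪ ⋃ z ∈ Z, W z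
  have hW0 : W0.Finite := (hT.union (Set.finite_range s)).union (hZ.biUnion fun z _ => hWf z)
  let R : Subalgebra L K := Algebra.adjoin L W0
  have hRft : Algebra.FiniteType L R := by
    rw [← Subalgebra.fg_iff_finiteType]
    exact ⟨hW0.toFinset, by simp [R]⟩
  have hsub : W0 ⊆ R := Algebra.subset_adjoin
  let sR : ι → R := fun i => ⟨s i, hsub (Or.inl (Or.inr ⟨i, rfl⟩))⟩
  have hsR : AlgebraicIndependent L sR :=
    (R.val.algebraicIndependent_iff Subtype.val_injective).1 hs
  obtain ⟨s₀, ev, hev⟩ := exists_specialization (k := k) (K := K) sR hsR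
  let μ := muH A R
  let la := laH A R ev
  have hμ : Function.Injective μ := muH_inj A hA R
  let M : Subring F :=
    { carrier := {x | ∃ n d, la d ≠ 0 ∧ μ n = x * μ d}
      mul_mem' := by
        rintro x y ⟨n, d, hd, h⟩ ⟨n', d', hd', h'⟩
        refine ⟨n * n', d * d', by rw [map_mul]; exact mul_ne_zero hd hd', ?_⟩
        rw [map_mul, map_mul, h, h']; ring
      one_mem' := ⟨1, 1, by simp, by simp⟩
      add_mem' := by
        rintro x y ⟨n, d, hd, h⟩ ⟨n', d', hd', h'⟩
        refine ⟨n * d' + n' * d, d * d', by rw [map_mul]; exact mul_ne_zero hd hd', ?_⟩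
        rw [map_add, map_mul, map_mul, map_mul, h, h']; ring
      zero_mem' := ⟨0, 1, by simp, by simp⟩
      neg_mem' := by
        rintro x ⟨n, d, hd, h⟩
        exact ⟨-n, d, hd, by rw [map_neg, h, neg_mul]⟩ }
  let l : F → F := fun x => if h : x ∈ M then la h.choose / la h.choose_spec.choose else 0
  have hl : ∀ x n d, la d ≠ 0 → μ n = x * μ d → l x = la n / la d := by
    intro x n d hd h
    have hx : x ∈ M := ⟨n, d, hd, h⟩
    have e1 : l x = la hx.choose / la hx.choose_spec.choose := dif_pos hx
    have h1 := hx.choose_spec.choose_spec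
    rw [e1, div_eq_div_iff h1.1 hd, ← map_mul, ← map_mul]
    congr 1
    apply hμ
    rw [map_mul, map_mul, h]
    exact (congrArg (· * μ d) h1.2).trans (by ring)
  refine ⟨M, l, s₀, ?_, ?_, ?_, ?_, ?_, ?_, ?_⟩
  · rw [hl 1 1 1 (by simp) (by simp)]; simp
  · rintro x ⟨n, d, hd, h⟩ y ⟨n', d', hd', h'⟩
    rw [hl x n d hd h, hl y n' d' hd' h', hl (x + y) (n * d' + n' * d) (d * d')
      (by rw [map_mul]; exact mul_ne_zero hd hd')
      (by rw [map_add, map_mul, map_mul, map_mul, h, h']; ring), map_add, map_mul, map_mul, map_mul]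
    field_simp
  · rintro x ⟨n, d, hd, h⟩ y ⟨n', d', hd', h'⟩
    rw [hl x n d hd h, hl y n' d' hd' h', hl (x * y) (n * n') (d * d')
      (by rw [map_mul]; exact mul_ne_zero hd hd')
      (by rw [map_mul, map_mul, h, h']; ring), map_mul, map_mul]
    field_simp
  · intro a ha
    have h1 : μ ((1 : R) ⊗ₜ (⟨a, ha⟩ : A)) = a * μ 1 := by
      rw [map_one, mul_one]; exact (muH_tmul A R _ _).trans (by simp)
    refine ⟨⟨_, 1, by simp, h1⟩, ?_⟩
    rw [hl _ _ _ (by simp) h1, map_one, div_one]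
    exact (laH_tmul A R ev _ _).trans (by simp)
  · intro c hc
    have h1 : μ ((⟨c, hsub (Or.inl (Or.inl hc))⟩ : R) ⊗ₜ (1 : A)) = algebraMap K F c * μ 1 := by
      rw [map_one, mul_one]; exact (muH_tmul A R _ _).trans (by simp)
    refine ⟨⟨_, 1, by simp, h1⟩, ev ⟨c, hsub (Or.inl (Or.inl hc))⟩, ?_⟩
    rw [hl _ _ _ (by simp) h1, map_one, div_one]
    exact (laH_tmul A R ev _ _).trans (by simp)
  · intro z hzZ hz0
    obtain ⟨n, d, h, hn, hd⟩ := hW z hz0 R (Set.Subset.trans (by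
      intro w hw
      exact Or.inr (Set.mem_biUnion hzZ hw)) hsub) ev
    refine ⟨⟨n, d, hd, h⟩, ⟨d, n, hn, ?_⟩⟩
    change muH A R d = z⁻¹ * muH A R n
    rw [h, inv_mul_cancel_left₀ hz0]
  · intro i
    have h1 : μ (sR i ⊗ₜ (1 : A)) = algebraMap K F (s i) * μ 1 := by
      rw [map_one, mul_one]; exact (muH_tmul A R _ _).trans (by simp [sR])
    refine ⟨⟨_, 1, by simp, h1⟩, ?_⟩
    rw [hl _ _ _ (by simp) h1, map_one, div_one]
    refine (laH_tmul A R ev _ _).trans ?_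
    rw [hev, IsScalarTower.algebraMap_apply L K F]
    simp

end spec0
end WD
end

section
namespace WD
open IntermediateField

variable {k K F : Type} [Field k] [Field K] [Algebra k K] [Field F] [Algebra K F]
variable {ρ : (K ≃ₐ[k] K) →* RingAut F}

theorem kt_sum {ι κ : Type} (t : ι → K) (u : κ → K) : kt k (Sum.elim t u) = kt k t ⊔ kt k u := by
  rw [kt, Set.Sum.elim_range, adjoin_union]

theorem exists_poly' {ι : Type} (A : Subring F) (s : ι → F) (f : F)
    (hf : f ∈ Subring.closure ((A : Set F) ∪ Set.range s)) :
    ∃ P : MvPolynomial ι A, MvPolynomial.eval₂ A.subtype s P = f := by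
  let θ : MvPolynomial ι A →+* F := MvPolynomial.eval₂Hom A.subtype s
  have : Subring.closure ((A : Set F) ∪ Set.range s) ≤ θ.range := by
    rw [Subring.closure_le]
    rintro _ (h | ⟨i, rfl⟩)
    · exact ⟨MvPolynomial.C ⟨_, h⟩, by simp [θ]⟩
    · exact ⟨MvPolynomial.X i, by simp [θ]⟩
  exact this hf

theorem spec (hρ : ∀ σ c, ρ σ (algebraMap K F c) = algebraMap K F (σ c))
    [IsAlgClosed K] [CharZero k]
    (htr : ∀ L : IntermediateField k K, L.FG → ∃ x : K, Transcendental L x)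
    {ι : Type} [Finite ι] (t s : ι → K) (ht : AlgebraicIndependent k t)
    (hs : AlgebraicIndependent (kt k t) s)
    (hfrac : ∀ f : F, ∃ a ∈ Submodule.span K (FF ρ (H t) : Set F),
      ∃ b ∈ Submodule.span K (FF ρ (H t) : Set F), b ≠ 0 ∧ f = a / b)
    (S' : Set F) (hS' : S'.Finite) (hS's : ∀ x ∈ S', x ∈ FF ρ (H s))
    (T : Set K) (hT : T.Finite) (Z : Set F) (hZ : Z.Finite) :
    ∃ (M : Subring F) (l : F → F), l 1 = 1 ∧
      (∀ x ∈ M, ∀ y ∈ M, l (x + y) = l x + l y) ∧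
      (∀ x ∈ M, ∀ y ∈ M, l (x * y) = l x * l y) ∧
      (∀ a ∈ FF ρ (H t), a ∈ M ∧ l a = a) ∧
      (∀ c ∈ T, algebraMap K F c ∈ M ∧ ∃ c', l (algebraMap K F c) = algebraMap K F c') ∧
      (∀ z ∈ Z, z ≠ 0 → z ∈ M ∧ z⁻¹ ∈ M) ∧
      (∀ x ∈ S', x ∈ M → ∀ g, ρ g (l x) = l x) := by
  classical
  let B : Subring F := (FF ρ (H t)).toSubring
  let s' : ι → F := fun i => algebraMap K F (s i)
  have hPQ : ∀ x : F, ∃ P Q : MvPolynomial ι B, (x ∈ S' → MvPolynomial.eval₂ B.subtype s' Q ≠ 0 ∧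
      x * MvPolynomial.eval₂ B.subtype s' Q = MvPolynomial.eval₂ B.subtype s' P) := by
    intro x
    by_cases hx : x ∈ S'
    swap
    · exact ⟨0, 0, fun h => (hx h).elim⟩
    obtain ⟨y, hy, z, hz, hyz⟩ :=
      Subfield.mem_closure_iff.1 (mem_closure_of_fixed hρ htr t s hfrac x (hS's x hx))
    obtain ⟨P, hP⟩ := exists_poly' B s' y hy
    obtain ⟨Q, hQ⟩ := exists_poly' B s' z hz
    by_cases hz0 : z = 0
    · refine ⟨0, 1, fun _ => ?_⟩
      rw [← hyz, hz0]
      simp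
    · refine ⟨P, Q, fun _ => ?_⟩
      rw [hP, hQ, ← hyz]
      exact ⟨hz0, div_mul_cancel₀ _ hz0⟩
  choose P Q hPQ using hPQ
  let ev : MvPolynomial ι B → F := fun P => MvPolynomial.eval₂ B.subtype s' P
  let A : Subalgebra (kt k t) F :=
    { (FF ρ (H t)).toSubring with
      algebraMap_mem' := fun c => by
        have := algebraMap_mem_FF (F := F) hρ c.2
        rwa [IsScalarTower.algebraMap_apply (kt k t) K F] }
  obtain ⟨M, l, s₀, h1, hadd, hmul, hA, hT, hZ, hs₀⟩ := spec0 (k := k) A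
    (fun v hv hl => linInd_of_fixed ρ hρ (H t) (H_mem htr t) v hv hl) hfrac s hs T hT
    (Z ∪ (fun x => ev (Q x)) '' S') (hZ.union (hS'.image _))
  refine ⟨M, l, h1, hadd, hmul, hA, hT, fun z hz => hZ z (Or.inl hz), ?_⟩
  intro x hx hxM
  -- evaluation at `s₀`
  let s0 : ι → F := fun i => algebraMap (kt k t) F (algebraMap k (kt k t) (s₀ i))
  have hs0 : ∀ g i, ρ g (s0 i) = s0 i := by
    intro g i
    have : s0 i = algebraMap K F (algebraMap k K (s₀ i)) := by
      simp only [s0]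
      rw [IsScalarTower.algebraMap_apply (kt k t) K F,
        ← IsScalarTower.algebraMap_apply k (kt k t) K]
    rw [this, hρ, AlgEquiv.commutes]
  have hev : ∀ P, ev P ∈ M ∧ l (ev P) = MvPolynomial.eval₂ B.subtype s0 P := by
    intro P
    induction P using MvPolynomial.induction_on with
    | C a =>
      have := hA a a.2
      simpa [ev] using this
    | add p q hp hq =>
      simp only [ev, MvPolynomial.eval₂_add] at hp hq ⊢
      exact ⟨add_mem hp.1 hq.1, by rw [hadd _ hp.1 _ hq.1, hp.2, hq.2]⟩
    | mul_X p i hp =>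
      simp only [ev, MvPolynomial.eval₂_mul, MvPolynomial.eval₂_X] at hp ⊢
      exact ⟨mul_mem hp.1 (hs₀ i).1, by rw [hmul _ hp.1 _ (hs₀ i).1, hp.2, (hs₀ i).2]⟩
  obtain ⟨hQ0, hxPQ⟩ := hPQ x hx
  obtain ⟨hQM, hQM'⟩ := hZ (ev (Q x)) (Or.inr ⟨x, hx, rfl⟩) hQ0
  let p0 := MvPolynomial.eval₂ B.subtype s0 (P x)
  let q0 := MvPolynomial.eval₂ B.subtype s0 (Q x)
  have hlx : l x * q0 = p0 := by
    have h := hmul x hxM _ hQM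
    rw [show x * ev (Q x) = ev (P x) from hxPQ, (hev _).2, (hev _).2] at h
    exact h.symm
  have hq0 : q0 ≠ 0 := by
    intro h
    have h2 := hmul _ hQM _ hQM'
    rw [mul_inv_cancel₀ hQ0, h1, (hev _).2, show MvPolynomial.eval₂ B.subtype s0 (Q x) = 0 from h,
      zero_mul] at h2
    exact one_ne_zero h2
  have hfixB : ∀ g ∈ H t, ∀ P, ρ g (MvPolynomial.eval₂ B.subtype s0 P) =
      MvPolynomial.eval₂ B.subtype s0 P := by
    intro g hg P
    induction P using MvPolynomial.induction_on with
    | C a => simpa using a.2 g hg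
    | add p q hp hq => rw [MvPolynomial.eval₂_add, map_add, hp, hq]
    | mul_X p i hp => rw [MvPolynomial.eval₂_mul, map_mul, hp, MvPolynomial.eval₂_X, hs0]
  -- the second automorphism
  obtain ⟨u, hu⟩ := exists_ind htr (kt k (Sum.elim t s)) (fg_range _) ι
  rw [kt_sum] at hu
  have htu : AlgebraicIndependent (kt k t) u := ind_mono le_sup_left hu
  have hsu : AlgebraicIndependent (kt k s) u := ind_mono le_sup_right hu
  have hts : AlgebraicIndependent (kt k s) t := by
    have h2 := ind_swap _ ((ind_sum_iff ⊥ (x := t) (y := s)).2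
      ⟨ind_bot.2 ht, by rw [bot_sup_eq]; exact hs⟩)
    have h3 := ((ind_sum_iff ⊥).1 h2).2
    rwa [bot_sup_eq] at h3
  have hstu : AlgebraicIndependent (kt k (Sum.elim t u)) s := by
    rw [kt_sum]
    exact ((ind_sum_iff _).1 (ind_swap _ ((ind_sum_iff (kt k t) (x := s) (y := u)).2 ⟨hs, hu⟩))).2
  obtain ⟨τ, hτs, hτt⟩ := exists_move htr (kt k s) (fg_range s) hts hsu
  have hτS : τ ∈ H (k := k) s := fun i => hτs _ (subset_adjoin k _ ⟨i, rfl⟩)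
  let Stab : Subgroup (K ≃ₐ[k] K) :=
    { carrier := {g | ρ g (l x) = l x}
      mul_mem' := by
        intro a b ha hb
        change ρ (a * b) (l x) = l x
        rw [map_mul, RingAut.mul_apply, show ρ b (l x) = l x from hb]
        exact ha
      one_mem' := by
        change ρ 1 (l x) = l x
        rw [map_one]; rfl
      inv_mem' := by
        intro a ha
        change ρ a⁻¹ (l x) = l x
        rw [map_inv]
        exact (RingEquiv.symm_apply_eq _).2 (show l x = ρ a (l x) from ha.symm) }
  have hlx' : l x = p0 / q0 := by rw [← hlx, mul_div_cancel_right₀ _ hq0]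
  have hST : Stab = ⊤ := by
    refine gen_top htr t ht Stab ?_ τ ?_ ?_
    · intro σ hσ
      change ρ σ (l x) = l x
      rw [hlx', map_div₀, hfixB σ hσ, hfixB σ hσ]
    · let PF := (P x).map B.subtype
      let QF := (Q x).map B.subtype
      let g : F →+* F := (ρ τ : F →+* F)
      have hgs' : ∀ P : MvPolynomial ι F, (P.map g).eval s' = g (P.eval s') := by
        intro P
        rw [MvPolynomial.eval_map, MvPolynomial.eval, MvPolynomial.coe_eval₂Hom,
          MvPolynomial.eval₂_comp_left]
        congr 1
        ext i
        exact ((hρ τ (s i)).trans (by rw [hτS i])).symm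
      have hgs0 : ∀ P : MvPolynomial ι F, (P.map g).eval s0 = g (P.eval s0) := by
        intro P
        rw [MvPolynomial.eval_map, MvPolynomial.eval, MvPolynomial.coe_eval₂Hom,
          MvPolynomial.eval₂_comp_left]
        congr 1
        ext i
        exact (hs0 τ i).symm
      have hxτ : g x = x := hS's x hx τ hτS
      have e1 : PF.eval s' = x * QF.eval s' := by
        rw [MvPolynomial.eval_map, MvPolynomial.eval_map]
        exact hxPQ.symm
      let D := PF * QF.map g - QF * PF.map g
      have hco : ∀ (R : MvPolynomial ι B) m, (R.map B.subtype).coeff m ∈ FF ρ (H (Sum.elim t u)) := by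
        intro R m σ hσ
        rw [MvPolynomial.coeff_map]
        exact (R.coeff m).2 σ (fun i => hσ (Sum.inl i))
      have hcog : ∀ (R : MvPolynomial ι B) m,
          ((R.map B.subtype).map g).coeff m ∈ FF ρ (H (Sum.elim t u)) := by
        intro R m σ hσ
        rw [MvPolynomial.coeff_map, MvPolynomial.coeff_map]
        have : τ⁻¹ * σ * τ ∈ H t := by
          intro i
          have h3 := hσ (Sum.inr i)
          rw [AlgEquiv.mul_apply, AlgEquiv.mul_apply, hτt]
          rw [Sum.elim_inr] at h3
          rw [h3, ← hτt, ← AlgEquiv.mul_apply, inv_mul_cancel]; rfl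
        have h4 := (R.coeff m).2 _ this
        have h5 := congrArg (ρ τ) h4
        rw [← RingAut.mul_apply, ← map_mul, ← mul_assoc, ← mul_assoc, mul_inv_cancel, one_mul,
          map_mul] at h5
        exact h5
      have hmulc : ∀ R R' : MvPolynomial ι F, (∀ m, R.coeff m ∈ FF ρ (H (Sum.elim t u))) →
          (∀ m, R'.coeff m ∈ FF ρ (H (Sum.elim t u))) → ∀ m, (R * R').coeff m ∈ FF ρ (H (Sum.elim t u)) := by
        intro R R' h h' m
        rw [MvPolynomial.coeff_mul]
        exact sum_mem fun i _ => mul_mem (h _) (h' _)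
      have hD : D = 0 := by
        refine poly_eq_zero hρ htr (Sum.elim t u) s hstu D ?_ ?_
        · intro m
          rw [MvPolynomial.coeff_sub]
          exact sub_mem (hmulc _ _ (hco _) (hcog _) m) (hmulc _ _ (hco _) (hcog _) m)
        · change D.eval s' = 0
          simp only [D, map_sub, map_mul, hgs', e1, hxτ]
          ring
      have e2 : PF.eval s0 = p0 := by rw [MvPolynomial.eval_map]
      have e3 : QF.eval s0 = q0 := by rw [MvPolynomial.eval_map]
      have h6 := congrArg (MvPolynomial.eval s0) hD
      simp only [D, map_sub, map_mul, hgs0, e2, e3, map_zero] at h6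
      change ρ τ (l x) = l x
      rw [hlx', map_div₀, div_eq_div_iff _ hq0]
      · have : p0 * ρ τ q0 - q0 * ρ τ p0 = 0 := h6
        linear_combination -this
      · rw [Ne, EmbeddingLike.map_eq_zero_iff]; exact hq0
    · convert! htu using 1
      ext i
      exact hτt i
  intro g
  have : g ∈ Stab := by rw [hST]; trivial
  exact this

end WD
end

section
namespace WD
open IntermediateField Filter

variable {k K F : Type} [Field k] [Field K] [Algebra k K] [Field F] [Algebra K F]
variable {ρ : (K ≃ₐ[k] K) →* RingAut F}

/-- Partially defined specialization maps. -/
structure Good (T : Set K) (Z : Set F) (M : Subring F) (l : F → F) : Prop where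
  one : l 1 = 1
  add : ∀ x ∈ M, ∀ y ∈ M, l (x + y) = l x + l y
  mul : ∀ x ∈ M, ∀ y ∈ M, l (x * y) = l x * l y
  cst : ∀ c ∈ T, algebraMap K F c ∈ M ∧ ∃ c', l (algebraMap K F c) = algebraMap K F c'
  inv : ∀ z ∈ Z, z ≠ 0 → z ∈ M ∧ z⁻¹ ∈ M

namespace Good
variable {T : Set K} {Z : Set F} {M : Subring F} {l : F → F} (h : Good T Z M l)
include h

theorem zero : l 0 = 0 := by
  have := h.add 0 (zero_mem _) 0 (zero_mem _)
  simpa using this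

theorem neg (x : F) (hx : x ∈ M) : l (-x) = - l x := by
  have := h.add x hx (-x) (neg_mem hx)
  rw [add_neg_cancel, h.zero] at this
  linear_combination -this

theorem sum {ι : Type} (s : Finset ι) (x : ι → F) (hx : ∀ i, x i ∈ M) :
    l (∑ i ∈ s, x i) = ∑ i ∈ s, l (x i) := by
  classical
  induction s using Finset.induction_on with
  | empty => simpa using h.zero
  | insert a s ha ih =>
    rw [Finset.sum_insert ha, Finset.sum_insert ha, h.add _ (hx a) _ (sum_mem fun i _ => hx i), ih]

theorem mono {T' : Set K} {Z' : Set F} (hT : T' ⊆ T) (hZ : Z' ⊆ Z) : Good T' Z' M l :=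
  ⟨h.one, h.add, h.mul, fun c hc => h.cst c (hT hc), fun z hz => h.inv z (hZ hz)⟩

theorem closure {U : Set F} (hU : U ⊆ M) {x : F}
    (hx : x ∈ Subring.closure (algebraMap K F '' T ∪ U)) : x ∈ M ∧ l x ∈ Kc K (l '' U) := by
  induction hx using Subring.closure_induction with
  | mem x hx =>
    rcases hx with ⟨c, hc, rfl⟩ | hx
    · obtain ⟨h1, c', h2⟩ := h.cst c hc
      exact ⟨h1, by rw [h2]; exact algebraMap_mem_Kc _ _⟩
    · exact ⟨hU hx, subset_Kc _ ⟨x, hx, rfl⟩⟩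
  | zero => exact ⟨zero_mem _, by rw [h.zero]; exact zero_mem _⟩
  | one => exact ⟨one_mem _, by rw [h.one]; exact one_mem _⟩
  | add x y _ _ hx hy =>
    exact ⟨add_mem hx.1 hy.1, by rw [h.add _ hx.1 _ hy.1]; exact add_mem hx.2 hy.2⟩
  | neg x _ hx => exact ⟨neg_mem hx.1, by rw [h.neg _ hx.1]; exact neg_mem hx.2⟩
  | mul x y _ _ hx hy =>
    exact ⟨mul_mem hx.1 hy.1, by rw [h.mul _ hx.1 _ hy.1]; exact mul_mem hx.2 hy.2⟩

end Good

/-- The filter of specialization maps. -/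
def GF (K F : Type) [Field K] [Field F] [Algebra K F] : Filter (Subring F × (F → F)) :=
  ⨅ TZ : Finset K × Finset F, 𝓟 {Ml | Good (TZ.1 : Set K) (TZ.2 : Set F) Ml.1 Ml.2}

theorem GF_exists {Q : Subring F × (F → F) → Prop} (h : ∀ᶠ Ml in GF K F, Q Ml) :
    ∃ (T : Finset K) (Z : Finset F), ∀ M l, Good (T : Set K) (Z : Set F) M l → Q (M, l) := by
  classical
  have hd : Directed (· ≥ ·) (fun TZ : Finset K × Finset F =>
      𝓟 {Ml : Subring F × (F → F) | Good (TZ.1 : Set K) (TZ.2 : Set F) Ml.1 Ml.2}) := by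
    intro a b
    refine ⟨(a.1 ∪ b.1, a.2 ∪ b.2), ?_, ?_⟩ <;>
    · refine principal_mono.2 fun Ml h => ?_
      refine Good.mono h ?_ ?_ <;> simp
  have h2 := (mem_iInf_of_directed hd _).1 h
  obtain ⟨TZ, h3⟩ := h2
  exact ⟨TZ.1, TZ.2, fun M l hg => h3 (show (M, l) ∈ _ from hg)⟩

theorem GF_good (T : Finset K) (Z : Finset F) :
    ∀ᶠ Ml in GF K F, Good (T : Set K) (Z : Set F) Ml.1 Ml.2 :=
  mem_iInf_of_mem (T, Z) (mem_principal_self _)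

theorem GF_inv (z : F) : ∀ᶠ Ml in GF K F, z ∈ Ml.1 ∧ z⁻¹ ∈ Ml.1 ∧ Ml.2 z⁻¹ = (Ml.2 z)⁻¹ ∧
    (z ≠ 0 → Ml.2 z ≠ 0) := by
  by_cases hz : z = 0
  · filter_upwards [GF_good (K := K) (F := F) ∅ ∅] with Ml h
    subst hz
    simp [h.zero, zero_mem]
  · filter_upwards [GF_good (K := K) (F := F) ∅ {z}] with Ml h
    have h2 := h.inv z (by simp) hz
    have h3 := h.mul _ h2.1 _ h2.2
    rw [mul_inv_cancel₀ hz, h.one] at h3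
    exact ⟨h2.1, h2.2, eq_inv_of_mul_eq_one_right h3.symm, fun _ h0 => by simp [h0] at h3⟩

theorem Kc_fin {U : Set F} {x : F} (hx : x ∈ Kc K U) :
    ∃ T : Finset K, x ∈ Subring.closure (algebraMap K F '' (T : Set K) ∪ U) := by
  classical
  have mono : ∀ {T T' : Finset K}, T ⊆ T' → Subring.closure (algebraMap K F '' (T : Set K) ∪ U) ≤
      Subring.closure (algebraMap K F '' (T' : Set K) ∪ U) := fun h =>
    Subring.closure_mono (Set.union_subset_union_left _ (Set.image_mono (Finset.coe_subset.2 h)))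
  induction hx using Subring.closure_induction with
  | mem x hx =>
    rcases hx with ⟨c, rfl⟩ | hx
    · exact ⟨{c}, Subring.subset_closure (Or.inl ⟨c, by simp, rfl⟩)⟩
    · exact ⟨∅, Subring.subset_closure (Or.inr hx)⟩
  | zero => exact ⟨∅, zero_mem _⟩
  | one => exact ⟨∅, one_mem _⟩
  | add x y _ _ hx hy =>
    obtain ⟨T, hT⟩ := hx
    obtain ⟨T', hT'⟩ := hy
    exact ⟨T ∪ T', add_mem (mono Finset.subset_union_left hT) (mono Finset.subset_union_right hT')⟩
  | neg x _ hx =>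
    obtain ⟨T, hT⟩ := hx
    exact ⟨T, neg_mem hT⟩
  | mul x y _ _ hx hy =>
    obtain ⟨T, hT⟩ := hx
    obtain ⟨T', hT'⟩ := hy
    exact ⟨T ∪ T', mul_mem (mono Finset.subset_union_left hT) (mono Finset.subset_union_right hT')⟩

theorem GF_mem {U : Set F} (hU : U.Finite) : ∀ᶠ Ml in GF K F, U ⊆ Ml.1 := by
  have := (eventually_all_finite hU).2 fun z _ => GF_inv (K := K) z
  filter_upwards [this] with Ml h
  exact fun z hz => (h z hz).1

theorem GF_Kc {U : Set F} (hU : U.Finite) {x : F} (hx : x ∈ Kc K U) :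
    ∀ᶠ Ml in GF K F, x ∈ Ml.1 ∧ Ml.2 x ∈ Kc K (Ml.2 '' U) := by
  obtain ⟨T, hT⟩ := Kc_fin hx
  filter_upwards [GF_good T ∅, GF_mem (K := K) hU] with Ml h1 h2
  exact h1.closure h2 hT

theorem loc_Kc (U : Set F) (b : F) : loc (Kc K U) b = Kc K (U ∪ {b⁻¹}) := by
  rw [loc, Kc, Kc, ← Subring.closure_union, Set.union_assoc]

theorem GF_div {e f : F} : ∀ᶠ Ml in GF K F, Ml.2 (f / e) = Ml.2 f / Ml.2 e := by
  filter_upwards [GF_inv (K := K) e, GF_inv (K := K) f, GF_good (K := K) ∅ ∅] with Ml h1 h2 h3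
  rw [div_eq_mul_inv, h3.mul _ h2.1 _ h1.2.1, h1.2.2.1, div_eq_mul_inv]

theorem GF_im {S : Set F} (hS : S.Finite) (e : F) : ∀ᶠ Ml in GF K F,
    Ml.2 '' ((fun f => f / e) '' S) = (fun f => f / Ml.2 e) '' (Ml.2 '' S) := by
  have := (eventually_all_finite hS).2 fun f _ => GF_div (K := K) (e := e) (f := f)
  filter_upwards [this] with Ml h
  rw [Set.image_image, Set.image_image]
  exact Set.image_congr h

theorem GF_BE {S : Set F} (hS : S.Finite) {e x : F} (hx : x ∈ BE K S e) :
    ∀ᶠ Ml in GF K F, x ∈ Ml.1 ∧ Ml.2 x ∈ BE K (Ml.2 '' S) (Ml.2 e) := by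
  filter_upwards [GF_Kc (hS.image _) hx, GF_im (K := K) hS e] with Ml h1 h2
  rw [h2] at h1
  exact h1

theorem GF_loc {S : Set F} (hS : S.Finite) {e x b : F} (hx : x ∈ loc (BE K S e) b) :
    ∀ᶠ Ml in GF K F, x ∈ Ml.1 ∧ Ml.2 x ∈ loc (BE K (Ml.2 '' S) (Ml.2 e)) (Ml.2 b) := by
  rw [BE, loc_Kc] at hx
  filter_upwards [GF_Kc ((hS.image _).union (Set.finite_singleton _)) hx, GF_im (K := K) hS e,
    GF_inv (K := K) b] with Ml h1 h2 h3
  rw [Set.image_union, Set.image_singleton, h2, h3.2.2.1] at h1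
  rwa [BE, loc_Kc]

theorem GF_loc_le {S S' : Set F} (hS : S.Finite) (hS' : S'.Finite) {e a e' b : F}
    (h : loc (BE K S e) a ≤ loc (BE K S' e') b) :
    ∀ᶠ Ml in GF K F, loc (BE K (Ml.2 '' S) (Ml.2 e)) (Ml.2 a) ≤
      loc (BE K (Ml.2 '' S') (Ml.2 e')) (Ml.2 b) := by
  have h1 := (eventually_all_finite hS).2 fun f hf =>
    GF_loc hS' (h (le_loc _ _ (div_mem_BE (K := K) e hf)))
  have h1' := (eventually_all_finite hS).2 fun f hf => GF_div (K := K) (e := e) (f := f)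
  have h2 := GF_loc hS' (h (inv_mem_loc _ _))
  filter_upwards [h1, h1', h2, GF_inv (K := K) a] with Ml h1 h1' h2 h3
  refine loc_le (BE_le (fun c => le_loc _ _ (algebraMap_mem_BE _ _ _)) ?_) ?_
  · rintro _ ⟨f, hf, rfl⟩
    rw [← h1' f hf]
    exact (h1 f hf).2
  · rw [← h3.2.2.1]; exact h2.2

/-- Certificates comparing two chart systems. -/
def Cert (K : Type) [Field K] [Algebra K F] (S : Set F) (e : F) (S' J' : Set F) : Prop :=
  ∃ (ι : Type) (_ : Fintype ι) (a c : ι → F), (∀ i, a i ∈ BE K S e) ∧ (∀ i, a i ≠ 0) ∧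
      (∀ i, c i ∈ BE K S e) ∧ ∑ i, c i * a i = 1 ∧
      ∀ i, ∃ e' ∈ J', ∃ b ∈ BE K S' e', b ≠ 0 ∧ loc (BE K S e) (a i) = loc (BE K S' e') b

theorem GF_cert {S S' J' : Set F} (hS : S.Finite) (hS' : S'.Finite) {e : F} (h : Cert K S e S' J') :
    ∀ᶠ Ml in GF K F, Cert K (Ml.2 '' S) (Ml.2 e) (Ml.2 '' S') (Ml.2 '' J') := by
  obtain ⟨ι, _, a, c, ha, ha0, hc, h1, hb⟩ := h
  choose e' he' b hb hb0 hl using hb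
  filter_upwards [eventually_all.2 fun i => GF_BE hS (ha i), eventually_all.2 fun i => GF_BE hS (hc i),
    eventually_all.2 fun i => GF_BE hS' (hb i), eventually_all.2 fun i => GF_inv (K := K) (a i),
    eventually_all.2 fun i => GF_inv (K := K) (b i),
    eventually_all.2 fun i => GF_loc_le hS hS' (hl i).le,
    eventually_all.2 fun i => GF_loc_le hS' hS (hl i).ge, GF_good (K := K) ∅ ∅]
    with Ml h2 h3 h4 h5 h6 h7 h8 h9
  refine ⟨ι, ‹_›, fun i => Ml.2 (a i), fun i => Ml.2 (c i), fun i => (h2 i).2,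
    fun i => (h5 i).2.2.2 (ha0 i), fun i => (h3 i).2, ?_, fun i => ⟨_, ⟨e' i, he' i, rfl⟩,
      Ml.2 (b i), (h4 i).2, (h6 i).2.2.2 (hb0 i), le_antisymm (h7 i) (h8 i)⟩⟩
  have h10 := congrArg Ml.2 h1
  rw [h9.sum _ _ (fun i => mul_mem (h3 i).1 (h2 i).1), h9.one] at h10
  rw [← h10]
  exact Finset.sum_congr rfl fun i _ => (h9.mul _ (h3 i).1 _ (h2 i).1).symm

theorem cert_geo (C : ChartSys ρ) {S J S' J' : Set F} (hG : Geo C S J) (hG' : Geo C S' J') :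
    ∀ e ∈ J, Cert K S e S' J' := by
  intro e he
  obtain ⟨ι, _, a, c, ha, ha0, hc, h1, hb⟩ := C.cert (BE K S e) (hG.ch e he)
    ((fun e' => BE K S' e') '' J') (fun y _ => by
      obtain ⟨e', he', h⟩ := hG'.cov y
      exact ⟨_, ⟨e', he', rfl⟩, h⟩)
  refine ⟨ι, ‹_›, a, c, ha, ha0, hc, h1, fun i => ?_⟩
  obtain ⟨_, ⟨e', he', rfl⟩, b, hb, hb0, h⟩ := hb i
  exact ⟨e', he', b, hb, hb0, h⟩

theorem geo_cert (C : ChartSys ρ) {S J S' J' : Set F} (hG : Geo C S J) (hsub : J' ⊆ S')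
    (hnz : ∀ e ∈ J', e ≠ 0) (h1 : ∀ e ∈ J, Cert K S e S' J') (h2 : ∀ e ∈ J', Cert K S' e S J) :
    Geo C S' J' := by
  have hch : ∀ e ∈ J', ∃ y, C.P (BE K S' e) y := by
    intro e he
    obtain ⟨ι, _, a, c, ha, ha0, hc, h1, hb⟩ := h2 e he
    refine C.glue _ (algebraMap_mem_BE _ _) a c ha ha0 hc h1 fun i => ?_
    obtain ⟨e', he', b, hb, hb0, hl⟩ := hb i
    rw [hl]
    exact C.basic _ (hG.ch e' he') b hb hb0
  refine ⟨hsub, hnz, hch, fun y => ?_⟩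
  obtain ⟨e, he, hy⟩ := hG.cov y
  obtain ⟨ι, _, a, c, ha, ha0, hc, h1, hb⟩ := h1 e he
  obtain ⟨i, hi⟩ := C.cover _ y hy a c ha ha0 hc h1
  obtain ⟨e', he', b, hb, hb0, hl⟩ := hb i
  rw [hl] at hi
  exact ⟨e', he', C.basic_le _ (hch e' he') b hb hb0 y hi⟩

theorem geo_image (hρ : ∀ σ c, ρ σ (algebraMap K F c) = algebraMap K F (σ c)) (C : ChartSys ρ)
    {S J : Set F} (hG : Geo C S J) (σ : K ≃ₐ[k] K) : Geo C (ρ σ '' S) (ρ σ '' J) := by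
  refine ⟨Set.image_mono hG.sub, ?_, ?_, ?_⟩
  · rintro _ ⟨e, he, rfl⟩
    rw [Ne, EmbeddingLike.map_eq_zero_iff]
    exact hG.nz e he
  · rintro _ ⟨e, he, rfl⟩
    obtain ⟨y, hy⟩ := hG.ch e he
    exact ⟨_, by rw [← BE_map hρ]; exact C.equi σ _ y hy⟩
  · intro y
    obtain ⟨z, rfl⟩ := C.act_surj σ y
    obtain ⟨e, he, hz⟩ := hG.cov z
    exact ⟨_, ⟨e, he, rfl⟩, by rw [← BE_map hρ]; exact C.equi σ _ z hz⟩

theorem step3 (hρ : ∀ σ c, ρ σ (algebraMap K F c) = algebraMap K F (σ c))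
    [IsAlgClosed K] [CharZero k]
    (htr : ∀ L : IntermediateField k K, L.FG → ∃ x : K, Transcendental L x)
    (C : ChartSys ρ) [Nonempty C.pt] {S J : Set F} (hG : Geo C S J) (hS : S.Finite)
    {ι : Type} [Finite ι] (t : ι → K) (ht : AlgebraicIndependent k t)
    (hSt : ∀ f ∈ S, f ∈ FF ρ (H t)) :
    ∃ S' J' : Set F, S'.Finite ∧ Geo C S' J' ∧ (∀ f ∈ S', ∀ g, ρ g f = f) ∧
      (Reg K S J → Reg K S' J') ∧ (1 ∈ S → 1 ∈ S') ∧ (1 ∈ J → 1 ∈ J') := by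
  classical
  obtain ⟨s, hs⟩ := exists_ind htr (kt k t) (fg_range t) ι
  have hs' : AlgebraicIndependent (⊥ : IntermediateField k K) s := ind_mono bot_le hs
  obtain ⟨σ, -, hσ⟩ := exists_move htr ⊥ fg_bot (ind_bot.2 ht) hs'
  let S1 := ρ σ '' S
  let J1 := ρ σ '' J
  have hG1 : Geo C S1 J1 := geo_image hρ C hG σ
  have hS1 : S1.Finite := hS.image _
  have hS1s : ∀ x ∈ S1, x ∈ FF ρ (H s) := by
    rintro _ ⟨f, hf, rfl⟩ γ hγ
    have : σ⁻¹ * γ * σ ∈ H t := by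
      intro i
      rw [AlgEquiv.mul_apply, AlgEquiv.mul_apply, hσ, hγ i, ← hσ, ← AlgEquiv.mul_apply,
        inv_mul_cancel]; rfl
    have h4 := hSt f hf _ this
    have h5 := congrArg (ρ σ) h4
    rw [← RingAut.mul_apply, ← map_mul, ← mul_assoc, ← mul_assoc, mul_inv_cancel, one_mul,
      map_mul] at h5
    exact h5
  have hR1 : Reg K S J → Reg K S1 J1 := by
    rintro hR _ ⟨e, he, rfl⟩ _ ⟨f, hf, rfl⟩
    have := hR e he hf
    rw [← BE_map hρ]
    exact ⟨f, this, rfl⟩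
  have hfrac : ∀ f : F, ∃ a ∈ Submodule.span K (FF ρ (H t) : Set F),
      ∃ b ∈ Submodule.span K (FF ρ (H t) : Set F), b ≠ 0 ∧ f = a / b := by
    intro f
    obtain ⟨y⟩ := ‹Nonempty C.pt›
    obtain ⟨e, he, hy⟩ := hG.cov y
    obtain ⟨a, ha, b, hb, hb0, h⟩ := C.frac _ _ hy f
    have hle : BE K S e ≤ Kc K ((FF ρ (H t)).toSubring : Set F) :=
      BE_le (algebraMap_mem_Kc _) fun f hf =>
        subset_Kc _ ((FF ρ (H t)).div_mem (hSt f hf) (hSt e (hG.sub he)))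
    exact ⟨a, Kc_eq_span _ _ (hle ha), b, Kc_eq_span _ _ (hle hb), hb0, h⟩
  have hJ : J.Finite := hS.subset hG.sub
  have hJ1 : J1.Finite := hS1.subset hG1.sub
  have ev : ∀ᶠ Ml in GF K F, (∀ e ∈ J, Cert K (Ml.2 '' S) (Ml.2 e) (Ml.2 '' S1) (Ml.2 '' J1)) ∧
      (∀ e ∈ J1, Cert K (Ml.2 '' S1) (Ml.2 e) (Ml.2 '' S) (Ml.2 '' J)) ∧ S1 ⊆ Ml.1 ∧
      (∀ e ∈ J1, Ml.2 e ≠ 0) ∧ (Reg K S1 J1 → Reg K (Ml.2 '' S1) (Ml.2 '' J1)) := by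
    have h1 := (eventually_all_finite hJ).2 fun e he => GF_cert hS hS1 (cert_geo C hG hG1 e he)
    have h2 := (eventually_all_finite hJ1).2 fun e he => GF_cert hS1 hS (cert_geo C hG1 hG e he)
    have h3 := (eventually_all_finite hJ1).2 fun e he => GF_inv (K := K) e
    have h4 : ∀ᶠ Ml in GF K F, Reg K S1 J1 → Reg K (Ml.2 '' S1) (Ml.2 '' J1) := by
      by_cases hR : Reg K S1 J1
      · have := (eventually_all_finite hJ1).2 fun e he => (eventually_all_finite hS1).2 fun f hf =>
          GF_BE hS1 (hR e he hf)
        filter_upwards [this] with Ml h _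
        rintro _ ⟨e, he, rfl⟩ _ ⟨f, hf, rfl⟩
        exact (h e he f hf).2
      · exact Eventually.of_forall fun _ h => (hR h).elim
    filter_upwards [h1, h2, h3, h4, GF_mem (K := K) hS1] with Ml h1 h2 h3 h4 h5
    exact ⟨h1, h2, h5, fun e he => (h3 e he).2.2.2 (hG1.nz e he), h4⟩
  obtain ⟨T, Z, hTZ⟩ := GF_exists ev
  obtain ⟨M, l, g1, g2, g3, g4, g5, g6, g7⟩ := spec hρ htr t s ht hs hfrac S1 hS1 hS1s (T : Set K)
    (Finset.finite_toSet _) (Z : Set F) (Finset.finite_toSet _)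
  obtain ⟨h1, h2, h3, h4, h5⟩ := hTZ M l ⟨g1, g2, g3, g5, g6⟩
  dsimp only at h1 h2 h3 h4 h5
  have hlS : l '' S = S := by
    rw [Set.image_congr (g := id) fun f hf => (g4 f (hSt f hf)).2, Set.image_id]
  have hlJ : l '' J = J := by
    rw [Set.image_congr (g := id) fun f hf => (g4 f (hSt f (hG.sub hf))).2, Set.image_id]
  rw [hlS, hlJ] at h2
  rw [hlS] at h1
  refine ⟨l '' S1, l '' J1, hS1.image _, ?_, ?_, fun h => h5 (hR1 h), ?_, ?_⟩
  · refine geo_cert C hG (Set.image_mono hG1.sub) ?_ ?_ ?_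
    · rintro _ ⟨e, he, rfl⟩
      exact h4 e he
    · intro e he
      have := h1 e he
      rwa [(g4 e (hSt e (hG.sub he))).2] at this
    · rintro _ ⟨e, he, rfl⟩
      exact h2 e he
  · rintro _ ⟨f, hf, rfl⟩ g
    exact g7 f hf (h3 hf) g
  · exact fun h => ⟨1, ⟨1, h, map_one _⟩, g1⟩
  · exact fun h => ⟨1, ⟨1, h, map_one _⟩, g1⟩

theorem pipeline (hρ : ∀ σ c, ρ σ (algebraMap K F c) = algebraMap K F (σ c))
    [IsAlgClosed K] [CharZero k]
    (htr : ∀ L : IntermediateField k K, L.FG → ∃ x : K, Transcendental L x)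
    (C : ChartSys ρ) [Nonempty C.pt] {S J : Set F} (hG : Geo C S J) (hS : S.Finite)
    (hcont : ∀ f : F, ∃ L : IntermediateField k K, L.FG ∧
      ∀ σ : K ≃ₐ[k] K, (∀ x ∈ L, σ x = x) → ρ σ f = f) :
    ∃ S' J' : Set F, S'.Finite ∧ Geo C S' J' ∧ (∀ f ∈ S', ∀ g, ρ g f = f) ∧
      (Reg K S J → Reg K S' J') ∧ (1 ∈ S → 1 ∈ S') ∧ (1 ∈ J → 1 ∈ J') := by
  obtain ⟨ι, _, t, ht, S1, J1, hS1, hG1, hf, hR, h1, h2⟩ := step12 hρ htr C hG hS hcont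
  obtain ⟨S2, J2, hS2, hG2, hf2, hR2, h12, h22⟩ := step3 hρ htr C hG1 hS1 t ht hf
  exact ⟨S2, J2, hS2, hG2, hf2, hR2 ∘ hR, h12 ∘ h1, h22 ∘ h2⟩

end WD
end

section
open AlgebraicGeometry CategoryTheory CategoryTheory.Limits
namespace WD

section
variable {Y : Scheme.{0}} [IsIntegral Y]

/-- The regular functions on `U`, as a subring of the function field. -/
def secs (U : Y.Opens) (h : genericPoint Y ∈ U) : Subring Y.functionField :=
  (Y.presheaf.germ U (genericPoint Y) h).hom.range

theorem gen_mem {U : Y.Opens} {y : Y} (hy : y ∈ U) : genericPoint Y ∈ U :=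
  ((genericPoint_spec Y).mem_open_set_iff U.isOpen).mpr (by simpa using ⟨y, hy⟩)

theorem mem_secs {U : Y.Opens} {h : genericPoint Y ∈ U} {f : Y.functionField} :
    f ∈ secs U h ↔ ∃ s : Γ(Y, U), Y.presheaf.germ U (genericPoint Y) h s = f := Iff.rfl

theorem secs_mono {U V : Y.Opens} (hV : genericPoint Y ∈ V) (hVU : V ≤ U) :
    secs U (hVU hV) ≤ secs V hV := by
  rintro f ⟨s, rfl⟩
  exact ⟨Y.presheaf.map (homOfLE hVU).op s,
    Y.presheaf.germ_res_apply (homOfLE hVU) (genericPoint Y) hV s⟩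

/-- The germ map onto its range. -/
def secsEquiv (U : Y.Opens) (h : genericPoint Y ∈ U) : Γ(Y, U) ≃+* secs U h :=
  RingEquiv.ofBijective (Y.presheaf.germ U (genericPoint Y) h).hom.rangeRestrict
    ⟨fun a b hab => germ_injective_of_isIntegral Y _ h (congrArg Subtype.val hab),
      RingHom.rangeRestrict_surjective _⟩

/-- Compatibility with the generic point. -/
def Gen {B : Subring Y.functionField} (m : Spec (CommRingCat.of B) ⟶ Y) : Prop :=
  Spec.map (CommRingCat.ofHom B.subtype) ≫ m = Y.fromSpecStalk (genericPoint Y)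

theorem exists_fac {U : Y.Opens} (hU : IsAffineOpen U) (h : genericPoint Y ∈ U)
    (B : Subring Y.functionField) (hB : secs U h ≤ B) :
    ∃ m : Spec (CommRingCat.of B) ⟶ Y, Gen m ∧ Set.range m ⊆ U := by
  let φ : Γ(Y, U) →+* B := (Subring.inclusion hB).comp (secsEquiv U h : Γ(Y, U) →+* secs U h)
  refine ⟨Spec.map (CommRingCat.ofHom φ) ≫ hU.fromSpec, ?_, ?_⟩
  · rw [Gen, ← hU.fromSpecStalk_eq_fromSpecStalk h, IsAffineOpen.fromSpecStalk,
      ← Spec.map_comp_assoc]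
    rfl
  · rintro _ ⟨x, rfl⟩
    rw [← hU.range_fromSpec]
    exact ⟨Spec.map (CommRingCat.ofHom φ) x, rfl⟩

theorem exists_fac_self {U : Y.Opens} (hU : IsAffineOpen U) (h : genericPoint Y ∈ U) :
    ∃ m : Spec (CommRingCat.of (secs U h)) ⟶ Y, Gen m ∧ Set.range m = U := by
  refine ⟨Spec.map (secsEquiv U h).toCommRingCatIso.hom ≫ hU.fromSpec, ?_, ?_⟩
  · rw [Gen, ← hU.fromSpecStalk_eq_fromSpecStalk h, IsAffineOpen.fromSpecStalk,
      ← Spec.map_comp_assoc]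
    rfl
  · rw [← hU.range_fromSpec]
    have hs : Function.Surjective (Spec.map (secsEquiv U h).toCommRingCatIso.hom) :=
      (Spec.map (secsEquiv U h).toCommRingCatIso.hom).surjective
    exact hs.range_comp hU.fromSpec

theorem dominant_subtype {F : Type} [Field F] (B : Subring F) :
    IsDominant (Spec.map (CommRingCat.ofHom B.subtype)) := by
  constructor
  exact (PrimeSpectrum.denseRange_comap_iff_ker_le_nilRadical _).2 (by
    rw [(RingHom.injective_iff_ker_eq_bot _).1 (Subtype.val_injective)]; exact bot_le)

theorem gen_unique [Y.IsSeparated] {B : Subring Y.functionField}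
    {m m' : Spec (CommRingCat.of B) ⟶ Y} (hm : Gen m) (hm' : Gen m') : m = m' := by
  have := dominant_subtype B
  exact ext_of_isDominant (Spec.map (CommRingCat.ofHom B.subtype)) (hm.trans hm'.symm)

theorem secs_le_of_range {B : Subring Y.functionField} {m : Spec (CommRingCat.of B) ⟶ Y}
    (hm : Gen m) {W : Y.Opens} (hW : IsAffineOpen W) (h : genericPoint Y ∈ W)
    (hr : Set.range m ⊆ W) : secs W h ≤ B := by
  have hr' : Set.range m ⊆ Set.range hW.fromSpec := by rwa [hW.range_fromSpec]
  let l := IsOpenImmersion.lift hW.fromSpec m hr'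
  have hl : l ≫ hW.fromSpec = m := IsOpenImmersion.lift_fac _ _ _
  obtain ⟨φ, hφ⟩ := Spec.map_surjective l
  have h1 : Spec.map (φ ≫ CommRingCat.ofHom B.subtype) =
      Spec.map (Y.presheaf.germ W (genericPoint Y) h) := by
    rw [← cancel_mono hW.fromSpec, Spec.map_comp, Category.assoc, hφ, hl]
    exact hm.trans (hW.fromSpecStalk_eq_fromSpecStalk h).symm
  have h2 := Spec.map_injective h1
  rintro _ ⟨s, rfl⟩
  rw [← h2]
  exact (φ.hom s).2

theorem le_of_secs_le [Y.IsSeparated] {U V : Y.Opens} (hU : IsAffineOpen U)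
    (hV : IsAffineOpen V) {h : genericPoint Y ∈ U} {h' : genericPoint Y ∈ V}
    (hle : secs U h ≤ secs V h') : V ≤ U := by
  obtain ⟨m, hm, hr⟩ := exists_fac hU h _ hle
  obtain ⟨m', hm', hr'⟩ := exists_fac_self hV h'
  rw [gen_unique hm hm', hr'] at hr
  exact hr

theorem eq_of_secs_eq [Y.IsSeparated] {U V : Y.Opens} (hU : IsAffineOpen U)
    (hV : IsAffineOpen V) {h : genericPoint Y ∈ U} {h' : genericPoint Y ∈ V}
    (hle : secs U h = secs V h') : U = V :=
  le_antisymm (le_of_secs_le hV hU hle.ge) (le_of_secs_le hU hV hle.le)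

theorem secs_inf [Y.IsSeparated] {U V : Y.Opens} (hU : IsAffineOpen U)
    (hV : IsAffineOpen V) (h : genericPoint Y ∈ U) (h' : genericPoint Y ∈ V) :
    secs (U ⊓ V) ⟨h, h'⟩ = secs U h ⊔ secs V h' := by
  apply le_antisymm
  · obtain ⟨m, hm, hr⟩ := exists_fac hU h (secs U h ⊔ secs V h') le_sup_left
    obtain ⟨m', hm', hr'⟩ := exists_fac hV h' (secs U h ⊔ secs V h') le_sup_right
    rw [← gen_unique hm hm'] at hr'
    exact secs_le_of_range hm (hU.inf hV) _ (Set.subset_inter hr hr')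
  · exact sup_le (secs_mono _ inf_le_left) (secs_mono _ inf_le_right)

theorem gen_mem_basicOpen {U : Y.Opens} {h : genericPoint Y ∈ U} {s : Γ(Y, U)}
    (hs : Y.presheaf.germ U _ h s ≠ 0) : genericPoint Y ∈ Y.basicOpen s := by
  rw [Scheme.mem_basicOpen Y s (genericPoint Y) h]
  exact isUnit_iff_ne_zero.2 hs

theorem secs_basicOpen {U : Y.Opens} (hU : IsAffineOpen U) (h : genericPoint Y ∈ U) (s : Γ(Y, U))
    (hs : Y.presheaf.germ U _ h s ≠ 0) :
    secs (Y.basicOpen s) (gen_mem_basicOpen hs) =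
      loc (secs U h) (Y.presheaf.germ U _ h s) := by
  have hle := Y.basicOpen_le s
  have hd := gen_mem_basicOpen hs
  apply le_antisymm
  · rintro _ ⟨t, rfl⟩
    have := hU.isLocalization_basicOpen s
    obtain ⟨n, a, ha⟩ := IsLocalization.Away.surj s t
    have e : Y.presheaf.germ _ _ hd t * (Y.presheaf.germ U _ h s)^n = Y.presheaf.germ U _ h a := by
      have h1 : ∀ b : Γ(Y, U), Y.presheaf.germ _ _ hd (algebraMap Γ(Y, U) Γ(Y, Y.basicOpen s) b) =
        Y.presheaf.germ U _ h b := fun b =>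
          Y.presheaf.germ_res_apply (homOfLE hle) (genericPoint Y) hd b
      rw [← h1 a, ← ha, map_mul, map_pow]
      congr 2
      exact (h1 s).symm
    have e2 : Y.presheaf.germ _ _ hd t = Y.presheaf.germ U _ h a * ((Y.presheaf.germ U _ h s)⁻¹)^n := by
      rw [← e, mul_assoc, ← mul_pow, mul_inv_cancel₀ hs, one_pow, mul_one]
    change Y.presheaf.germ _ _ hd t ∈ _
    rw [e2]
    exact mul_mem (le_loc _ _ ⟨a, rfl⟩) (pow_mem (inv_mem_loc _ _) _)
  · refine loc_le (secs_mono hd hle) ?_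
    have hu := RingedSpace.isUnit_res_basicOpen Y.toRingedSpace s
    obtain ⟨v, hv⟩ := hu.exists_left_inv
    refine ⟨v, ?_⟩
    rw [← mul_eq_one_iff_eq_inv₀ hs]
    have := congrArg (Y.presheaf.germ _ _ hd) hv
    have h3 := (map_mul (Y.presheaf.germ _ _ hd).hom _ _).symm.trans
      (this.trans (map_one (Y.presheaf.germ _ _ hd).hom))
    rw [← h3]
    congr 1
    exact (Y.presheaf.germ_res_apply (homOfLE hle) (genericPoint Y) hd s).symm

end
end WD
end

section
open AlgebraicGeometry CategoryTheory CategoryTheory.Limits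
namespace WD

section
variable {Y : Scheme.{0}} [IsIntegral Y]

theorem secs_iSup {ι : Type} [Nonempty ι] (V : ι → Y.Opens) (h : ∀ i, genericPoint Y ∈ V i)
    (h' : genericPoint Y ∈ iSup V) {f : Y.functionField} (hf : ∀ i, f ∈ secs (V i) (h i)) :
    f ∈ secs (iSup V) h' := by
  choose s hs using hf
  obtain ⟨t, ht, -⟩ := Y.sheaf.existsUnique_gluing V s (by
    intro i j
    have hij : genericPoint Y ∈ V i ⊓ V j := ⟨h i, h j⟩
    apply germ_injective_of_isIntegral Y _ hij
    have e1 := Y.presheaf.germ_res_apply (TopologicalSpace.Opens.infLELeft (V i) (V j))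
      (genericPoint Y) hij (s i)
    have e2 := Y.presheaf.germ_res_apply (TopologicalSpace.Opens.infLERight (V i) (V j))
      (genericPoint Y) hij (s j)
    exact e1.trans (((hs i).trans (hs j).symm).trans e2.symm))
  obtain ⟨i⟩ := ‹Nonempty ι›
  refine ⟨t, ?_⟩
  rw [← hs i]
  have := ht i
  rw [← this]
  exact (Y.presheaf.germ_res_apply (TopologicalSpace.Opens.leSupr V i) (genericPoint Y) (h i) t).symm

/-- the chart predicate -/
def PP (B : Subring Y.functionField) (y : Y) : Prop :=
  ∃ U : Y.Opens, IsAffineOpen U ∧ y ∈ U ∧ ∃ h, secs U h = B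

theorem exists_PP {B : Subring Y.functionField} : (∃ y, PP B y) ↔
    ∃ U : Y.Opens, IsAffineOpen U ∧ ∃ h, secs U h = B := by
  constructor
  · rintro ⟨y, U, h1, h2, h3⟩; exact ⟨U, h1, h3⟩
  · rintro ⟨U, h1, h, h3⟩; exact ⟨_, U, h1, h, h, h3⟩

theorem germ_ne_zero {U : Y.Opens} {h : genericPoint Y ∈ U} {s : Γ(Y, U)}
    (hs : genericPoint Y ∈ Y.basicOpen s) : Y.presheaf.germ U _ h s ≠ 0 := by
  rw [Scheme.mem_basicOpen Y s (genericPoint Y) h] at hs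
  exact isUnit_iff_ne_zero.1 hs

theorem chart_cover [Y.IsSeparated] (B : Subring Y.functionField) (y : Y) (hP : PP B y)
    {ι : Type} [Fintype ι] (a c : ι → Y.functionField)
    (ha : ∀ i, a i ∈ B) (ha0 : ∀ i, a i ≠ 0) (hc : ∀ i, c i ∈ B) (h1 : ∑ i, c i * a i = 1) :
    ∃ i, PP (loc B (a i)) y := by
  obtain ⟨U, hU, hy, h, rfl⟩ := hP
  choose s hs using ha
  choose t ht using hc
  have h2 : ∑ i, t i * s i = 1 := by
    apply germ_injective_of_isIntegral Y _ h
    rw [map_one, map_sum, ← h1]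
    refine Finset.sum_congr rfl fun i _ => ?_
    rw [map_mul, ← hs i, ← ht i]
  have h3 : Ideal.span (Set.range s) = ⊤ := by
    rw [Ideal.eq_top_iff_one, ← h2]
    exact Ideal.sum_mem _ fun i _ => Ideal.mul_mem_left _ _ (Ideal.subset_span ⟨i, rfl⟩)
  rw [← hU.self_le_iSup_basicOpen_iff] at h3
  have h4 := h3 hy
  rw [TopologicalSpace.Opens.mem_iSup] at h4
  obtain ⟨⟨_, i, rfl⟩, hi⟩ := h4
  refine ⟨i, Y.basicOpen (s i), hU.basicOpen _, hi, gen_mem hi, ?_⟩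
  rw [← hs i]
  exact secs_basicOpen hU h (s i) ((hs i).trans_ne (ha0 i))

theorem chart_basic (B : Subring Y.functionField) (hP : ∃ y, PP B y) (a : Y.functionField)
    (ha : a ∈ B) (ha0 : a ≠ 0) : ∃ y, PP (loc B a) y := by
  obtain ⟨U, hU, h, rfl⟩ := exists_PP.1 hP
  obtain ⟨s, rfl⟩ := ha
  exact exists_PP.2 ⟨Y.basicOpen s, hU.basicOpen _, _, secs_basicOpen hU h s ha0⟩

theorem chart_basic_le [Y.IsSeparated] (B : Subring Y.functionField) (hP : ∃ y, PP B y)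
    (a : Y.functionField) (y : Y) (h : PP (loc B a) y) : PP B y := by
  obtain ⟨U, hU, h, rfl⟩ := exists_PP.1 hP
  obtain ⟨V, hV, hy, h', e⟩ := h
  exact ⟨U, hU, le_of_secs_le hU hV (h := h) (h' := h') (by rw [e]; exact le_loc _ _) hy, h, rfl⟩

theorem chart_glue [Y.IsSeparated] (B : Subring Y.functionField)
    {ι : Type} [Fintype ι] (a c : ι → Y.functionField)
    (ha : ∀ i, a i ∈ B) (ha0 : ∀ i, a i ≠ 0) (hc : ∀ i, c i ∈ B) (h1 : ∑ i, c i * a i = 1)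
    (hP : ∀ i, ∃ y, PP (loc B (a i)) y) : ∃ y, PP B y := by
  have hne : Nonempty ι := by
    by_contra hn
    rw [not_nonempty_iff] at hn
    simp at h1
  simp only [exists_PP] at hP ⊢
  choose V hV h hs using hP
  obtain ⟨i0⟩ := id hne
  have hg : genericPoint Y ∈ iSup V := (le_iSup V i0) (h i0)
  have hB : secs (iSup V) hg = B := by
    apply le_antisymm
    · intro f hf
      refine mem_of_loc ha ha0 hc h1 fun i => ?_
      rw [← hs i]
      exact secs_mono (h i) (le_iSup V i) hf
    · intro f hf
      refine secs_iSup V h hg fun i => ?_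
      rw [hs i]
      exact le_loc _ _ hf
  refine ⟨iSup V, ?_, hg, hB⟩
  rw [← hB] at ha hc
  choose s hs' using ha
  choose t ht using hc
  have h2 : ∑ i, t i * s i = 1 := by
    apply germ_injective_of_isIntegral Y _ hg
    rw [map_one, map_sum, ← h1]
    refine Finset.sum_congr rfl fun i _ => ?_
    rw [map_mul, ← hs' i, ← ht i]
  refine isAffineOpen_of_isAffineOpen_basicOpen _ (Set.range s) ?_ ?_
  · rw [Ideal.eq_top_iff_one, ← h2]
    exact Ideal.sum_mem _ fun i _ => Ideal.mul_mem_left _ _ (Ideal.subset_span ⟨i, rfl⟩)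
  · rintro _ ⟨i, rfl⟩
    suffices hh : Y.basicOpen (s i) = V i by rw [hh]; exact hV i
    -- restriction to the pieces
    have key : ∀ j, ∃ r : Γ(Y, V j), Y.basicOpen r = V j ⊓ Y.basicOpen (s i) ∧
        Y.presheaf.germ _ _ (h j) r = a i := by
      intro j
      refine ⟨Y.presheaf.map (homOfLE (le_iSup V j)).op (s i), Y.basicOpen_res _ _, ?_⟩
      exact (Y.presheaf.germ_res_apply (homOfLE (le_iSup V j)) (genericPoint Y) (h j) (s i)).trans
        (hs' i)
    apply le_antisymm
    · intro x hx
      have hx' := Y.basicOpen_le _ hx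
      rw [TopologicalSpace.Opens.mem_iSup] at hx'
      obtain ⟨j, hj⟩ := hx'
      obtain ⟨r, hr, hra⟩ := key j
      have hxr : x ∈ Y.basicOpen r := by rw [hr]; exact ⟨hj, hx⟩
      have hr0 : Y.presheaf.germ _ _ (h j) r ≠ 0 := by rw [hra]; exact ha0 i
      refine le_of_secs_le (hV i) ((hV j).basicOpen r) (h := h i) (h' := gen_mem hxr) ?_ hxr
      rw [secs_basicOpen (hV j) (h j) r hr0, hs, hs, hra]
      exact loc_le ((le_loc _ _).trans (le_loc _ _)) (inv_mem_loc _ _)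
    · obtain ⟨r, hr, hra⟩ := key i
      have hr0 : Y.presheaf.germ _ _ (h i) r ≠ 0 := by rw [hra]; exact ha0 i
      have : Y.basicOpen r = V i := by
        refine eq_of_secs_eq ((hV i).basicOpen r) (hV i) (h := gen_mem_basicOpen hr0) (h' := h i) ?_
        rw [secs_basicOpen (hV i) (h i) r hr0, hs, hra]
        exact le_antisymm (loc_le le_rfl (inv_mem_loc _ _)) (le_loc _ _)
      rw [this] at hr
      exact inf_eq_left.1 hr.symm

theorem chart_frac (B : Subring Y.functionField) (y : Y) (hP : PP B y) (f : Y.functionField) :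
    ∃ a ∈ B, ∃ b ∈ B, b ≠ 0 ∧ f = a / b := by
  obtain ⟨U, hU, hy, h, rfl⟩ := hP
  have : Nonempty U := ⟨⟨y, hy⟩⟩
  have := functionField_isFractionRing_of_isAffineOpen Y U hU
  obtain ⟨a, b, hb, e⟩ := IsFractionRing.div_surjective Γ(Y, U) f
  refine ⟨Y.presheaf.germ U _ h a, ⟨a, rfl⟩, Y.presheaf.germ U _ h b, ⟨b, rfl⟩, ?_, e.symm⟩
  intro h0
  have : b = 0 := by
    apply germ_injective_of_isIntegral Y _ h
    rw [h0, map_zero]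
  exact nonZeroDivisors.ne_zero hb this

theorem chart_inter [Y.IsSeparated] (B B' : Subring Y.functionField) (y : Y) (h : PP B y)
    (h' : PP B' y) : PP (B ⊔ B') y := by
  obtain ⟨U, hU, hy, h, rfl⟩ := h
  obtain ⟨U', hU', hy', h', rfl⟩ := h'
  exact ⟨U ⊓ U', hU.inf hU', ⟨hy, hy'⟩, ⟨h, h'⟩, secs_inf hU hU' h h'⟩

theorem chart_inter_ne [Y.IsSeparated] (B B' : Subring Y.functionField) (h0 : ∃ y, PP B y)
    (h0' : ∃ y, PP B' y) : ∃ y, PP (B ⊔ B') y := by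
  obtain ⟨U, hU, h, rfl⟩ := exists_PP.1 h0
  obtain ⟨U', hU', h', rfl⟩ := exists_PP.1 h0'
  exact exists_PP.2 ⟨U ⊓ U', hU.inf hU', ⟨h, h'⟩, secs_inf hU hU' h h'⟩

theorem chart_cert [Y.IsSeparated] (A : Subring Y.functionField) (hA : ∃ y, PP A y)
    (J : Set (Subring Y.functionField)) (hJ : ∀ y, PP A y → ∃ B ∈ J, PP B y) :
    ∃ (ι : Type) (_ : Fintype ι) (a c : ι → Y.functionField), (∀ i, a i ∈ A) ∧ (∀ i, a i ≠ 0) ∧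
      (∀ i, c i ∈ A) ∧ ∑ i, c i * a i = 1 ∧
      ∀ i, ∃ B ∈ J, ∃ b ∈ B, b ≠ 0 ∧ loc A (a i) = loc B b := by
  obtain ⟨U, hU, h, rfl⟩ := exists_PP.1 hA
  let T : Set Γ(Y, U) := {s | (∃ y, y ∈ Y.basicOpen s) ∧ ∃ B ∈ J, ∃ b ∈ B, b ≠ 0 ∧
    loc (secs U h) (Y.presheaf.germ U _ h s) = loc B b}
  have hT : Ideal.span T = ⊤ := by
    rw [← hU.self_le_iSup_basicOpen_iff]
    intro y hy
    obtain ⟨B, hB, V, hV, hyV, h', rfl⟩ := hJ y ⟨U, hU, hy, h, rfl⟩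
    obtain ⟨f, g, e, hx⟩ := exists_basicOpen_le_affine_inter hU hV y ⟨hy, hyV⟩
    rw [TopologicalSpace.Opens.mem_iSup]
    have hg0 : Y.presheaf.germ V _ h' g ≠ 0 := germ_ne_zero (gen_mem (e ▸ hx))
    have hf0 : Y.presheaf.germ U _ h f ≠ 0 := germ_ne_zero (gen_mem hx)
    refine ⟨⟨f, ⟨y, hx⟩, _, hB, Y.presheaf.germ V _ h' g, ⟨g, rfl⟩, hg0, ?_⟩, hx⟩
    rw [← secs_basicOpen hU h f hf0, ← secs_basicOpen hV h' g hg0]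
    congr 1
  rw [Ideal.eq_top_iff_one, Ideal.span, Submodule.mem_span_set'] at hT
  obtain ⟨n, c, s, e⟩ := hT
  refine ⟨Fin n, inferInstance, fun i => Y.presheaf.germ U _ h (s i),
    fun i => Y.presheaf.germ U _ h (c i), fun i => ⟨_, rfl⟩, fun i => ?_, fun i => ⟨_, rfl⟩, ?_, ?_⟩
  · obtain ⟨y, hy⟩ := (s i).2.1
    exact germ_ne_zero (gen_mem hy)
  · rw [← map_one (Y.presheaf.germ U _ h).hom, ← e, map_sum]
    refine Finset.sum_congr rfl fun i _ => ?_
    rw [smul_eq_mul, map_mul]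
  · exact fun i => (s i).2.2

variable {k K : Type} [Field k] [Field K] [Algebra k K] [Algebra K Y.functionField]

/-- The chart system of `Y`. -/
def chartSys [Y.IsSeparated] (ρ : (K ≃ₐ[k] K) →* RingAut Y.functionField)
    (act : (K ≃ₐ[k] K) →* Aut Y)
    (hρ : ∀ σ (U : Y.Opens) h h', secs ((act σ⁻¹).hom ⁻¹ᵁ U) h' =
      (secs U h).map (ρ σ : Y.functionField →+* Y.functionField)) : ChartSys ρ where
  pt := Y
  P := PP
  act σ y := (act σ).hom y
  act_surj σ := by
    have : IsIso (act σ).hom := (act σ : Y ≅ Y).isIso_hom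
    exact (act σ).hom.surjective
  frac := chart_frac
  basic := chart_basic
  basic_le B hB a _ _ y h := chart_basic_le B hB a y h
  cover B y hB _ _ := chart_cover B y hB
  glue B _ _ _ := chart_glue B
  inter := chart_inter
  inter_ne := chart_inter_ne
  cert := chart_cert
  equi := by
    rintro σ _ y ⟨U, hU, hy, h, rfl⟩
    have hy' : (act σ).hom y ∈ (act σ⁻¹).hom ⁻¹ᵁ U := by
      change (act σ⁻¹).hom ((act σ).hom y) ∈ U
      rw [← Scheme.Hom.comp_apply]
      have : (act σ).hom ≫ (act σ⁻¹).hom = 𝟙 Y := by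
        rw [map_inv]; exact (act σ).hom_inv_id
      rw [this]; exact hy
    have : IsIso (act σ⁻¹).hom := (act σ⁻¹ : Y ≅ Y).isIso_hom
    exact ⟨(act σ⁻¹).hom ⁻¹ᵁ U, hU.preimage _, hy', gen_mem hy', hρ σ U h _⟩

end
end WD
end

namespace Paper

attribute [local instance] MvPolynomial.gradedAlgebra

/-- Projective `n`-space over a ring `K`, as `Proj` of the polynomial ring in `n + 1`
variables with its grading by total degree. -/
def ProjSpace (K : Type) [CommRing K] (n : ℕ) : Scheme :=
  Proj (MvPolynomial.homogeneousSubmodule (Fin (n + 1)) K)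

/-- The structure morphism `ℙⁿ_K ⟶ Spec K`. -/
def ProjSpace.structMap (K : Type) [CommRing K] (n : ℕ) :
    ProjSpace K n ⟶ Spec (CommRingCat.of K) :=
  Proj.toSpecZero _ ≫ Spec.map (CommRingCat.ofHom
    (algebraMap K (MvPolynomial.homogeneousSubmodule (Fin (n + 1)) K 0)))

/-- A scheme `Y` with structure morphism `p : Y ⟶ Spec K` is quasi-projective over `K` if
for some `n` there is an immersion (locally closed immersion) `Y ⟶ ℙⁿ_K` over `K`. -/
def QuasiProjectiveOver (K : Type) [CommRing K] {Y : Scheme}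
    (p : Y ⟶ Spec (CommRingCat.of K)) : Prop :=
  ∃ (n : ℕ) (f : Y ⟶ ProjSpace K n), IsImmersion f ∧ f ≫ ProjSpace.structMap K n = p

/-- A scheme `Y` with structure morphism `p : Y ⟶ Spec K` is quasi-affine over `K` if it is
of finite type over `K` and admits an open immersion over `K` into an affine `K`-scheme. -/
def QuasiAffineOver (K : Type) [CommRing K] {Y : Scheme}
    (p : Y ⟶ Spec (CommRingCat.of K)) : Prop :=
  LocallyOfFiniteType p ∧ QuasiCompact p ∧
    ∃ (Z : Scheme) (q : Z ⟶ Spec (CommRingCat.of K)) (j : Y ⟶ Z),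
      IsAffine Z ∧ IsOpenImmersion j ∧ j ≫ q = p

variable (k K : Type) [Field k] [Field K] [Algebra k K]

/-- The automorphism `Spec (σ⁻¹)` of `Spec K` attached to `σ ∈ Aut(K/k)`. -/
def specAut (σ : K ≃ₐ[k] K) : Spec (CommRingCat.of K) ⟶ Spec (CommRingCat.of K) :=
  Spec.map (CommRingCat.ofHom ((σ⁻¹ : K ≃ₐ[k] K) : K →+* K))

/-- A descent datum on the `K`-scheme `(Y, p)` with respect to `K/k`: an action of
`Aut(K/k)` on `Y` by scheme isomorphisms lifting the natural action on `Spec K`. -/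
structure DescentDatum (Y : Scheme) (p : Y ⟶ Spec (CommRingCat.of K)) where
  act : (K ≃ₐ[k] K) →* Aut Y
  compat : ∀ σ : K ≃ₐ[k] K, (act σ).hom ≫ p = p ≫ specAut k K σ

lemma specAut_comp (σ : K ≃ₐ[k] K) :
    specAut k K σ ≫ Spec.map (CommRingCat.ofHom (algebraMap k K)) =
      Spec.map (CommRingCat.ofHom (algebraMap k K)) := by
  rw [specAut, ← Spec.map_comp]
  congr 1
  ext x
  exact (σ⁻¹ : K ≃ₐ[k] K).commutes x

/-- The base change to `K` of a scheme `X` over `k`. -/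
def baseChange {X : Scheme} (q : X ⟶ Spec (CommRingCat.of k)) : Scheme :=
  pullback q (Spec.map (CommRingCat.ofHom (algebraMap k K)))

/-- The automorphism `id_X × Spec (σ⁻¹)` of the base change `X ×_{Spec k} Spec K`. -/
def baseChangeAut {X : Scheme} (q : X ⟶ Spec (CommRingCat.of k)) (σ : K ≃ₐ[k] K) :
    baseChange k K q ⟶ baseChange k K q :=
  pullback.map _ _ _ _ (𝟙 X) (specAut k K σ) (𝟙 (Spec (CommRingCat.of k)))
    (by simp) (by rw [Category.comp_id, specAut_comp])

/-- A scheme isomorphism fixes the generic point of an irreducible scheme. -/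
lemma aut_base_genericPoint {Y : Scheme} [IrreducibleSpace Y] (e : Y ≅ Y) :
    e.hom.base (genericPoint Y) = genericPoint Y := by
  let h : Y ≃ₜ Y := TopCat.homeoOfIso (Scheme.forgetToTop.mapIso e)
  have hg : IsGenericPoint (h (genericPoint Y)) (⊤ : Set Y) := by
    rw [IsGenericPoint, ← Set.image_singleton, ← h.image_closure,
      (genericPoint_spec Y).def, Set.top_eq_univ, Set.image_univ, h.surjective.range_eq]
  exact hg.eq (genericPoint_spec Y)

variable {k K}

/-- The action of `σ ∈ Aut(K/k)` on the function field of `Y`, given by pullback of rational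
functions along the action of `σ⁻¹` on `Y`. -/
def DescentDatum.ffAction {Y : Scheme} [IrreducibleSpace Y] {p : Y ⟶ Spec (CommRingCat.of K)}
    (D : DescentDatum k K Y p) (σ : K ≃ₐ[k] K) :
    Y.functionField ⟶ Y.functionField :=
  eqToHom (congrArg Y.presheaf.stalk (aut_base_genericPoint ((D.act σ⁻¹ : Aut Y) : Y ≅ Y)).symm) ≫
    (D.act σ⁻¹ : Aut Y).hom.stalkMap (genericPoint Y)

/-- Continuity of a descent datum on an irreducible scheme: every rational function
(i.e. element of the function field) is defined over a subfield of `K` that is finitely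
generated over `k`. -/
def DescentDatum.IsContinuous {Y : Scheme} [IrreducibleSpace Y]
    {p : Y ⟶ Spec (CommRingCat.of K)} (D : DescentDatum k K Y p) : Prop :=
  ∀ f : Y.functionField, ∃ L : IntermediateField k K, L.FG ∧
    ∀ σ : K ≃ₐ[k] K, (∀ x ∈ L, σ x = x) → D.ffAction σ f = f


end Paper

section
open AlgebraicGeometry CategoryTheory CategoryTheory.Limits
namespace WD
open Paper

section
variable {k K : Type} [Field k] [Field K] [Algebra k K]
variable {Y : Scheme.{0}} [IsIntegral Y] (p : Y ⟶ Spec (CommRingCat.of K))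

/-- The constants in the function field. -/
def ffMap : CommRingCat.of K ⟶ Y.functionField :=
  Spec.preimage (Y.fromSpecStalk (genericPoint Y) ≫ p)

theorem ffMap_spec : Spec.map (ffMap p) = Y.fromSpecStalk (genericPoint Y) ≫ p :=
  Spec.map_preimage _

/-- The `K`-algebra structure of the function field. -/
abbrev ffAlg : Algebra K Y.functionField := (ffMap p).hom.toAlgebra

theorem ffMap_eq {U : Y.Opens} (hU : IsAffineOpen U) (h : genericPoint Y ∈ U) :
    ffMap p = Spec.preimage (hU.fromSpec ≫ p) ≫ Y.presheaf.germ U _ h := by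
  apply Spec.map_injective
  rw [ffMap_spec, Spec.map_comp, Spec.map_preimage, ← hU.fromSpecStalk_eq_fromSpecStalk h,
    IsAffineOpen.fromSpecStalk, Category.assoc]

theorem ffMap_mem {U : Y.Opens} (hU : IsAffineOpen U) (h : genericPoint Y ∈ U) (c : K) :
    (ffMap p).hom c ∈ secs U h := by
  rw [ffMap_eq p hU h]
  exact ⟨_, rfl⟩

theorem map_eqToHom_fromSpecStalk {x x' : Y} (h : x = x') :
    Spec.map (eqToHom (congrArg Y.presheaf.stalk h)) ≫ Y.fromSpecStalk x = Y.fromSpecStalk x' := by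
  subst h
  simp

theorem eqToHom_germ {x x' : Y} (h : x = x') (U : Y.Opens) (hx : x ∈ U) :
    Y.presheaf.germ U x hx ≫ eqToHom (congrArg Y.presheaf.stalk h) =
      Y.presheaf.germ U x' (h ▸ hx) := by
  subst h
  simp

variable {p} (D : DescentDatum k K Y p)

theorem ffAction_spec (σ : K ≃ₐ[k] K) : Spec.map (D.ffAction σ) ≫ Y.fromSpecStalk (genericPoint Y) =
    Y.fromSpecStalk (genericPoint Y) ≫ (D.act σ⁻¹).hom := by
  rw [DescentDatum.ffAction, Spec.map_comp, Category.assoc, map_eqToHom_fromSpecStalk,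
    Scheme.SpecMap_stalkMap_fromSpecStalk]
  exact (aut_base_genericPoint (D.act σ⁻¹ : Y ≅ Y)).symm

theorem ffAction_one : D.ffAction 1 = 𝟙 _ := by
  apply Spec.map_injective
  rw [← cancel_mono (Y.fromSpecStalk (genericPoint Y)), ffAction_spec, inv_one, map_one]
  simp
  exact Category.comp_id _

theorem ffAction_mul (σ τ : K ≃ₐ[k] K) : D.ffAction (σ * τ) = D.ffAction τ ≫ D.ffAction σ := by
  apply Spec.map_injective
  rw [← cancel_mono (Y.fromSpecStalk (genericPoint Y)), ffAction_spec, Spec.map_comp,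
    Category.assoc, ffAction_spec, reassoc_of% (ffAction_spec D σ), mul_inv_rev, map_mul]
  rfl

/-- The action on the function field. -/
def rho : (K ≃ₐ[k] K) →* RingAut Y.functionField where
  toFun σ := RingEquiv.ofRingHom (D.ffAction σ).hom (D.ffAction σ⁻¹).hom
    (by rw [← CommRingCat.hom_comp, ← ffAction_mul, mul_inv_cancel, ffAction_one]; rfl)
    (by rw [← CommRingCat.hom_comp, ← ffAction_mul, inv_mul_cancel, ffAction_one]; rfl)
  map_one' := by
    ext f
    change (D.ffAction 1).hom f = f
    rw [ffAction_one]; rfl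
  map_mul' σ τ := by
    ext f
    change (D.ffAction (σ * τ)).hom f = _
    rw [ffAction_mul]; rfl

theorem rho_apply (σ : K ≃ₐ[k] K) (f : Y.functionField) : rho D σ f = D.ffAction σ f := rfl

theorem rho_const (σ : K ≃ₐ[k] K) (c : K) : rho D σ ((ffMap p).hom c) = (ffMap p).hom (σ c) := by
  have : ffMap p ≫ D.ffAction σ = CommRingCat.ofHom (σ : K →+* K) ≫ ffMap p := by
    apply Spec.map_injective
    rw [Spec.map_comp, Spec.map_comp, ffMap_spec, ← Category.assoc, ffAction_spec, Category.assoc,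
      D.compat, specAut, inv_inv, Category.assoc]
  exact congrArg (fun φ => φ.hom c) this

theorem secs_act (σ : K ≃ₐ[k] K) (U : Y.Opens) (h) (h') : secs ((D.act σ⁻¹).hom ⁻¹ᵁ U) h' =
      (secs U h).map (rho D σ : Y.functionField →+* Y.functionField) := by
  have : IsIso (D.act σ⁻¹).hom := (D.act σ⁻¹ : Y ≅ Y).isIso_hom
  have e : Y.presheaf.germ U _ h ≫ D.ffAction σ =
      (D.act σ⁻¹).hom.app U ≫ Y.presheaf.germ _ _ h' := by
    rw [DescentDatum.ffAction, ← Category.assoc, eqToHom_germ, Scheme.Hom.germ_stalkMap]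
    exact (aut_base_genericPoint (D.act σ⁻¹ : Y ≅ Y)).symm
  ext f
  constructor
  · rintro ⟨s, rfl⟩
    refine ⟨_, ⟨inv ((D.act σ⁻¹).hom.app U) s, rfl⟩, ?_⟩
    have := congrArg (fun φ => (inv ((D.act σ⁻¹).hom.app U) ≫ φ).hom s) e
    simp only [IsIso.inv_hom_id_assoc] at this
    exact this
  · rintro ⟨_, ⟨s, rfl⟩, rfl⟩
    exact ⟨_, (congrArg (fun φ => φ.hom s) e).symm⟩

end
end WD
end

section
open AlgebraicGeometry CategoryTheory CategoryTheory.Limits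
namespace WD
open Paper
attribute [local instance] MvPolynomial.gradedAlgebra

theorem zero_surj (K : Type) [CommRing K] (n : ℕ) : Function.Surjective
    (algebraMap K (MvPolynomial.homogeneousSubmodule (Fin (n + 1)) K 0)) := by
  rintro ⟨f, hf⟩
  rw [MvPolynomial.mem_homogeneousSubmodule] at hf
  refine ⟨MvPolynomial.coeff 0 f, Subtype.ext ?_⟩
  exact (MvPolynomial.totalDegree_eq_zero_iff_eq_C.1
    (Nat.le_zero.1 (MvPolynomial.IsHomogeneous.totalDegree_le hf))).symm

theorem finiteType_zero (K : Type) [CommRing K] (n : ℕ) : Algebra.FiniteType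
    (MvPolynomial.homogeneousSubmodule (Fin (n + 1)) K 0) (MvPolynomial (Fin (n+1)) K) :=
  ⟨⟨(Set.finite_range (MvPolynomial.X : Fin (n + 1) → MvPolynomial (Fin (n + 1)) K)).toFinset, by
    rw [eq_top_iff]
    rintro f -
    induction f using MvPolynomial.induction_on with
    | C a =>
      exact Subalgebra.algebraMap_mem _
        (⟨MvPolynomial.C a, MvPolynomial.isHomogeneous_C _ _⟩ :
          MvPolynomial.homogeneousSubmodule (Fin (n + 1)) K 0)
    | add f g hf hg => exact add_mem hf hg
    | mul_X f i hf => exact mul_mem hf (Algebra.subset_adjoin (by simp))⟩⟩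

instance projSep (K : Type) [CommRing K] (n : ℕ) : (ProjSpace K n).IsSeparated :=
  inferInstanceAs (Proj _).IsSeparated

theorem structMap_lft (K : Type) [CommRing K] (n : ℕ) :
    LocallyOfFiniteType (ProjSpace.structMap K n) := by
  have := finiteType_zero K n
  have : LocallyOfFiniteType (Spec.map (CommRingCat.ofHom
    (algebraMap K (MvPolynomial.homogeneousSubmodule (Fin (n + 1)) K 0)))) := by
    rw [HasRingHomProperty.Spec_iff (P := @LocallyOfFiniteType)]
    exact RingHom.FiniteType.of_surjective _ (zero_surj K n)
  rw [ProjSpace.structMap]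
  have : LocallyOfFiniteType (Proj.toSpecZero (MvPolynomial.homogeneousSubmodule (Fin (n + 1)) K)) := inferInstance
  exact MorphismProperty.comp_mem _ _ _ ‹_› ‹_›

theorem structMap_qc (K : Type) [CommRing K] (n : ℕ) :
    QuasiCompact (ProjSpace.structMap K n) := by
  have := finiteType_zero K n
  rw [ProjSpace.structMap]
  have : QuasiCompact (Proj.toSpecZero (MvPolynomial.homogeneousSubmodule (Fin (n + 1)) K)) := inferInstance
  exact MorphismProperty.comp_mem _ _ _ ‹_› inferInstance

theorem proj_noeth (K : Type) [Field K] (n : ℕ) : IsNoetherian (ProjSpace K n) := by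
  have := structMap_lft K n
  have := structMap_qc K n
  have h1 : IsLocallyNoetherian (ProjSpace K n) :=
    LocallyOfFiniteType.isLocallyNoetherian (ProjSpace.structMap K n)
  have h2 : CompactSpace (ProjSpace K n) :=
    QuasiCompact.compactSpace_of_compactSpace (ProjSpace.structMap K n)
  constructor

section
variable {K : Type} [Field K] {Y : Scheme.{0}} {p : Y ⟶ Spec (CommRingCat.of K)}

theorem QP.lft (h : QuasiProjectiveOver K p) : LocallyOfFiniteType p := by
  obtain ⟨n, f, hf, rfl⟩ := h
  have := structMap_lft K n
  infer_instance

theorem QP.sep (h : QuasiProjectiveOver K p) : Y.IsSeparated := by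
  obtain ⟨n, f, hf, rfl⟩ := h
  constructor
  have : terminal.from Y = f ≫ terminal.from _ := (terminal.comp_from f).symm
  rw [this]
  have := (projSep K n).isSeparated_terminal_from
  infer_instance

theorem QP.compact (h : QuasiProjectiveOver K p) : CompactSpace Y := by
  obtain ⟨n, f, hf, rfl⟩ := h
  have := proj_noeth K n
  have : TopologicalSpace.NoetherianSpace Y := f.isEmbedding.isInducing.noetherianSpace
  infer_instance

end
end WD
end

section
open AlgebraicGeometry CategoryTheory CategoryTheory.Limits
namespace WD
open Paper

section
variable {K : Type} [Field K] {Y : Scheme.{0}} [IsIntegral Y] (p : Y ⟶ Spec (CommRingCat.of K))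

theorem fg_secs [LocallyOfFiniteType p] {U : Y.Opens} (hU : IsAffineOpen U)
    (h : genericPoint Y ∈ U) : letI := ffAlg p; ∃ G : Set Y.functionField, G.Finite ∧
      secs U h = Kc K G := by
  letI := ffAlg p
  have h1 : LocallyOfFiniteType (hU.fromSpec ≫ p) := inferInstance
  rw [← Spec.map_preimage (hU.fromSpec ≫ p), HasRingHomProperty.Spec_iff (P := @LocallyOfFiniteType)]
    at h1
  letI : Algebra K Γ(Y, U) := (Spec.preimage (hU.fromSpec ≫ p)).hom.toAlgebra
  obtain ⟨T, hT⟩ := Algebra.FiniteType.out (self := h1)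
  have hc : ∀ c, algebraMap K Y.functionField c =
      Y.presheaf.germ U _ h (Spec.preimage (hU.fromSpec ≫ p) c) := by
    intro c
    change (ffMap p).hom c = _
    rw [ffMap_eq p hU h]
    rfl
  refine ⟨(Y.presheaf.germ U _ h) '' (T : Set Γ(Y, U)), T.finite_toSet.image _, ?_⟩
  apply le_antisymm
  · rintro _ ⟨s, rfl⟩
    have hs : s ∈ Algebra.adjoin K (T : Set Γ(Y, U)) := by
      have : s ∈ (⊤ : Subalgebra K Γ(Y, U)) := trivial
      rw [← hT] at this
      exact this
    induction hs using Algebra.adjoin_induction with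
    | mem x hx => exact subset_Kc _ ⟨x, hx, rfl⟩
    | algebraMap c =>
      have := algebraMap_mem_Kc ((Y.presheaf.germ U _ h) '' (T : Set Γ(Y, U))) c
      rw [hc] at this
      exact this
    | add x y _ _ hx hy => rw [map_add]; exact add_mem hx hy
    | mul x y _ _ hx hy => rw [map_mul]; exact mul_mem hx hy
  · refine Kc_le (fun c => ffMap_mem p hU h c) ?_
    rintro _ ⟨x, hx, rfl⟩
    exact ⟨x, rfl⟩

theorem exists_pow_mul [Y.IsSeparated] [CompactSpace Y] (f : Γ(Y, ⊤))
    (hd : genericPoint Y ∈ Y.basicOpen f) {g : Y.functionField} (hg : g ∈ secs (Y.basicOpen f) hd) :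
    ∃ n : ℕ, (Y.presheaf.germ ⊤ _ trivial f) ^ n * g ∈ secs ⊤ (trivial : genericPoint Y ∈ (⊤ : Y.Opens)) := by
  obtain ⟨z, rfl⟩ := hg
  have hq : QuasiSeparatedSpace Y := inferInstance
  obtain ⟨n, y, e⟩ := exists_eq_pow_mul_of_isCompact_of_isQuasiSeparated Y ⊤ isCompact_univ
    (isQuasiSeparated_univ) f z
  refine ⟨n, y, ?_⟩
  have h1 : ∀ b : Γ(Y, ⊤), Y.presheaf.germ (Y.basicOpen f) _ hd (Y.presheaf.map (homOfLE (Y.basicOpen_le f)).op b) =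
      Y.presheaf.germ ⊤ _ trivial b := fun b =>
          Y.presheaf.germ_res_apply (homOfLE (Y.basicOpen_le f)) (genericPoint Y) hd b
  have h2 := congrArg (Y.presheaf.germ (Y.basicOpen f) _ hd) e
  refine (h1 y).symm.trans (h2.trans ?_)
  refine (map_mul (Y.presheaf.germ (Y.basicOpen f) _ hd).hom _ _).trans ?_
  congr 1
  refine (map_pow (Y.presheaf.germ (Y.basicOpen f) _ hd).hom _ _).trans ?_
  congr 1
  exact h1 f

theorem exists_T [Y.IsQuasiAffine] : ∃ T : Set Γ(Y, ⊤), T.Finite ∧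
    (∀ f ∈ T, IsAffineOpen (Y.basicOpen f) ∧ genericPoint Y ∈ Y.basicOpen f) ∧
    (∀ y, ∃ f ∈ T, y ∈ Y.basicOpen f) ∧ (IsAffine Y → 1 ∈ T) := by
  by_cases hA : IsAffine Y
  · refine ⟨{1}, Set.finite_singleton _, ?_, fun y => ⟨1, rfl, ?_⟩, fun _ => rfl⟩
    · rintro _ rfl
      rw [Y.basicOpen_of_isUnit isUnit_one]
      exact ⟨isAffineOpen_top Y, trivial⟩
    · rw [Y.basicOpen_of_isUnit isUnit_one]; trivial
  · have hb : ∀ y : Y, ∃ r : Γ(Y, ⊤), IsAffineOpen (Y.basicOpen r) ∧ y ∈ Y.basicOpen r := by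
      intro y
      obtain ⟨_, ⟨_, ⟨r, hr, rfl⟩, rfl⟩, hxr, -⟩ := (Scheme.IsQuasiAffine.isBasis_basicOpen
        Y).exists_subset_of_mem_open (Set.mem_univ y) isOpen_univ
      exact ⟨r, hr, hxr⟩
    choose r hr hy using hb
    obtain ⟨t, ht⟩ := isCompact_univ.elim_finite_subcover (fun y : Y => (Y.basicOpen (r y) : Set Y))
      (fun y => (Y.basicOpen (r y)).isOpen) (fun y _ => Set.mem_iUnion.2 ⟨y, hy y⟩)
    refine ⟨r '' t, t.finite_toSet.image _, ?_, ?_, fun h => (hA h).elim⟩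
    · rintro _ ⟨y, -, rfl⟩
      exact ⟨hr y, gen_mem (hy y)⟩
    · intro y
      have := ht (Set.mem_univ y)
      simp only [Set.mem_iUnion] at this
      obtain ⟨z, hz, hyz⟩ := this
      exact ⟨r z, ⟨z, hz, rfl⟩, hyz⟩

/-- Geometric input in terms of `PP`. -/
structure GeoP (p : Y ⟶ Spec (CommRingCat.of K)) (S J : Set Y.functionField) : Prop where
  sub : J ⊆ S
  nz : ∀ e ∈ J, e ≠ 0
  ch : letI := ffAlg p; ∀ e ∈ J, ∃ y, PP (BE K S e) y
  cov : letI := ffAlg p; ∀ y, ∃ e ∈ J, PP (BE K S e) y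

theorem alpha_qa [Y.IsSeparated] [Y.IsQuasiAffine] [LocallyOfFiniteType p] :
    ∃ S J : Set Y.functionField, S.Finite ∧ GeoP p S J ∧ (letI := ffAlg p; Reg K S J) ∧ 1 ∈ S ∧
      (IsAffine Y → 1 ∈ J) := by
  letI := ffAlg p
  obtain ⟨T, hT, hTa, hTc, hT1⟩ := exists_T (Y := Y)
  let γ : Γ(Y, ⊤) → Y.functionField := fun f => Y.presheaf.germ ⊤ _ trivial f
  have key : ∀ f : T, ∃ (G : Set Y.functionField) (n : ℕ), G.Finite ∧
      secs (Y.basicOpen f.1) (hTa f.1 f.2).2 = Kc K G ∧ ∀ g ∈ G, γ f.1 ^ n * g ∈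
        secs ⊤ (trivial : genericPoint Y ∈ (⊤ : Y.Opens)) := by
    intro f
    obtain ⟨G, hG, e⟩ := fg_secs p (hTa f.1 f.2).1 (hTa f.1 f.2).2
    have h1 : ∀ g : G, ∃ n : ℕ, γ f.1 ^ n * g ∈
        secs ⊤ (trivial : genericPoint Y ∈ (⊤ : Y.Opens)) := by
      rintro ⟨g, hg⟩
      refine exists_pow_mul f.1 (hTa f.1 f.2).2 ?_
      rw [e]; exact subset_Kc _ hg
    choose n hn using h1
    have : Fintype G := hG.fintype
    refine ⟨G, ∑ g, n g, hG, e, fun g hg => ?_⟩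
    have h2 : n ⟨g, hg⟩ ≤ ∑ g, n g := Finset.single_le_sum (f := n) (fun _ _ => Nat.zero_le _) (Finset.mem_univ _)
    obtain ⟨m, hm⟩ := Nat.exists_eq_add_of_le h2
    rw [hm, pow_add, mul_assoc, mul_left_comm]
    exact mul_mem (pow_mem (mem_secs.2 ⟨f.1, rfl⟩) m) (hn ⟨g, hg⟩)
  choose G n hG hGe hGn using key
  have : Finite T := hT
  let J : Set Y.functionField := Set.range fun f : T => γ f.1 ^ n f
  let S : Set Y.functionField := {1} ∪ J ∪ ⋃ f : T, (fun g => γ f.1 ^ n f * g) '' G f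
  have hne : ∀ f : T, γ f.1 ≠ 0 := fun f => germ_ne_zero (hTa f.1 f.2).2
  have hS : S ⊆ (secs (⊤ : Y.Opens) (trivial : genericPoint Y ∈ (⊤ : Y.Opens)) : Set Y.functionField) := by
    rintro s ((rfl | ⟨f, rfl⟩) | hs)
    · exact one_mem _
    · exact pow_mem (mem_secs.2 ⟨f.1, rfl⟩) _
    · obtain ⟨f, hf⟩ := Set.mem_iUnion.1 hs
      obtain ⟨g, hg, rfl⟩ := hf
      exact hGn f g hg
  have hS' : ∀ f : T, S ⊆ (secs (Y.basicOpen f.1) (hTa f.1 f.2).2 : Set Y.functionField) := fun f =>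
    hS.trans (secs_mono _ (Y.basicOpen_le f.1))
  have hBE : ∀ f : T, BE K S (γ f.1 ^ n f) = secs (Y.basicOpen f.1) (hTa f.1 f.2).2 := by
    intro f
    have hinv : (γ f.1)⁻¹ ∈ secs (Y.basicOpen f.1) (hTa f.1 f.2).2 := by
      have hu := RingedSpace.isUnit_res_basicOpen Y.toRingedSpace f.1
      obtain ⟨v, hv⟩ := hu.exists_left_inv
      refine ⟨v, ?_⟩
      rw [← mul_eq_one_iff_eq_inv₀ (hne f)]
      have := congrArg (Y.presheaf.germ _ _ (hTa f.1 f.2).2) hv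
      have h3 := (map_mul (Y.presheaf.germ _ _ (hTa f.1 f.2).2).hom _ _).symm.trans
        (this.trans (map_one (Y.presheaf.germ _ _ (hTa f.1 f.2).2).hom))
      rw [← h3]
      congr 1
      exact (Y.presheaf.germ_res_apply (homOfLE (Y.basicOpen_le f.1)) (genericPoint Y) (hTa f.1 f.2).2 f.1).symm
    apply le_antisymm
    · refine BE_le (fun c => ffMap_mem p (hTa f.1 f.2).1 _ c) fun s hs => ?_
      rw [div_eq_mul_inv, ← inv_pow]
      exact mul_mem (hS' f hs) (pow_mem hinv _)
    · rw [hGe f]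
      refine Kc_le (algebraMap_mem_BE _ _) fun g hg => ?_
      have : γ f.1 ^ n f * g ∈ S := Or.inr (Set.mem_iUnion.2 ⟨f, g, hg, rfl⟩)
      have h3 := div_mem_BE (K := K) (γ f.1 ^ n f) this
      rwa [mul_div_cancel_left₀ _ (pow_ne_zero _ (hne f))] at h3
  refine ⟨S, J, ?_, ⟨?_, ?_, ?_, ?_⟩, ?_, ?_, ?_⟩
  · refine ((Set.finite_singleton _).union (Set.finite_range _)).union
      (Set.finite_iUnion fun f => (hG f).image _)
  · exact fun e he => Or.inl (Or.inr he)
  · rintro _ ⟨f, rfl⟩; exact pow_ne_zero _ (hne f)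
  · rintro _ ⟨f, rfl⟩
    exact exists_PP.2 ⟨Y.basicOpen f.1, (hTa f.1 f.2).1, _, (hBE f).symm⟩
  · intro y
    obtain ⟨f, hf, hy⟩ := hTc y
    exact ⟨_, ⟨⟨f, hf⟩, rfl⟩, Y.basicOpen f, (hTa f hf).1, hy, _, (hBE ⟨f, hf⟩).symm⟩
  · rintro _ ⟨f, rfl⟩
    dsimp only
    rw [hBE f]
    exact hS' f
  · exact Or.inl (Or.inl rfl)
  · intro hA
    refine ⟨⟨1, hT1 hA⟩, ?_⟩
    have : γ 1 = 1 := map_one (Y.presheaf.germ ⊤ (genericPoint Y) trivial).hom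
    dsimp only
    rw [this, one_pow]

end
end WD
end

section
open AlgebraicGeometry CategoryTheory CategoryTheory.Limits
namespace WD
open Paper

section
variable {A σ : Type} [CommRing A] [SetLike σ A] [AddSubgroupClass σ A] (𝒜 : ℕ → σ) [GradedRing 𝒜]
  {Y : Scheme.{0}} [IsIntegral Y] (f : Y ⟶ Proj 𝒜)

/-- Pull back of homogeneous fractions to the function field. -/
def chi (g : A) (h : genericPoint Y ∈ f ⁻¹ᵁ Proj.basicOpen 𝒜 g) :
    HomogeneousLocalization.Away 𝒜 g →+* Y.functionField :=
  (Proj.awayToSection 𝒜 g ≫ f.app (Proj.basicOpen 𝒜 g) ≫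
    Y.presheaf.germ (f ⁻¹ᵁ Proj.basicOpen 𝒜 g) (genericPoint Y) h).hom

theorem chi_awayMap {g g' x : A} {m' : ℕ} (hg' : g' ∈ 𝒜 m') (hx : x = g * g')
    (h : genericPoint Y ∈ f ⁻¹ᵁ Proj.basicOpen 𝒜 g)
    (h' : genericPoint Y ∈ f ⁻¹ᵁ Proj.basicOpen 𝒜 x) (z : HomogeneousLocalization.Away 𝒜 g) :
    chi 𝒜 f x h' (HomogeneousLocalization.awayMap 𝒜 hg' hx z) = chi 𝒜 f g h z := by
  have h1 := Proj.awayMap_awayToSection 𝒜 (f := g) hg' hx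
  have h2 : CommRingCat.ofHom (HomogeneousLocalization.awayMap 𝒜 hg' hx) ≫
      (Proj.awayToSection 𝒜 x ≫ f.app (Proj.basicOpen 𝒜 x) ≫
        Y.presheaf.germ (f ⁻¹ᵁ Proj.basicOpen 𝒜 x) (genericPoint Y) h') =
      (Proj.awayToSection 𝒜 g ≫ f.app (Proj.basicOpen 𝒜 g) ≫
        Y.presheaf.germ (f ⁻¹ᵁ Proj.basicOpen 𝒜 g) (genericPoint Y) h) := by
    rw [reassoc_of% h1, f.naturality_assoc]
    congr 2
    exact Y.presheaf.germ_res _ _ _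
  exact congrArg (fun φ => φ.hom z) h2

open Classical in
/-- The fraction `a / b` as a rational function. -/
def qf (M : ℕ) (a b : A) : Y.functionField :=
  if h : a ∈ 𝒜 M ∧ b ∈ 𝒜 M ∧ genericPoint Y ∈ f ⁻¹ᵁ Proj.basicOpen 𝒜 b then
    chi 𝒜 f b h.2.2 (HomogeneousLocalization.Away.mk 𝒜 h.2.1 1 a (by simpa using h.1)) else 0

theorem qf_eq {M : ℕ} {a b : A} (ha : a ∈ 𝒜 M) (hb : b ∈ 𝒜 M)
    (h : genericPoint Y ∈ f ⁻¹ᵁ Proj.basicOpen 𝒜 b) : qf 𝒜 f M a b =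
    chi 𝒜 f b h (HomogeneousLocalization.Away.mk 𝒜 hb 1 a (by simpa using ha)) :=
  dif_pos ⟨ha, hb, h⟩

theorem qf_self {M : ℕ} {b : A} (hb : b ∈ 𝒜 M)
    (h : genericPoint Y ∈ f ⁻¹ᵁ Proj.basicOpen 𝒜 b) : qf 𝒜 f M b b = 1 := by
  rw [qf_eq 𝒜 f hb hb h]
  refine Eq.trans (congrArg _ ?_) (map_one _)
  apply HomogeneousLocalization.val_injective
  rw [HomogeneousLocalization.Away.val_mk, HomogeneousLocalization.val_one]
  have h1 := Localization.mk_self (⟨b ^ 1, 1, rfl⟩ : Submonoid.powers b)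
  simpa using h1

theorem qf_mul {M : ℕ} {a b c : A} (ha : a ∈ 𝒜 M) (hb : b ∈ 𝒜 M) (hc : c ∈ 𝒜 M)
    (h : genericPoint Y ∈ f ⁻¹ᵁ Proj.basicOpen 𝒜 b)
    (h' : genericPoint Y ∈ f ⁻¹ᵁ Proj.basicOpen 𝒜 c) :
    qf 𝒜 f M a b * qf 𝒜 f M b c = qf 𝒜 f M a c := by
  have h2 : genericPoint Y ∈ f ⁻¹ᵁ Proj.basicOpen 𝒜 (b * c) := by
    rw [Proj.basicOpen_mul]; exact ⟨h, h'⟩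
  rw [qf_eq 𝒜 f ha hb h, qf_eq 𝒜 f hb hc h', qf_eq 𝒜 f ha hc h',
    ← chi_awayMap 𝒜 f hc rfl h h2, ← chi_awayMap 𝒜 f hb (mul_comm b c) h' h2,
    ← chi_awayMap 𝒜 f hb (mul_comm b c) h' h2, ← map_mul]
  congr 1
  apply HomogeneousLocalization.val_injective
  rw [HomogeneousLocalization.val_mul, HomogeneousLocalization.awayMap_mk,
    HomogeneousLocalization.awayMap_mk, HomogeneousLocalization.awayMap_mk,
    HomogeneousLocalization.Away.val_mk,
    HomogeneousLocalization.Away.val_mk, HomogeneousLocalization.Away.val_mk, Localization.mk_mul,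
    Localization.mk_eq_mk_iff, Localization.r_iff_exists]
  refine ⟨1, ?_⟩
  simp
  ring

theorem qf_pow {d : ℕ} {g : A} (hg : g ∈ 𝒜 d) (h : genericPoint Y ∈ f ⁻¹ᵁ Proj.basicOpen 𝒜 g)
    (z : HomogeneousLocalization.Away 𝒜 g) : ∃ n0, ∀ n ≥ n0, 0 < n → ∃ a ∈ 𝒜 (n * d),
      chi 𝒜 f g h z = qf 𝒜 f (n * d) a (g ^ n) := by
  obtain ⟨n0, a, ha, rfl⟩ := HomogeneousLocalization.Away.mk_surjective 𝒜 hg z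
  refine ⟨n0, fun n hn hn0 => ?_⟩
  obtain ⟨r, rfl⟩ := Nat.exists_eq_add_of_le hn
  have ha' : a * g ^ r ∈ 𝒜 ((n0 + r) * d) := by
    rw [add_mul]
    exact SetLike.mul_mem_graded ha (SetLike.pow_mem_graded r hg)
  have h1 : genericPoint Y ∈ f ⁻¹ᵁ Proj.basicOpen 𝒜 (g ^ (n0 + r)) := by
    rwa [Proj.basicOpen_pow _ _ _ hn0]
  refine ⟨a * g ^ r, ha', ?_⟩
  have hp : g ^ (n0 + r) ∈ 𝒜 ((n0 + r) * d) := SetLike.pow_mem_graded (n0 + r) hg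
  have hp' : g ^ (n0 + r - 1) ∈ 𝒜 ((n0 + r - 1) * d) := SetLike.pow_mem_graded (n0 + r - 1) hg
  have hx : g ^ (n0 + r) = g * g ^ (n0 + r - 1) := by
    rw [← pow_succ']; congr 1; omega
  rw [qf_eq 𝒜 f ha' hp h1, ← chi_awayMap 𝒜 f hp' hx h h1]
  congr 1
  apply HomogeneousLocalization.val_injective
  rw [HomogeneousLocalization.awayMap_mk,
    HomogeneousLocalization.Away.val_mk, HomogeneousLocalization.Away.val_mk,
    Localization.mk_eq_mk_iff, Localization.r_iff_exists]
  refine ⟨1, ?_⟩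
  obtain ⟨t, ht⟩ : ∃ t, n0 + r = t + 1 := ⟨n0 + r - 1, by omega⟩
  simp only [pow_one, OneMemClass.coe_one, one_mul]
  rw [← pow_mul, ← pow_mul]
  have e1 : (n0 + r) * n0 + r = n0 + r + (n0 + r - 1) * n0 := by
    have : n0 + r - 1 = t := by omega
    rw [this, ht]
    nlinarith
  rw [mul_left_comm, mul_left_comm (g ^ _) a, ← pow_add, ← pow_add, e1]

theorem imm_affine [IsImmersion f] {V : (Proj 𝒜).Opens} (hV : IsAffineOpen V)
    (hVW : V ≤ f.coborderRange) : IsAffineOpen (f ⁻¹ᵁ V) ∧ Function.Surjective (f.app V) := by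
  let V' : f.coborderRange.toScheme.Opens := f.coborderRange.ι ⁻¹ᵁ V
  have hV' : f.coborderRange.ι ''ᵁ V' = V := by
    rw [Scheme.Hom.image_preimage_eq_opensRange_inf, Scheme.Opens.opensRange_ι]
    exact inf_eq_right.2 hVW
  have hA : IsAffineOpen V' := by
    rw [← Scheme.Hom.isAffineOpen_iff_of_isOpenImmersion f.coborderRange.ι, hV']
    exact hV
  have h1 := hA.preimage f.liftCoborder
  have h2 := f.liftCoborder.app_surjective V' hA
  rw [liftCoborder_app] at h2
  rw [Scheme.Hom.liftCoborder_preimage, hV'] at h1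
  refine ⟨h1, ?_⟩
  have h3 : Function.Surjective (f.app (f.coborderRange.ι ''ᵁ V')) := by
    intro x
    obtain ⟨y, hy⟩ := h2 (Y.presheaf.map (eqToHom <| f.liftCoborder_preimage V').op x)
    refine ⟨y, ?_⟩
    have : Function.Injective (Y.presheaf.map (eqToHom <| f.liftCoborder_preimage V').op) :=
      (ConcreteCategory.bijective_of_isIso _).1
    exact this hy
  rwa [hV'] at h3

theorem chi_range [IsImmersion f] {d : ℕ} {g : A} (hg : g ∈ 𝒜 d) (hd : 0 < d)
    (hW : Proj.basicOpen 𝒜 g ≤ f.coborderRange)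
    (h : genericPoint Y ∈ f ⁻¹ᵁ Proj.basicOpen 𝒜 g) :
    secs (f ⁻¹ᵁ Proj.basicOpen 𝒜 g) h = (chi 𝒜 f g h).range := by
  have h1 := (imm_affine 𝒜 f (Proj.isAffineOpen_basicOpen 𝒜 g hg hd) hW).2
  have h2 : Function.Surjective (Proj.awayToSection 𝒜 g) := by
    rw [← Proj.basicOpenIsoAway_hom 𝒜 g hg hd]
    exact (ConcreteCategory.bijective_of_isIso _).2
  ext z
  rw [mem_secs]
  constructor
  · rintro ⟨s, rfl⟩
    obtain ⟨s, rfl⟩ := h1 s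
    obtain ⟨s, rfl⟩ := h2 s
    exact ⟨s, rfl⟩
  · rintro ⟨s, rfl⟩
    exact ⟨_, rfl⟩

theorem qf_mem {M : ℕ} (a b : A)
    (h : genericPoint Y ∈ f ⁻¹ᵁ Proj.basicOpen 𝒜 b) :
    qf 𝒜 f M a b ∈ secs (f ⁻¹ᵁ Proj.basicOpen 𝒜 b) h := by
  rw [qf]
  split_ifs with h1
  · exact ⟨_, rfl⟩
  · exact zero_mem _

theorem exists_basic (y : Proj 𝒜) (W : (Proj 𝒜).Opens) (hy : y ∈ W) :
    ∃ d > 0, ∃ g ∈ 𝒜 d, y ∈ Proj.basicOpen 𝒜 g ∧ Proj.basicOpen 𝒜 g ≤ W := by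
  obtain ⟨_, ⟨g, rfl⟩, hg, hgW⟩ := (TopologicalSpace.Opens.isBasis_iff_nbhd.1 (Proj.isBasis_basicOpen 𝒜)) hy
  rw [Proj.basicOpen_eq_iSup_proj] at hg hgW
  obtain ⟨i, hi⟩ := TopologicalSpace.Opens.mem_iSup.1 hg
  have hiW := (le_iSup (fun i => Proj.basicOpen 𝒜 (GradedRing.proj 𝒜 i g)) i).trans hgW
  have hm : GradedRing.proj 𝒜 i g ∈ 𝒜 i := SetLike.coe_mem _
  set a := GradedRing.proj 𝒜 i g
  obtain ⟨j, hj⟩ := (Proj.affineOpenCover 𝒜).openCover.exists_eq y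
  obtain ⟨z, hz⟩ := hj
  obtain ⟨n, b, hb, hn, hyb⟩ : ∃ n : ℕ, ∃ b ∈ 𝒜 n, 0 < n ∧ y ∈ Proj.basicOpen 𝒜 b := by
    refine ⟨j.1, j.2, SetLike.coe_mem _, j.1.2, ?_⟩
    rw [← Proj.opensRange_awayι 𝒜 (j.2 : A) (SetLike.coe_mem _) j.1.2]
    exact ⟨z, hz⟩
  refine ⟨i + n, by omega, a * b, SetLike.mul_mem_graded hm hb, ?_, ?_⟩
  · rw [Proj.basicOpen_mul]; exact ⟨hi, hyb⟩
  · rw [Proj.basicOpen_mul]; exact inf_le_left.trans hiW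

variable {K : Type} [Field K] (p : Y ⟶ Spec (CommRingCat.of K))

theorem alpha_local [IsImmersion f] [LocallyOfFiniteType p] (y : Y) :
    letI := ffAlg p
    ∃ d > 0, ∃ g ∈ 𝒜 d, f y ∈ Proj.basicOpen 𝒜 g ∧
      IsAffineOpen (f ⁻¹ᵁ Proj.basicOpen 𝒜 g) ∧
      ∃ h : genericPoint Y ∈ f ⁻¹ᵁ Proj.basicOpen 𝒜 g,
      ∃ n0, ∀ n ≥ n0, 0 < n → ∃ T : Set A, T.Finite ∧ (∀ a ∈ T, a ∈ 𝒜 (n * d)) ∧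
        secs (f ⁻¹ᵁ Proj.basicOpen 𝒜 g) h =
          Kc K ((fun a => qf 𝒜 f (n * d) a (g ^ n)) '' T) := by
  letI := ffAlg p
  obtain ⟨d, hd, g, hg, hy, hW⟩ := exists_basic 𝒜 (f y) f.coborderRange
    (subset_coborder ⟨y, rfl⟩)
  have h : genericPoint Y ∈ f ⁻¹ᵁ Proj.basicOpen 𝒜 g := gen_mem (y := y) hy
  have hA := (imm_affine 𝒜 f (Proj.isAffineOpen_basicOpen 𝒜 g hg hd) hW).1
  refine ⟨d, hd, g, hg, hy, hA, h, ?_⟩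
  obtain ⟨G, hGf, hG⟩ := fg_secs p hA h
  have hex : ∀ x ∈ G, ∃ n0, ∀ n ≥ n0, 0 < n → ∃ a ∈ 𝒜 (n * d),
      x = qf 𝒜 f (n * d) a (g ^ n) := by
    intro x hx
    have : x ∈ secs (f ⁻¹ᵁ Proj.basicOpen 𝒜 g) h := by rw [hG]; exact subset_Kc _ hx
    rw [chi_range 𝒜 f hg hd hW h] at this
    obtain ⟨z, rfl⟩ := this
    exact qf_pow 𝒜 f hg h z
  choose! n0 hn0 using hex
  obtain ⟨N, hN⟩ := (hGf.image n0).bddAbove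
  refine ⟨N, fun n hn hpos => ?_⟩
  have hex2 : ∀ x ∈ G, ∃ a ∈ 𝒜 (n * d), x = qf 𝒜 f (n * d) a (g ^ n) := fun x hx =>
    hn0 x hx n ((hN ⟨x, hx, rfl⟩).trans hn) hpos
  choose! a ha ha' using hex2
  refine ⟨a '' G, hGf.image _, ?_, ?_⟩
  · rintro _ ⟨x, hx, rfl⟩; exact ha x hx
  · rw [hG, Set.image_image]
    congr 1
    ext x
    constructor
    · intro hx; exact ⟨x, hx, (ha' x hx).symm⟩
    · rintro ⟨x, hx, rfl⟩
      change qf 𝒜 f (n * d) (a x) (g ^ n) ∈ G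
      rw [← ha' x hx]
      exact hx

theorem exists_common {ι : Type} (t : Finset ι) (d n : ι → ℕ) (hd : ∀ i ∈ t, 0 < d i) :
    ∃ M > 0, ∀ i ∈ t, ∃ m ≥ n i, 0 < m ∧ m * d i = M := by
  classical
  refine ⟨(∑ i ∈ t, n i + 1) * ∏ i ∈ t, d i, Nat.mul_pos (by omega) (Finset.prod_pos hd), ?_⟩
  intro i hi
  have h1 : 0 < ∏ j ∈ t.erase i, d j :=
    Finset.prod_pos fun j hj => hd j (Finset.mem_of_mem_erase hj)
  have h2 := Finset.single_le_sum (f := n) (fun j _ => Nat.zero_le _) hi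
  refine ⟨(∑ i ∈ t, n i + 1) * ∏ j ∈ t.erase i, d j, ?_, Nat.mul_pos (by omega) h1, ?_⟩
  · exact ((h2.trans (Nat.le_succ _))).trans (Nat.le_mul_of_pos_right _ h1)
  · rw [mul_assoc, Finset.prod_erase_mul _ _ hi]

theorem alpha_imm [IsImmersion f] [LocallyOfFiniteType p] [CompactSpace Y] :
    ∃ S J : Set Y.functionField, S.Finite ∧ GeoP p S J := by
  letI := ffAlg p
  choose d hd g hg hy hA hη n0 hn0 using alpha_local 𝒜 f p
  obtain ⟨t, -, ht⟩ := isCompact_univ.elim_nhds_subcover (X := Y)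
    (fun y => (f ⁻¹ᵁ Proj.basicOpen 𝒜 (g y) : Set Y)) (fun y _ =>
      (f ⁻¹ᵁ Proj.basicOpen 𝒜 (g y)).isOpen.mem_nhds (hy y))
  obtain ⟨M, hM, hm⟩ := exists_common t d n0 (fun i _ => hd i)
  choose! m hm1 hm2 hm3 using hm
  have hT : ∀ y ∈ t, ∃ T : Set A, T.Finite ∧ (∀ a ∈ T, a ∈ 𝒜 M) ∧
        secs (f ⁻¹ᵁ Proj.basicOpen 𝒜 (g y)) (hη y) =
          Kc K ((fun a => qf 𝒜 f M a (g y ^ m y)) '' T) := by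
    intro y hyt
    have := hn0 y (m y) (hm1 y hyt) (hm2 y hyt)
    rw [hm3 y hyt] at this
    exact this
  choose! T hTf hT hTe using hT
  have hgm : ∀ y ∈ t, g y ^ m y ∈ 𝒜 M := by
    intro y hyt
    rw [← hm3 y hyt]
    exact SetLike.pow_mem_graded (m y) (hg y)
  have hη' : ∀ y ∈ t, genericPoint Y ∈ f ⁻¹ᵁ Proj.basicOpen 𝒜 (g y ^ m y) := by
    intro y hyt
    rw [Proj.basicOpen_pow _ _ _ (hm2 y hyt)]
    exact hη y
  obtain ⟨y1, hy1, -⟩ : ∃ y1 ∈ t, True := by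
    have := ht (Set.mem_univ (genericPoint Y))
    simp only [Set.mem_iUnion] at this
    obtain ⟨z, hz, -⟩ := this
    exact ⟨z, hz, trivial⟩
  let b := g y1 ^ m y1
  let J : Set Y.functionField := (fun y => qf 𝒜 f M (g y ^ m y) b) '' t
  let S : Set Y.functionField := (⋃ y ∈ t, (fun a => qf 𝒜 f M a b) '' T y) ∪ J
  have hJ0 : ∀ y ∈ t, qf 𝒜 f M (g y ^ m y) b ≠ 0 := by
    intro y hyt h0
    have := qf_mul 𝒜 f (hgm y1 hy1) (hgm y hyt) (hgm y1 hy1) (hη' y hyt) (hη' y1 hy1)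
    rw [qf_self 𝒜 f (hgm y1 hy1) (hη' y1 hy1)] at this
    change qf 𝒜 f M b _ * qf 𝒜 f M (g y ^ m y) b = 1 at this
    rw [h0, mul_zero] at this
    exact zero_ne_one this
  have hdiv : ∀ y ∈ t, ∀ a ∈ 𝒜 M, qf 𝒜 f M a b / qf 𝒜 f M (g y ^ m y) b =
      qf 𝒜 f M a (g y ^ m y) := by
    intro y hyt a ha
    rw [div_eq_iff (hJ0 y hyt), qf_mul 𝒜 f ha (hgm y hyt) (hgm y1 hy1) (hη' y hyt) (hη' y1 hy1)]
  have hBE : ∀ y ∈ t, BE K S (qf 𝒜 f M (g y ^ m y) b) =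
      secs (f ⁻¹ᵁ Proj.basicOpen 𝒜 (g y)) (hη y) := by
    intro y hyt
    have hmem : ∀ a, qf 𝒜 f M a (g y ^ m y) ∈ secs (f ⁻¹ᵁ Proj.basicOpen 𝒜 (g y)) (hη y) := by
      intro a
      have := qf_mem 𝒜 f (M := M) a (g y ^ m y) (hη' y hyt)
      convert this using 2
      rw [Proj.basicOpen_pow _ _ _ (hm2 y hyt)]
    apply le_antisymm
    · refine BE_le (fun c => ffMap_mem p (hA y) (hη y) c) ?_
      rintro s (hs | ⟨z, hz, rfl⟩)
      · simp only [Set.mem_iUnion] at hs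
        obtain ⟨z, hz, a, ha, rfl⟩ := hs
        simp only
        rw [hdiv y hyt a (hT z hz a ha)]
        exact hmem a
      · simp only
        rw [hdiv y hyt _ (hgm z hz)]
        exact hmem _
    · rw [hTe y hyt]
      refine Kc_le (fun c => algebraMap_mem_BE _ _ c) ?_
      rintro _ ⟨a, ha, rfl⟩
      simp only
      rw [← hdiv y hyt a (hT y hyt a ha)]
      refine div_mem_BE _ (Or.inl ?_)
      simp only [Set.mem_iUnion]
      exact ⟨y, hyt, a, ha, rfl⟩
  refine ⟨S, J, ?_, ⟨Set.subset_union_right, ?_, ?_, ?_⟩⟩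
  · refine Set.Finite.union (t.finite_toSet.biUnion fun y hyt => (hTf y hyt).image _)
      (t.finite_toSet.image _)
  · rintro _ ⟨y, hyt, rfl⟩; exact hJ0 y hyt
  · rintro _ ⟨y, hyt, rfl⟩
    exact ⟨y, _, hA y, hy y, hη y, (hBE y hyt).symm⟩
  · intro y
    have := ht (Set.mem_univ y)
    simp only [Set.mem_iUnion] at this
    obtain ⟨z, hz, hyz⟩ := this
    exact ⟨_, ⟨z, hz, rfl⟩, _, hA z, hyz, hη z, (hBE z hz).symm⟩
end

section
attribute [local instance] MvPolynomial.gradedAlgebra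
variable {K : Type} [Field K] {Y : Scheme.{0}} [IsIntegral Y] (p : Y ⟶ Spec (CommRingCat.of K))

theorem alpha_qp (h : QuasiProjectiveOver K p) :
    ∃ S J : Set Y.functionField, S.Finite ∧ GeoP p S J := by
  have := QP.lft h
  have := QP.compact h
  obtain ⟨n, f, hf, -⟩ := h
  exact @alpha_imm _ _ _ _ _ (MvPolynomial.homogeneousSubmodule (Fin (n + 1)) K) _ Y _ f K _ p
    hf _ _
end
end WD
end

section
open AlgebraicGeometry CategoryTheory CategoryTheory.Limits
namespace WD
open Paper

section
open TensorProduct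

theorem isPushout_alg {k K R0 R : Type} [Field k] [Field K] [CommRing R0] [CommRing R]
    [Algebra k K] [Algebra k R0] [Algebra k R] [Algebra K R] [Algebra R0 R]
    [IsScalarTower k K R] [IsScalarTower k R0 R]
    (hind : ∀ {ι : Type} (v : ι → R0), LinearIndependent k v →
      LinearIndependent K (fun i => algebraMap R0 R (v i)))
    (hgen : ∀ x : R, x ∈ Subring.closure (Set.range (algebraMap K R) ∪ Set.range (algebraMap R0 R))) :
    Algebra.IsPushout k K R0 R := by
  let Φ : K ⊗[k] R0 →ₐ[K] R := Algebra.TensorProduct.lift (Algebra.ofId K R)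
    (IsScalarTower.toAlgHom k R0 R) (fun _ _ => Commute.all _ _)
  have hΦ : ∀ (c : K) (r : R0), Φ (c ⊗ₜ r) = c • algebraMap R0 R r := by
    intro c r
    simp [Φ, Algebra.smul_def, Algebra.ofId_apply]
  have hinj : Function.Injective Φ := by
    let b := Module.Basis.ofVectorSpace k R0
    let B : Module.Basis _ K (K ⊗[k] R0) := b.baseChange K
    have h1 := hind b b.linearIndependent
    have h2 : LinearIndependent K (fun i => Φ.toLinearMap (B i)) := by
      convert h1 using 2 with i
      simp [B, hΦ, Module.Basis.baseChange_apply]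
    have h3 : ∀ x, Φ.toLinearMap x = 0 → x = 0 := by
      intro x hx
      rw [← B.linearCombination_repr x, ← LinearMap.comp_apply,
        ← Finsupp.linearCombination_linear_comp] at hx
      have := linearIndependent_iff.1 h2 _ hx
      exact B.repr.map_eq_zero_iff.1 this
    exact (injective_iff_map_eq_zero Φ.toLinearMap).2 h3
  have hsurj : Function.Surjective Φ := by
    intro x
    have h1 : Subring.closure (Set.range (algebraMap K R) ∪ Set.range (algebraMap R0 R)) ≤
        Φ.toRingHom.range := by
      rw [Subring.closure_le]
      rintro _ (⟨c, rfl⟩ | ⟨r, rfl⟩)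
      · exact ⟨algebraMap K _ c, Φ.commutes c⟩
      · exact ⟨1 ⊗ₜ r, by change Φ _ = _; rw [hΦ, one_smul]⟩
    exact h1 (hgen x)
  constructor
  refine IsBaseChange.of_equiv (LinearEquiv.ofBijective Φ.toLinearMap ⟨hinj, hsurj⟩) ?_
  intro x
  change Φ (1 ⊗ₜ x) = _
  rw [hΦ, one_smul]
  rfl

theorem isPushout_ring {k K R0 R : Type} [Field k] [Field K] [CommRing R0] [CommRing R]
    (a : k →+* K) (b : k →+* R0) (c : K →+* R) (d : R0 →+* R) (hcomm : c.comp a = d.comp b)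
    (hind : ∀ {ι : Type} (v : ι → R0), (letI := b.toAlgebra; LinearIndependent k v) →
      (letI := c.toAlgebra; LinearIndependent K (fun i => d (v i))))
    (hgen : ∀ x : R, x ∈ Subring.closure (Set.range c ∪ Set.range d)) :
    IsPushout (CommRingCat.ofHom b) (CommRingCat.ofHom a)
      (CommRingCat.ofHom d) (CommRingCat.ofHom c) := by
  letI := a.toAlgebra
  letI := b.toAlgebra
  letI := c.toAlgebra
  letI := d.toAlgebra
  letI : Algebra k R := (c.comp a).toAlgebra
  haveI : IsScalarTower k K R := IsScalarTower.of_algebraMap_eq' rfl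
  haveI : IsScalarTower k R0 R := IsScalarTower.of_algebraMap_eq' hcomm
  haveI : Algebra.IsPushout k K R0 R := isPushout_alg hind hgen
  exact (CommRingCat.isPushout_of_isPushout k K R0 R).flip

end

section
theorem isPullback_local {Y X S' S : Scheme.{0}} (t : Y ⟶ X) (p : Y ⟶ S') (q : X ⟶ S) (s : S' ⟶ S)
    {ι : Type} (V : ι → X.Opens) (hV : ∀ i, IsAffineOpen (V i)) (hc : ⨆ i, V i = ⊤)
    (hU : ∀ i, IsAffineOpen (t ⁻¹ᵁ V i))
    (H : ∀ i, IsPullback (Spec.map (t.app (V i))) ((hU i).fromSpec ≫ p) ((hV i).fromSpec ≫ q) s) :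
    IsPullback t p q s := by
  let 𝒰 : X.OpenCover := X.openCoverOfIsOpenCover V (.mk hc)
  apply Scheme.isPullback_of_openCover t p q s 𝒰
  intro i
  have h1 : IsPullback (Spec.map (t.app (V i)) ≫ (hV i).isoSpec.inv) (hU i).fromSpec (V i).ι t := by
    apply IsOpenImmersion.isPullback
    · rw [Category.assoc]
      have := (hV i).SpecMap_appLE_fromSpec t (hU i) le_rfl
      rw [Scheme.Hom.appLE_eq_app] at this
      exact this.symm
    · rw [IsAffineOpen.opensRange_fromSpec, Scheme.Opens.opensRange_ι]
  refine (H i).of_iso h1.flip.isoPullback (hV i).isoSpec.symm (Iso.refl _) (Iso.refl _) ?_ ?_ ?_ ?_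
  · exact (h1.flip.isoPullback_hom_snd).symm
  · rw [Iso.refl_hom, Category.comp_id]
    exact (h1.flip.isoPullback_hom_fst_assoc p).symm
  · rw [Iso.refl_hom, Category.comp_id]
    rfl
  · simp
end
end WD
end

section
open AlgebraicGeometry CategoryTheory CategoryTheory.Limits
namespace WD
open Paper

section
variable {k K : Type} [Field k] [Field K] [Algebra k K]
variable {Y : Scheme.{0}} [IsIntegral Y] {p : Y ⟶ Spec (CommRingCat.of K)}

theorem gen_factor {X : Scheme.{0}} (t : Y ⟶ X) {V : X.Opens} (hV : IsAffineOpen V)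
    (hU : IsAffineOpen (t ⁻¹ᵁ V)) (h : genericPoint Y ∈ t ⁻¹ᵁ V) :
    Y.fromSpecStalk (genericPoint Y) ≫ t =
      Spec.map (t.app V ≫ Y.presheaf.germ _ _ h) ≫ hV.fromSpec := by
  have := hV.SpecMap_appLE_fromSpec t hU le_rfl
  rw [Scheme.Hom.appLE_eq_app] at this
  rw [Spec.map_comp, Category.assoc, this, ← hU.fromSpecStalk_eq_fromSpecStalk h,
    IsAffineOpen.fromSpecStalk, Category.assoc]

theorem inv_fixed (D : DescentDatum k K Y p) {X : Scheme.{0}} (t : Y ⟶ X)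
    (hinv : ∀ σ, (D.act σ).hom ≫ t = t) {V : X.Opens} (hV : IsAffineOpen V)
    (hU : IsAffineOpen (t ⁻¹ᵁ V)) (h : genericPoint Y ∈ t ⁻¹ᵁ V) (σ : K ≃ₐ[k] K) (s : Γ(X, V)) :
    rho D σ ((t.app V ≫ Y.presheaf.germ _ _ h).hom s) = (t.app V ≫ Y.presheaf.germ _ _ h).hom s := by
  have : (t.app V ≫ Y.presheaf.germ _ _ h) ≫ D.ffAction σ = t.app V ≫ Y.presheaf.germ _ _ h := by
    apply Spec.map_injective
    rw [← cancel_mono hV.fromSpec, ← gen_factor t hV hU h, Spec.map_comp, Category.assoc,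
      ← gen_factor t hV hU h, ← Category.assoc, ffAction_spec, Category.assoc, hinv]
  exact congrArg (fun φ => φ.hom s) this

theorem beta_local (D : DescentDatum k K Y p)
    (hfix : ∀ a : K, (∀ σ : K ≃ₐ[k] K, σ a = a) → a ∈ Set.range (algebraMap k K))
    {X : Scheme.{0}} (q : X ⟶ Spec (CommRingCat.of k)) (t : Y ⟶ X)
    (htq : t ≫ q = p ≫ Spec.map (CommRingCat.ofHom (algebraMap k K)))
    (hinv : ∀ σ, (D.act σ).hom ≫ t = t) {V : X.Opens} (hV : IsAffineOpen V)
    (hU : IsAffineOpen (t ⁻¹ᵁ V)) (h : genericPoint Y ∈ t ⁻¹ᵁ V)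
    (hinj : Function.Injective (t.app V))
    (hgen : secs (t ⁻¹ᵁ V) h ≤ Subring.closure (Set.range (ffMap p).hom ∪
      Set.range (t.app V ≫ Y.presheaf.germ _ _ h).hom)) :
    IsPullback (Spec.map (t.app V)) (hU.fromSpec ≫ p) (hV.fromSpec ≫ q)
      (Spec.map (CommRingCat.ofHom (algebraMap k K))) := by
  obtain ⟨b, hb⟩ := Spec.map_surjective (hV.fromSpec ≫ q)
  obtain ⟨c, hc⟩ := Spec.map_surjective (hU.fromSpec ≫ p)
  rw [← hb, ← hc]
  apply isPullback_SpecMap_of_isPushout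
  let G := Y.presheaf.germ (t ⁻¹ᵁ V) (genericPoint Y) h
  have hG : Function.Injective G := germ_injective_of_isIntegral Y _ h
  have hcG : ffMap p = c ≫ G := by
    rw [ffMap_eq p hU h, ← hc, Spec.preimage_map]
  have hcomm : CommRingCat.ofHom (algebraMap k K) ≫ c = b ≫ t.app V := by
    apply Spec.map_injective
    have := hV.SpecMap_appLE_fromSpec t hU le_rfl
    rw [Scheme.Hom.appLE_eq_app] at this
    rw [Spec.map_comp, Spec.map_comp, hb, hc, ← Category.assoc, this, Category.assoc, Category.assoc,
      htq]
  refine isPushout_ring (algebraMap k K) b.hom c.hom (t.app V).hom ?_ ?_ ?_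
  · exact congrArg CommRingCat.Hom.hom hcomm
  · intro ι v hv
    letI := ffAlg p
    letI : Algebra k Y.functionField := ((ffMap p).hom.comp (algebraMap k K)).toAlgebra
    haveI : IsScalarTower k K Y.functionField := IsScalarTower.of_algebraMap_eq' rfl
    have h1 : LinearIndependent k (fun i => G (t.app V (v i))) := by
      letI := b.hom.toAlgebra
      let L : Γ(X, V) →ₗ[k] Y.functionField :=
        { toFun := fun x => G (t.app V x)
          map_add' := fun x y => by simp
          map_smul' := fun a x => by
            rw [Algebra.smul_def, Algebra.smul_def, map_mul, map_mul]
            congr 1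
            change (b ≫ t.app V ≫ G) a = (ffMap p) (algebraMap k K a)
            rw [hcG, ← Category.assoc, ← hcomm]
            rfl }
      exact hv.map_injOn L (fun x _ y _ hxy => hinj (hG hxy))
    have h2 : LinearIndependent K (fun i => G (t.app V (v i))) := by
      refine linInd_of_fixed (rho D) (fun σ c => rho_const D σ c) ⊤ (N := k) ?_ _ ?_ h1
      · intro a ha
        exact hfix a fun σ => ha σ trivial
      · intro i σ _
        exact inv_fixed D t hinv hV hU h σ (v i)
    letI := c.hom.toAlgebra
    let L : Γ(Y, t ⁻¹ᵁ V) →ₗ[K] Y.functionField :=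
        { toFun := fun x => G x
          map_add' := fun x y => by simp
          map_smul' := fun a x => by
            rw [Algebra.smul_def, Algebra.smul_def, map_mul]
            congr 1
            change (c ≫ G) a = (ffMap p) a
            rw [hcG] }
    exact LinearIndependent.of_comp L h2
  · intro x
    have h1 := hgen (mem_secs.2 ⟨x, rfl⟩)
    have h2 : Set.range (ffMap p).hom ∪ Set.range (t.app V ≫ G).hom =
        G.hom '' (Set.range c.hom ∪ Set.range (t.app V).hom) := by
      rw [Set.image_union, ← Set.range_comp, ← Set.range_comp, hcG]
      rfl
    rw [h2, ← RingHom.map_closure] at h1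
    obtain ⟨y, hy, hyx⟩ := h1
    rwa [← hG hyx]

theorem app_germ_comp {X W : Scheme.{0}} (t : Y ⟶ X) (i : X ⟶ W) (g : Y ⟶ W) (e : t ≫ i = g)
    (V : W.Opens) (h : genericPoint Y ∈ g ⁻¹ᵁ V) (h' : genericPoint Y ∈ t ⁻¹ᵁ i ⁻¹ᵁ V) :
    i.app V ≫ t.app _ ≫ Y.presheaf.germ _ _ h' = g.app V ≫ Y.presheaf.germ _ _ h := by
  subst e
  simp

theorem beta2 (D : DescentDatum k K Y p)
    (hfix : ∀ a : K, (∀ σ : K ≃ₐ[k] K, σ a = a) → a ∈ Set.range (algebraMap k K))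
    {W : Scheme.{0}} (r : W ⟶ Spec (CommRingCat.of k)) (g : Y ⟶ W) [QuasiCompact g]
    (hgr : g ≫ r = p ≫ Spec.map (CommRingCat.ofHom (algebraMap k K)))
    (hinv : ∀ σ, (D.act σ).hom ≫ g = g) {ι : Type} (V : ι → W.Opens)
    (hV : ∀ i, IsAffineOpen (V i)) (hcov : ⨆ i, V i = ⊤)
    (hU : ∀ i, IsAffineOpen (g ⁻¹ᵁ V i)) (h : ∀ i, genericPoint Y ∈ g ⁻¹ᵁ V i)
    (hgen : ∀ i, secs (g ⁻¹ᵁ V i) (h i) ≤ Subring.closure (Set.range (ffMap p).hom ∪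
      Set.range (g.app (V i) ≫ Y.presheaf.germ _ _ (h i)).hom)) :
    IsPullback g.toImage p (g.imageι ≫ r) (Spec.map (CommRingCat.ofHom (algebraMap k K))) ∧
      ∀ σ, (D.act σ).hom ≫ g.toImage = g.toImage := by
  have hinv' : ∀ σ, (D.act σ).hom ≫ g.toImage = g.toImage := by
    intro σ
    rw [← cancel_mono g.imageι, Category.assoc, Scheme.Hom.toImage_imageι, hinv]
  refine ⟨?_, hinv'⟩
  have hV' : ∀ i, IsAffineOpen (g.imageι ⁻¹ᵁ V i) := fun i => (hV i).preimage g.imageι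
  have key : ∀ i, g.toImage ⁻¹ᵁ g.imageι ⁻¹ᵁ V i = g ⁻¹ᵁ V i := by
    intro i
    rw [← Scheme.Hom.comp_preimage, Scheme.Hom.toImage_imageι]
  refine isPullback_local _ _ _ _ (fun i => g.imageι ⁻¹ᵁ V i) hV' ?_ (fun i => ?_) (fun i => ?_)
  · rw [← Scheme.Hom.preimage_iSup, hcov]
    rfl
  · rw [key]; exact hU i
  · have h' : genericPoint Y ∈ g.toImage ⁻¹ᵁ g.imageι ⁻¹ᵁ V i := by rw [key]; exact h i
    refine beta_local D hfix (g.imageι ≫ r) g.toImage ?_ hinv' (hV' i) _ h' ?_ ?_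
    · rw [Scheme.Hom.toImage_imageι_assoc, hgr]
    · exact Scheme.Hom.toImage_app_injective g ⟨V i, hV i⟩
    · have e1 : secs _ h' = secs _ (h i) := by simp only [key]
      rw [e1]
      refine (hgen i).trans (Subring.closure_mono (Set.union_subset_union_right _ ?_))
      rintro _ ⟨s, rfl⟩
      refine ⟨g.imageι.app _ s, ?_⟩
      exact congrArg (fun φ => φ.hom s)
        (app_germ_comp g.toImage g.imageι g (Scheme.Hom.toImage_imageι g) (V i) (h i) h')
end
end WD
end

section
open AlgebraicGeometry CategoryTheory CategoryTheory.Limits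
namespace WD
open Paper

section
variable {A σ F : Type} [CommRing A] [SetLike σ A] [AddSubgroupClass σ A] (𝒜 : ℕ → σ) [GradedRing 𝒜]
  [Field F] (ev : A →+* F)

/-- Evaluation of homogeneous fractions. -/
def psi (P : A) (h : ev P ≠ 0) : HomogeneousLocalization.Away 𝒜 P →+* F :=
  (Localization.awayLift ev P
    (isUnit_iff_exists_inv.mpr ⟨(ev P)⁻¹, mul_inv_cancel₀ h⟩)).comp
    (algebraMap (HomogeneousLocalization.Away 𝒜 P) (Localization.Away P))

theorem psi_mk {P : A} (h : ev P ≠ 0) {d : ℕ} (hP : P ∈ 𝒜 d) (n : ℕ) (a : A) (ha : a ∈ 𝒜 (n • d)) :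
    psi 𝒜 ev P h (HomogeneousLocalization.Away.mk 𝒜 hP n a ha) = ev a / ev P ^ n := by
  rw [psi, RingHom.comp_apply, HomogeneousLocalization.algebraMap_apply,
    HomogeneousLocalization.Away.val_mk, Localization.awayLift_mk, div_eq_mul_inv, inv_pow]
  exact mul_inv_cancel₀ h

theorem psi_awayMap {P Q R : A} {d e : ℕ} (hP : P ∈ 𝒜 d) (hQ : Q ∈ 𝒜 e) (hR : R = P * Q)
    (h : ev P ≠ 0) (h' : ev R ≠ 0) :
    (psi 𝒜 ev R h').comp (HomogeneousLocalization.awayMap 𝒜 hQ hR) = psi 𝒜 ev P h := by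
  ext z
  obtain ⟨n, a, ha, rfl⟩ := HomogeneousLocalization.Away.mk_surjective 𝒜 hP z
  rw [RingHom.comp_apply, HomogeneousLocalization.awayMap_mk, psi_mk, psi_mk]
  subst hR
  have : ev Q ≠ 0 := fun h0 => h' (by rw [map_mul, h0, mul_zero])
  simp only [map_mul, map_pow]
  field_simp
  ring

/-- The point of `Proj` given by an evaluation. -/
def gam (P : A) (h : ev P ≠ 0) {d : ℕ} (hP : P ∈ 𝒜 d) (hd : 0 < d) :
    Spec (CommRingCat.of F) ⟶ Proj 𝒜 :=
  Spec.map (CommRingCat.ofHom (psi 𝒜 ev P h)) ≫ Proj.awayι 𝒜 P hP hd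

theorem gam_mul {P Q R : A} {d e : ℕ} (hP : P ∈ 𝒜 d) (hQ : Q ∈ 𝒜 e) (hd : 0 < d) (hR : R = P * Q)
    (h : ev P ≠ 0) (h' : ev R ≠ 0) (hR' : R ∈ 𝒜 (d + e)) (hd' : 0 < d + e) :
    gam 𝒜 ev R h' hR' hd' = gam 𝒜 ev P h hP hd := by
  have h1 := Proj.SpecMap_awayMap_awayι 𝒜 hP hd hQ hR
  rw [gam, gam, ← h1, ← Category.assoc, ← Spec.map_comp, ← CommRingCat.ofHom_comp,
    psi_awayMap 𝒜 ev hP hQ hR h h']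

theorem gam_eq {P Q : A} {d e : ℕ} (hP : P ∈ 𝒜 d) (hQ : Q ∈ 𝒜 e) (hd : 0 < d) (he : 0 < e)
    (h : ev P ≠ 0) (h' : ev Q ≠ 0) :
    gam 𝒜 ev P h hP hd = gam 𝒜 ev Q h' hQ he := by
  have h1 : ev (P * Q) ≠ 0 := by rw [map_mul]; exact mul_ne_zero h h'
  have h2 : P * Q ∈ 𝒜 (d + e) := SetLike.mul_mem_graded hP hQ
  have h3 : Q * P ∈ 𝒜 (e + d) := SetLike.mul_mem_graded hQ hP
  rw [← gam_mul 𝒜 ev hP hQ hd rfl h h1 h2 (by omega)]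
  have h4 := gam_mul 𝒜 ev hQ hP he (mul_comm P Q) h' h1 (by rwa [add_comm]) (by omega)
  rw [← h4]
  simp only [add_comm]

end

section
open MvPolynomial
attribute [local instance] MvPolynomial.gradedAlgebra

theorem aeval_div {k F : Type} [Field k] [Field F] [Algebra k F] {N : ℕ} (y : Fin (N + 1) → F)
    (c : F) {n : ℕ} {a : MvPolynomial (Fin (N + 1)) k}
    (ha : a ∈ homogeneousSubmodule (Fin (N + 1)) k n) :
    aeval y a / c ^ n = aeval (fun i => y i / c) a := by
  rw [mem_homogeneousSubmodule] at ha
  rw [aeval_def, aeval_def, eval₂_eq', eval₂_eq', Finset.sum_div]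
  refine Finset.sum_congr rfl fun m hm => ?_
  have h1 := ha (mem_support_iff.1 hm)
  rw [mul_div_assoc]
  congr 1
  rw [← h1, Finsupp.weight_apply, Finsupp.sum_fintype _ _ (by simp), ← Finset.prod_pow_eq_pow_sum,
    ← Finset.prod_div_distrib]
  refine Finset.prod_congr rfl fun i _ => ?_
  simp [div_pow]

theorem psi_mem {k F : Type} [Field k] [Field F] [Algebra k F] {N : ℕ} (y : Fin (N + 1) → F)
    (j : Fin (N + 1)) (hj : (aeval y : _ →ₐ[k] F).toRingHom (X j) ≠ 0) (B : Subring F)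
    (hB : ∀ c : k, algebraMap k F c ∈ B) (hB' : ∀ i, y i / y j ∈ B) (z) :
    psi (homogeneousSubmodule (Fin (N + 1)) k) (aeval y : _ →ₐ[k] F).toRingHom (X j) hj z ∈ B := by
  have hX : (X j : MvPolynomial (Fin (N + 1)) k) ∈ homogeneousSubmodule (Fin (N + 1)) k 1 :=
    (mem_homogeneousSubmodule 1 _).2 (isHomogeneous_X k j)
  obtain ⟨n, a, ha, rfl⟩ := HomogeneousLocalization.Away.mk_surjective _ hX z
  rw [psi_mk]
  have e : (aeval y : _ →ₐ[k] F).toRingHom (X j) = y j := by simp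
  rw [e]
  have h1 := aeval_div y (y j) (n := n) (a := a) (by simpa using ha)
  change aeval y a / _ ∈ B
  rw [h1, aeval_def, eval₂_eq']
  exact B.sum_mem fun m _ => B.mul_mem (hB _) (B.prod_mem fun i _ => B.pow_mem (hB' i) _)

end

section
variable {Y : Scheme.{0}} [IsIntegral Y]

theorem dominant_gen {T : Scheme.{0}} (j : T ⟶ Y) [IsOpenImmersion j]
    (m : Spec Y.functionField ⟶ T) (hm : m ≫ j = Y.fromSpecStalk (genericPoint Y)) :
    IsDominant m := by
  constructor
  rw [DenseRange, dense_iff_inter_open]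
  intro O hO hne
  let O' : T.Opens := ⟨O, hO⟩
  obtain ⟨x, hx⟩ := hne
  have h1 : genericPoint Y ∈ j ''ᵁ O' := gen_mem (y := j x) ⟨x, hx, rfl⟩
  obtain ⟨z, hz, hz'⟩ := h1
  refine ⟨z, hz, IsLocalRing.closedPoint _, ?_⟩
  apply j.isOpenEmbedding.injective
  refine Eq.trans ?_ hz'.symm
  have h2 : (m ≫ j) (IsLocalRing.closedPoint Y.functionField : PrimeSpectrum _) = genericPoint Y := by
    rw [hm]
    exact Scheme.fromSpecStalk_closedPoint
  exact h2

theorem gen_ext {Z : Scheme.{0}} [Z.IsSeparated] {a b : Y ⟶ Z}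
    (h : Y.fromSpecStalk (genericPoint Y) ≫ a = Y.fromSpecStalk (genericPoint Y) ≫ b) : a = b := by
  have := dominant_gen (𝟙 Y) (Y.fromSpecStalk (genericPoint Y)) (Category.comp_id _)
  exact ext_of_isDominant _ h

theorem glue_gen {Z : Scheme.{0}} [Z.IsSeparated] {ι : Type} (U : ι → Y.Opens)
    (hU : ∀ i, IsAffineOpen (U i)) (hc : ⨆ i, U i = ⊤) (h : ∀ i, genericPoint Y ∈ U i)
    (f : ∀ i, Spec Γ(Y, U i) ⟶ Z) (γ : Spec Y.functionField ⟶ Z)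
    (hf : ∀ i, Spec.map (Y.presheaf.germ _ _ (h i)) ≫ f i = γ) :
    ∃ g : Y ⟶ Z, (∀ i, (hU i).fromSpec ≫ g = f i) := by
  have key : ∀ i, ∃ m : Spec Y.functionField ⟶ (U i).toScheme,
      m ≫ (U i).ι = Y.fromSpecStalk (genericPoint Y) ∧ m ≫ (hU i).isoSpec.hom ≫ f i = γ := by
    intro i
    refine ⟨Spec.map (Y.presheaf.germ _ _ (h i)) ≫ (hU i).isoSpec.inv, ?_, ?_⟩
    · rw [Category.assoc, ← (hU i).fromSpecStalk_eq_fromSpecStalk (h i), IsAffineOpen.fromSpecStalk]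
      rfl
    · rw [Category.assoc, Iso.inv_hom_id_assoc, hf]
  choose m hm1 hm2 using key
  have agree : ∀ i j, pullback.fst (U i).ι (U j).ι ≫ (hU i).isoSpec.hom ≫ f i =
      pullback.snd (U i).ι (U j).ι ≫ (hU j).isoSpec.hom ≫ f j := by
    intro i j
    let l := pullback.lift (f := (U i).ι) (g := (U j).ι) (m i) (m j) ((hm1 i).trans (hm1 j).symm)
    have hl : IsDominant l := by
      apply dominant_gen (pullback.fst (U i).ι (U j).ι ≫ (U i).ι)
      rw [pullback.lift_fst_assoc, hm1]
    have : IsReduced (pullback (U i).ι (U j).ι) :=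
      isReduced_of_isOpenImmersion (pullback.fst (U i).ι (U j).ι ≫ (U i).ι)
    refine ext_of_isDominant l ?_
    rw [pullback.lift_fst_assoc, pullback.lift_snd_assoc, hm2, hm2]
  let 𝒰 : Y.OpenCover := Y.openCoverOfIsOpenCover U (.mk hc)
  refine ⟨𝒰.glueMorphisms (fun i => (hU i).isoSpec.hom ≫ f i) agree, ?_⟩
  intro i
  have h1 : (U i).ι ≫ 𝒰.glueMorphisms (fun i => (hU i).isoSpec.hom ≫ f i) agree =
    (hU i).isoSpec.hom ≫ f i := 𝒰.ι_glueMorphisms (fun i => (hU i).isoSpec.hom ≫ f i) agree i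
  rw [← cancel_epi (hU i).isoSpec.hom, ← h1, ← Category.assoc]
  congr 1
  exact (hU i).isoSpec_hom_fromSpec

theorem range_le {Z : Scheme.{0}} {R : CommRingCat.{0}} (a : Spec R ⟶ Z) [IsOpenImmersion a]
    (V : Z.Opens) (hV : IsAffineOpen V) (hVa : V ≤ a.opensRange) (g : Y ⟶ Z)
    (hU : IsAffineOpen (g ⁻¹ᵁ V)) (h : genericPoint Y ∈ g ⁻¹ᵁ V) (φ : R ⟶ Y.functionField)
    (hφ : Y.fromSpecStalk (genericPoint Y) ≫ g = Spec.map φ ≫ a) :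
    Set.range φ.hom ⊆ Set.range (g.app V ≫ Y.presheaf.germ _ _ h).hom := by
  let l := IsOpenImmersion.lift a hV.fromSpec (by rw [hV.range_fromSpec]; exact hVa)
  have hl : l ≫ a = hV.fromSpec := IsOpenImmersion.lift_fac _ _ _
  obtain ⟨ψ, hψ⟩ := Spec.map_surjective l
  have h1 : φ = ψ ≫ g.app V ≫ Y.presheaf.germ _ _ h := by
    apply Spec.map_injective
    rw [← cancel_mono a, Spec.map_comp, Category.assoc, hψ, hl, ← gen_factor g hV hU h, hφ]
  rintro _ ⟨x, rfl⟩
  rw [h1]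
  exact ⟨ψ x, rfl⟩

end
end WD
end

section
open AlgebraicGeometry CategoryTheory CategoryTheory.Limits
namespace WD
open Paper

section
variable {A σ F : Type} [CommRing A] [SetLike σ A] [AddSubgroupClass σ A] (𝒜 : ℕ → σ) [GradedRing 𝒜]
  [Field F] (ev : A →+* F)

theorem psi_zero (P : A) (h : ev P ≠ 0) (a : 𝒜 0) :
    psi 𝒜 ev P h (HomogeneousLocalization.fromZeroRingHom 𝒜 _ a) = ev a := by
  rw [psi, RingHom.comp_apply, HomogeneousLocalization.algebraMap_apply]
  have h1 := Localization.awayLift_mk ev P (a : A) (ev P)⁻¹ (mul_inv_cancel₀ h) 0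
  have h2 : ev (a : A) * (ev P)⁻¹ ^ 0 = ev a := by rw [pow_zero, mul_one]
  rw [← h2, ← h1]
  congr 1
  rw [HomogeneousLocalization.fromZeroRingHom]
  change HomogeneousLocalization.val (HomogeneousLocalization.mk _) = _
  rw [HomogeneousLocalization.val_mk]
  congr 1
  apply Subtype.ext
  simp

end

section
open MvPolynomial
attribute [local instance] MvPolynomial.gradedAlgebra

theorem psi_mem' {k F : Type} [Field k] [Field F] (φ : k →+* F) {N : ℕ} (y : Fin (N + 1) → F)
    (j : Fin (N + 1)) (hj : eval₂Hom φ y (X j) ≠ 0) (B : Subring F)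
    (hB : ∀ c : k, φ c ∈ B) (hB' : ∀ i, y i / y j ∈ B) (z) :
    psi (homogeneousSubmodule (Fin (N + 1)) k) (eval₂Hom φ y) (X j) hj z ∈ B := by
  letI := φ.toAlgebra
  exact psi_mem y j hj B hB hB' z

theorem X_mem {k : Type} [Field k] {N : ℕ} (j : Fin (N + 1)) :
    (X j : MvPolynomial (Fin (N + 1)) k) ∈ homogeneousSubmodule (Fin (N + 1)) k 1 :=
  (mem_homogeneousSubmodule 1 _).2 (isHomogeneous_X k j)

variable {k K : Type} [Field k] [Field K] [Algebra k K]
variable {Y : Scheme.{0}} [IsIntegral Y] {p : Y ⟶ Spec (CommRingCat.of K)}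

/-- Constants of `k` in the function field. -/
def kff (k : Type) [Field k] [Algebra k K] (p : Y ⟶ Spec (CommRingCat.of K)) : k →+* Y.functionField :=
  (ffMap p).hom.comp (algebraMap k K)

theorem rho_ev (D : DescentDatum k K Y p) {N : ℕ} {y : Fin (N + 1) → Y.functionField}
    (hy : ∀ σ i, rho D σ (y i) = y i) (σ : K ≃ₐ[k] K) (a : MvPolynomial (Fin (N + 1)) k) :
    rho D σ (eval₂Hom (kff k p) y a) = eval₂Hom (kff k p) y a := by
  have : ((rho D σ : Y.functionField →+* Y.functionField).comp (eval₂Hom (kff k p) y)) =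
      eval₂Hom (kff k p) y := by
    apply MvPolynomial.ringHom_ext
    · intro c
      rw [RingHom.comp_apply, eval₂Hom_C]
      refine (rho_const D σ (algebraMap k K c)).trans ?_
      rw [σ.commutes]
      rfl
    · intro i
      rw [RingHom.comp_apply, eval₂Hom_X']
      exact hy σ i
  exact congrArg (fun φ => φ a) this

theorem gam_inv (D : DescentDatum k K Y p) {N : ℕ} {y : Fin (N + 1) → Y.functionField}
    (hy : ∀ σ i, rho D σ (y i) = y i) (σ : K ≃ₐ[k] K) (j : Fin (N + 1))
    (hj : eval₂Hom (kff k p) y (X j) ≠ 0) :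
    Spec.map (D.ffAction σ) ≫
      gam (homogeneousSubmodule (Fin (N + 1)) k) (eval₂Hom (kff k p) y) (X j) hj (X_mem j) one_pos =
      gam (homogeneousSubmodule (Fin (N + 1)) k) (eval₂Hom (kff k p) y) (X j) hj (X_mem j) one_pos := by
  rw [gam]
  have h1 : CommRingCat.ofHom (psi (homogeneousSubmodule (Fin (N + 1)) k) (eval₂Hom (kff k p) y) (X j) hj)
      ≫ D.ffAction σ =
      CommRingCat.ofHom (psi (homogeneousSubmodule (Fin (N + 1)) k) (eval₂Hom (kff k p) y) (X j) hj) := by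
    ext z
    change rho D σ _ = _
    obtain ⟨n, a, ha, rfl⟩ := HomogeneousLocalization.Away.mk_surjective _ (X_mem j) z
    change rho D σ (psi _ _ _ hj _) = psi _ _ _ hj _
    rw [psi_mk, map_div₀, map_pow, rho_ev D hy, rho_ev D hy]
  rw [← Category.assoc]
  congr 1
  refine (Spec.map_comp _ _).symm.trans ?_
  rw [h1]

/-- The structure morphism of projective space. -/
def sM (k : Type) [Field k] (N : ℕ) : Proj (homogeneousSubmodule (Fin (N + 1)) k) ⟶
    Spec (CommRingCat.of k) :=
  Proj.toSpecZero _ ≫ Spec.map (CommRingCat.ofHom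
    (algebraMap k (homogeneousSubmodule (Fin (N + 1)) k 0)))

theorem gam_struct {N : ℕ} {y : Fin (N + 1) → Y.functionField} (j : Fin (N + 1))
    (hj : eval₂Hom (kff k p) y (X j) ≠ 0) :
      gam (homogeneousSubmodule (Fin (N + 1)) k) (eval₂Hom (kff k p) y) (X j) hj (X_mem j) one_pos ≫
        sM k N = Spec.map (CommRingCat.ofHom (kff k p)) := by
  rw [gam, sM, Category.assoc]
  rw [Proj.awayι_toSpecZero_assoc]
  rw [← Spec.map_comp, ← Spec.map_comp]
  congr 1
  ext c
  change psi _ _ _ hj (HomogeneousLocalization.fromZeroRingHom _ _ _) = kff k p c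
  rw [psi_zero]
  exact eval₂Hom_C _ _ _

theorem beta1 [Y.IsSeparated] (D : DescentDatum k K Y p) {N : ℕ} (y : Fin (N + 1) → Y.functionField)
    (hy : ∀ σ i, rho D σ (y i) = y i) {ι : Type} [Nonempty ι] (j : ι → Fin (N + 1))
    (hj : ∀ i, y (j i) ≠ 0) (U : ι → Y.Opens)
    (hU : ∀ i, IsAffineOpen (U i)) (hc : ⨆ i, U i = ⊤) (h : ∀ i, genericPoint Y ∈ U i)
    (hs : ∀ i, letI := ffAlg p; secs (U i) (h i) = BE K (Set.range y) (y (j i))) :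
    ∃ g : Y ⟶ Proj (homogeneousSubmodule (Fin (N + 1)) k),
      g ≫ sM k N = p ≫ Spec.map (CommRingCat.ofHom (algebraMap k K)) ∧
      (∀ σ, (D.act σ).hom ≫ g = g) ∧
      (∀ i l, ∃ s : Γ(Y, U i), Y.presheaf.germ _ _ (h i) s = y l / y (j i) ∧
        U i ⊓ g ⁻¹ᵁ Proj.basicOpen _ (X l) = Y.basicOpen s) ∧
      (∀ i, g ⁻¹ᵁ Proj.basicOpen _ (X (j i)) = U i) ∧
      (∀ i, ∀ (h' : genericPoint Y ∈ g ⁻¹ᵁ Proj.basicOpen _ (X (j i))), ∀ l,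
        y l / y (j i) ∈ Set.range (g.app (Proj.basicOpen _ (X (j i))) ≫
          Y.presheaf.germ _ _ h').hom) := by
  letI := ffAlg p
  let 𝒜 := homogeneousSubmodule (Fin (N + 1)) k
  let ev := eval₂Hom (kff k p) y
  have evX : ∀ l, ev (X l) = y l := fun l => eval₂Hom_X' _ _ _
  have hj' : ∀ i, ev (X (j i)) ≠ 0 := fun i => by rw [evX]; exact hj i
  have hm : ∀ i z, psi 𝒜 ev (X (j i)) (hj' i) z ∈ secs (U i) (h i) := by
    intro i z
    rw [hs]
    apply psi_mem'
    · intro c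
      exact algebraMap_mem_BE _ _ (algebraMap k K c)
    · intro l
      exact div_mem_BE _ ⟨l, rfl⟩
  let φ : ∀ i, HomogeneousLocalization.Away 𝒜 (X (j i)) →+* Γ(Y, U i) := fun i =>
    ((secsEquiv (U i) (h i)).symm : secs (U i) (h i) →+* Γ(Y, U i)).comp
      ((psi 𝒜 ev (X (j i)) (hj' i)).codRestrict _ (hm i))
  have hφ : ∀ i z, Y.presheaf.germ _ _ (h i) (φ i z) = psi 𝒜 ev (X (j i)) (hj' i) z := by
    intro i z
    exact congrArg Subtype.val ((secsEquiv (U i) (h i)).apply_symm_apply _)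
  let f : ∀ i, Spec Γ(Y, U i) ⟶ Proj 𝒜 := fun i =>
    Spec.map (CommRingCat.ofHom (φ i)) ≫ Proj.awayι 𝒜 (X (j i)) (X_mem _) one_pos
  let i0 : ι := Classical.arbitrary ι
  let γ := gam 𝒜 ev (X (j i0)) (hj' i0) (X_mem _) one_pos
  have hγ : ∀ i, γ = gam 𝒜 ev (X (j i)) (hj' i) (X_mem _) one_pos := fun i =>
    gam_eq 𝒜 ev _ _ _ _ _ _
  have hf : ∀ i, Spec.map (Y.presheaf.germ _ _ (h i)) ≫ f i = γ := by
    intro i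
    rw [hγ i, gam, ← Category.assoc]
    congr 1
    refine (Spec.map_comp _ _).symm.trans ?_
    congr 1
    ext z
    exact hφ i z
  obtain ⟨g, hg⟩ := glue_gen U hU hc h f γ hf
  have hgen : Y.fromSpecStalk (genericPoint Y) ≫ g = γ := by
    rw [← (hU i0).fromSpecStalk_eq_fromSpecStalk (h i0), IsAffineOpen.fromSpecStalk, Category.assoc,
      hg, hf]
  have hb : ∀ i l, ∃ s : Γ(Y, U i), Y.presheaf.germ _ _ (h i) s = y l / y (j i) ∧
        U i ⊓ g ⁻¹ᵁ Proj.basicOpen 𝒜 (X l) = Y.basicOpen s := by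
    intro i l
    let el := HomogeneousLocalization.Away.isLocalizationElem (𝒜 := 𝒜) (X_mem (j i)) (X_mem l)
    refine ⟨φ i el, ?_, ?_⟩
    · rw [hφ, psi_mk, pow_one, evX, pow_one, evX]
    · have h1 : f i ⁻¹ᵁ Proj.basicOpen 𝒜 (X l) = PrimeSpectrum.basicOpen (φ i el) := by
        simp only [f]
        rw [Scheme.Hom.comp_preimage, Proj.awayι_preimage_basicOpen 𝒜 (X_mem (j i)) one_pos (X_mem l) one_pos]
        rfl
      rw [← hg, Scheme.Hom.comp_preimage] at h1
      have h2 := (hU i).fromSpec.image_preimage_eq_opensRange_inf (g ⁻¹ᵁ Proj.basicOpen 𝒜 (X l))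
      rw [h1, (hU i).opensRange_fromSpec, (hU i).fromSpec_image_basicOpen] at h2
      exact h2.symm
  have hpre : ∀ i, g ⁻¹ᵁ Proj.basicOpen _ (X (j i)) = U i := by
    intro i
    apply le_antisymm
    · intro x hx
      have hx' : x ∈ ⨆ i, U i := by rw [hc]; trivial
      obtain ⟨l, hl⟩ := TopologicalSpace.Opens.mem_iSup.1 hx'
      obtain ⟨s, hs1, hs2⟩ := hb l (j i)
      have hne : Y.presheaf.germ _ _ (h l) s ≠ 0 := by
        rw [hs1]; exact div_ne_zero (hj i) (hj l)
      have h3 : Y.basicOpen s ≤ U i := by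
        refine le_of_secs_le (h := h i) (h' := gen_mem_basicOpen hne) (hU i)
          ((hU l).basicOpen s) ?_
        rw [secs_basicOpen (hU l) (h l) s hne, hs1, hs, hs,
          loc_BE (Set.range y) ⟨j i, rfl⟩ ⟨j l, rfl⟩ (hj i) (hj l)]
        exact le_loc _ _
      apply h3
      rw [← hs2]
      exact ⟨hl, hx⟩
    · obtain ⟨s, hs1, hs2⟩ := hb i (j i)
      have : s = 1 := by
        apply germ_injective_of_isIntegral Y _ (h i)
        rw [hs1, div_self (hj i), map_one]
      rw [this, Y.basicOpen_of_isUnit isUnit_one] at hs2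
      rw [← hs2]
      exact inf_le_right
  refine ⟨g, ?_, ?_, hb, hpre, ?_⟩
  · have : (Spec (CommRingCat.of k)).IsSeparated := inferInstance
    apply gen_ext
    rw [← Category.assoc, hgen, ← Category.assoc, ← ffMap_spec, ← Spec.map_comp]
    exact gam_struct _ _
  · intro σ
    have : (Proj 𝒜).IsSeparated := inferInstance
    apply gen_ext
    have h1 := ffAction_spec D σ⁻¹
    rw [inv_inv] at h1
    rw [← Category.assoc, ← h1, Category.assoc, hgen]
    exact gam_inv D hy _ _ _
  · intro i h' l
    have hUi : IsAffineOpen (g ⁻¹ᵁ Proj.basicOpen 𝒜 (X (j i))) := by rw [hpre]; exact hU i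
    have h1 := range_le (Proj.awayι 𝒜 (X (j i)) (X_mem _) one_pos) (Proj.basicOpen 𝒜 (X (j i)))
      (Proj.isAffineOpen_basicOpen 𝒜 _ (X_mem _) one_pos) (Proj.opensRange_awayι _ _ _ _).ge g
      hUi h' (CommRingCat.ofHom (psi 𝒜 ev (X (j i)) (hj' i))) (hgen.trans (hγ i))
    apply h1
    refine ⟨HomogeneousLocalization.Away.isLocalizationElem (𝒜 := 𝒜) (X_mem (j i)) (X_mem l), ?_⟩
    change psi _ _ _ (hj' i) _ = _
    rw [psi_mk, pow_one, evX, pow_one, evX]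

end
end WD
end

section
open AlgebraicGeometry CategoryTheory CategoryTheory.Limits
namespace WD
open Paper

section
variable {k K : Type} [Field k] [Field K] [Algebra k K]
variable {Y : Scheme.{0}} [IsIntegral Y] {p : Y ⟶ Spec (CommRingCat.of K)}

theorem spec_surj : Surjective (Spec.map (CommRingCat.ofHom (algebraMap k K))) := by
  constructor
  intro x
  have : Subsingleton (Spec (CommRingCat.of k)) :=
    inferInstanceAs (Subsingleton (PrimeSpectrum k))
  have : Nonempty (Spec (CommRingCat.of K)) :=
    inferInstanceAs (Nonempty (PrimeSpectrum K))
  exact ⟨Classical.arbitrary _, Subsingleton.elim _ _⟩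

theorem core_geo (D : DescentDatum k K Y p)
    (hfix : ∀ a : K, (∀ σ : K ≃ₐ[k] K, σ a = a) → a ∈ Set.range (algebraMap k K))
    [CompactSpace Y] {P : Scheme.{0}} [P.IsSeparated] (r : P ⟶ Spec (CommRingCat.of k)) (g : Y ⟶ P)
    (hgr : g ≫ r = p ≫ Spec.map (CommRingCat.ofHom (algebraMap k K)))
    (hinv : ∀ σ, (D.act σ).hom ≫ g = g) {ι : Type} (B : ι → P.Opens)
    (hB : ∀ i, IsAffineOpen (B i)) (hcov : ⨆ i, g ⁻¹ᵁ B i = ⊤)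
    (hU : ∀ i, IsAffineOpen (g ⁻¹ᵁ B i)) (h : ∀ i, genericPoint Y ∈ g ⁻¹ᵁ B i)
    (hgen : ∀ i, secs (g ⁻¹ᵁ B i) (h i) ≤ Subring.closure (Set.range (ffMap p).hom ∪
      Set.range (g.app (B i) ≫ Y.presheaf.germ _ _ (h i)).hom)) :
    ∃ (X : Scheme.{0}) (i : X ⟶ P) (t : Y ⟶ X), t ≫ i = g ∧ IsImmersion i ∧
      IsPullback t p (i ≫ r) (Spec.map (CommRingCat.ofHom (algebraMap k K))) ∧
      (∀ σ, (D.act σ).hom ≫ t = t) ∧ Surjective t ∧ ∀ l, IsAffineOpen (i ⁻¹ᵁ B l) := by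
  let W : P.Opens := ⨆ i, B i
  have hW : Set.range g ⊆ Set.range W.ι := by
    rw [Scheme.Opens.range_ι]
    rintro _ ⟨x, rfl⟩
    have hx : x ∈ ⨆ i, g ⁻¹ᵁ B i := by rw [hcov]; trivial
    rw [← Scheme.Hom.preimage_iSup] at hx
    exact hx
  let g' : Y ⟶ W := IsOpenImmersion.lift W.ι g hW
  have hg' : g' ≫ W.ι = g := IsOpenImmersion.lift_fac _ _ _
  have hsepW : (W : Scheme).IsSeparated := by
    constructor
    rw [(terminal.comp_from W.ι).symm]
    infer_instance
  have hqc : QuasiCompact g' := quasiCompact_of_compactSpace g'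
  let V : ι → (W : Scheme).Opens := fun i => W.ι ⁻¹ᵁ B i
  have hV : ∀ i, IsAffineOpen (V i) := fun i => (hB i).preimage_of_isOpenImmersion W.ι (by
    rw [Scheme.Opens.opensRange_ι]; exact le_iSup B i)
  have hVc : ⨆ i, V i = ⊤ := by
    change ⨆ i, W.ι ⁻¹ᵁ B i = ⊤
    rw [← Scheme.Hom.preimage_iSup]
    exact Scheme.Opens.ι_preimage_self W
  have hpre : ∀ i, g' ⁻¹ᵁ V i = g ⁻¹ᵁ B i := by
    intro i
    change g' ⁻¹ᵁ W.ι ⁻¹ᵁ B i = _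
    rw [← Scheme.Hom.comp_preimage, hg']
  have hinv' : ∀ σ, (D.act σ).hom ≫ g' = g' := by
    intro σ
    rw [← cancel_mono W.ι, Category.assoc, hg', hinv]
  have h' : ∀ i, genericPoint Y ∈ g' ⁻¹ᵁ V i := fun i => by rw [hpre]; exact h i
  have hsec : ∀ (U U' : Y.Opens) (e : U = U') (a : genericPoint Y ∈ U) (b), secs U a = secs U' b := by
    rintro U _ rfl a b; rfl
  obtain ⟨hp, hi⟩ := beta2 D hfix (W.ι ≫ r) g' (by rw [← Category.assoc, hg', hgr]) hinv' V hV hVc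
    (fun i => by rw [hpre]; exact hU i) h' (by
      intro i
      rw [hsec _ _ (hpre i) (h' i) (h i)]
      refine (hgen i).trans (Subring.closure_mono (Set.union_subset_union_right _ ?_))
      rintro _ ⟨z, rfl⟩
      rw [← app_germ_comp g' W.ι g hg' (B i) (h i) (h' i)]
      exact ⟨W.ι.app (B i) z, rfl⟩)
  have hcl : IsClosedImmersion g'.imageι := inferInstance
  refine ⟨g'.image, g'.imageι ≫ W.ι, g'.toImage, ?_, inferInstance, ?_, hi, ?_, ?_⟩
  · rw [Scheme.Hom.toImage_imageι_assoc, hg']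
  · rw [Category.assoc]; exact hp
  · exact MorphismProperty.of_isPullback hp.flip spec_surj
  · intro l
    rw [Scheme.Hom.comp_preimage]
    exact (hV l).preimage g'.imageι
end
end WD
end

section
open AlgebraicGeometry CategoryTheory CategoryTheory.Limits
namespace WD
open Paper

section
open MvPolynomial
attribute [local instance] MvPolynomial.gradedAlgebra
variable {k K : Type} [Field k] [Field K] [Algebra k K]
variable {Y : Scheme.{0}} [IsIntegral Y] {p : Y ⟶ Spec (CommRingCat.of K)}

theorem preimage_top {X P : Scheme.{0}} (i : X ⟶ P) (t : Y ⟶ X) [Surjective t] (g : Y ⟶ P)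
    (e : t ≫ i = g) (V : P.Opens) (h : g ⁻¹ᵁ V = ⊤) : i ⁻¹ᵁ V = ⊤ := by
  rw [eq_top_iff]
  rintro x -
  obtain ⟨y, rfl⟩ := t.surjective x
  have hy : y ∈ g ⁻¹ᵁ V := by rw [h]; trivial
  rw [← e, Scheme.Hom.comp_preimage] at hy
  exact hy

theorem core (D : DescentDatum k K Y p)
    (hfix : ∀ a : K, (∀ σ : K ≃ₐ[k] K, σ a = a) → a ∈ Set.range (algebraMap k K))
    [Y.IsSeparated] [CompactSpace Y] {S J : Set Y.functionField} (hS : S.Finite)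
    (hG : GeoP p S J) (hfS : ∀ f ∈ S, ∀ σ, rho D σ f = f) :
    ∃ (X : Scheme.{0}) (q : X ⟶ Spec (CommRingCat.of k)) (t : Y ⟶ X),
      IsPullback t p q (Spec.map (CommRingCat.ofHom (algebraMap k K))) ∧
      (∀ σ, (D.act σ).hom ≫ t = t) ∧ QuasiProjectiveOver k q ∧
      ((letI := ffAlg p; Reg K S J) → 1 ∈ S → X.IsQuasiAffine ∧ (1 ∈ J → IsAffine X)) := by
  letI := ffAlg p
  obtain ⟨n, y, -, hy⟩ := hS.fin_param
  obtain ⟨e0, he0, -⟩ := hG.cov (genericPoint Y)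
  obtain ⟨i0, hi0⟩ : e0 ∈ Set.range y := by rw [hy]; exact hG.sub he0
  obtain ⟨N, rfl⟩ : ∃ N, n = N + 1 := ⟨n - 1, by have := i0.2; omega⟩
  let ι : Type := {i // y i ∈ J}
  have hne : Nonempty ι := ⟨⟨i0, by rw [hi0]; exact he0⟩⟩
  have hch : ∀ i : ι, ∃ U : Y.Opens, IsAffineOpen U ∧ ∃ h, secs U h = BE K S (y i.1) :=
    fun i => exists_PP.1 (hG.ch _ i.2)
  choose U hU h hs using hch
  have hc : ⨆ i, U i = ⊤ := by
    rw [eq_top_iff]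
    rintro x -
    obtain ⟨e, he, V, hV, hx, hh, hVs⟩ := hG.cov x
    obtain ⟨i, rfl⟩ : e ∈ Set.range y := by rw [hy]; exact hG.sub he
    rw [eq_of_secs_eq hV (hU ⟨i, he⟩) (hVs.trans (hs ⟨i, he⟩).symm)] at hx
    exact TopologicalSpace.Opens.mem_iSup.2 ⟨_, hx⟩
  obtain ⟨g, hg1, hg2, hg3, hg4, hg5⟩ := beta1 D y
    (fun σ i => hfS _ (by rw [← hy]; exact ⟨i, rfl⟩) σ) (ι := ι) Subtype.val
    (fun i => hG.nz _ i.2) U hU hc h (fun i => by rw [hy]; exact hs i)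
  have h' : ∀ i : ι, genericPoint Y ∈ g ⁻¹ᵁ Proj.basicOpen _ (X i.1) := fun i => by
    rw [hg4]; exact h i
  have hsec : ∀ (U U' : Y.Opens) (e : U = U') (a : genericPoint Y ∈ U) (b), secs U a = secs U' b := by
    rintro U _ rfl a b; rfl
  have hgc : ⨆ i : ι, g ⁻¹ᵁ Proj.basicOpen _ (X i.1) = ⊤ := by
    rw [← hc]; exact iSup_congr hg4
  obtain ⟨Z, i, t, hti, him, hpb, hact, hsurj, haff⟩ := core_geo D hfix (sM k N) g hg1 hg2
    (fun i : ι => Proj.basicOpen (homogeneousSubmodule (Fin (N + 1)) k) (X i.1))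
    (fun i => Proj.isAffineOpen_basicOpen _ _ (X_mem i.1) one_pos) hgc
    (fun i => by rw [hg4]; exact hU i) h' (by
      intro i
      rw [hsec _ _ (hg4 i) (h' i) (h i), hs i]
      refine BE_le (fun c => Subring.subset_closure (Or.inl ⟨c, rfl⟩)) ?_
      intro f hf
      obtain ⟨l, rfl⟩ : f ∈ Set.range y := by rw [hy]; exact hf
      exact Subring.subset_closure (Or.inr (hg5 i (h' i) l)))
  have hQ : QuasiProjectiveOver k (i ≫ sM k N) := ⟨N, i, him, rfl⟩
  have hcZ : CompactSpace Z := QP.compact hQ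
  refine ⟨Z, i ≫ sM k N, t, hpb, hact, hQ, fun hR h1 => ?_⟩
  have key : ∀ l, y l = 1 → i ⁻¹ᵁ Proj.basicOpen _ (X l) = ⊤ := by
    intro l hl
    refine preimage_top i t g hti _ ?_
    rw [eq_top_iff, ← hc]
    refine iSup_le fun m => ?_
    obtain ⟨s, hs1, hs2⟩ := hg3 m l
    have hm : y m.1 ∈ secs (U m) (h m) := by
      rw [hs m]; exact hR _ m.2 (hG.sub m.2)
    obtain ⟨s', hs'⟩ := mem_secs.1 hm
    have hu : s' * s = 1 := by
      apply germ_injective_of_isIntegral Y _ (h m)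
      rw [map_mul, map_one, hs1, hs', hl]
      exact mul_one_div_cancel (hG.nz _ m.2)
    have hb : Y.basicOpen s = U m := Y.basicOpen_of_isUnit (IsUnit.of_mul_eq_one_right _ hu)
    rw [hb] at hs2
    exact inf_eq_left.1 hs2
  constructor
  · obtain ⟨l, hl⟩ : 1 ∈ Set.range y := by rw [hy]; exact h1
    let V := Proj.basicOpen (homogeneousSubmodule (Fin (N + 1)) k) (X l)
    have hV : IsAffineOpen V := Proj.isAffineOpen_basicOpen _ _ (X_mem l) one_pos
    have hr : Set.range i ⊆ Set.range V.ι := by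
      rw [Scheme.Opens.range_ι]
      rintro _ ⟨x, rfl⟩
      have hx : x ∈ i ⁻¹ᵁ V := by rw [key l hl]; trivial
      exact hx
    have : IsAffine V := hV
    let i' : Z ⟶ V := IsOpenImmersion.lift V.ι i hr
    have hi' : i' ≫ V.ι = i := IsOpenImmersion.lift_fac _ _ _
    have h3 : IsImmersion (i' ≫ V.ι) := by rw [hi']; exact him
    have : IsImmersion i' := IsImmersion.of_comp i' V.ι
    exact Scheme.IsQuasiAffine.of_isImmersion i'
  · intro h1J
    obtain ⟨l, hl⟩ : 1 ∈ Set.range y := by rw [hy]; exact h1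
    have := haff ⟨l, by rw [hl]; exact h1J⟩
    rw [key l hl] at this
    have : IsAffine (⊤ : Z.Opens) := this
    exact IsAffine.of_isIso Z.topIso.inv

theorem final [CharZero k] [IsAlgClosed K]
    (htr : ∀ L : IntermediateField k K, L.FG → ∃ x : K, Transcendental L x)
    (hqp : QuasiProjectiveOver K p)
    (D : DescentDatum k K Y p) (hcont : D.IsContinuous) :
    ∃ (X : Scheme.{0}) (q : X ⟶ Spec (CommRingCat.of k)) (t : Y ⟶ X),
      IsPullback t p q (Spec.map (CommRingCat.ofHom (algebraMap k K))) ∧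
      (∀ σ, (D.act σ).hom ≫ t = t) ∧ QuasiProjectiveOver k q ∧
      (Y.IsQuasiAffine → X.IsQuasiAffine) ∧ (IsAffine Y → IsAffine X) := by
  letI := ffAlg p
  have hfix : ∀ a : K, (∀ σ : K ≃ₐ[k] K, σ a = a) → a ∈ Set.range (algebraMap k K) := by
    intro a ha
    have := fixed_mem htr ⊥ IntermediateField.fg_bot a (fun σ _ => ha σ)
    exact IntermediateField.mem_bot.1 this
  have := QP.sep hqp
  have := QP.compact hqp
  have := QP.lft hqp
  let C := chartSys (rho D) D.act (secs_act D)
  have : Nonempty C.pt := ⟨(genericPoint Y : Y)⟩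
  have conv : ∀ S J, GeoP p S J → Geo C S J := fun S J h => ⟨h.1, h.2, h.3, h.4⟩
  have conv' : ∀ S J, Geo C S J → GeoP p S J := fun S J h => ⟨h.1, h.2, h.3, h.4⟩
  by_cases hq : Y.IsQuasiAffine
  · obtain ⟨S, J, hS, hG, hR, h1, h2⟩ := alpha_qa p
    obtain ⟨S', J', hS', hG', hf', hR', h1', h2'⟩ :=
      pipeline (rho_const D) htr C (conv S J hG) hS hcont
    obtain ⟨X, q, t, a, b, c, d⟩ := core D hfix hS' (conv' _ _ hG') hf'
    exact ⟨X, q, t, a, b, c, fun _ => (d (hR' hR) (h1' h1)).1,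
      fun ha => (d (hR' hR) (h1' h1)).2 (h2' (h2 ha))⟩
  · obtain ⟨S, J, hS, hG⟩ := alpha_qp p hqp
    obtain ⟨S', J', hS', hG', hf', hR', h1', h2'⟩ :=
      pipeline (rho_const D) htr C (conv S J hG) hS hcont
    obtain ⟨X, q, t, a, b, c, d⟩ := core D hfix hS' (conv' _ _ hG') hf'
    exact ⟨X, q, t, a, b, c, fun h => (hq h).elim, fun h => (hq inferInstance).elim⟩

theorem equivar {X : Scheme.{0}} {q : X ⟶ Spec (CommRingCat.of k)} {t : Y ⟶ X}
    (hpb : IsPullback t p q (Spec.map (CommRingCat.ofHom (algebraMap k K)))) (σ : K ≃ₐ[k] K)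
    (a : Y ⟶ Y) (h1 : a ≫ t = t) (h2 : a ≫ p = p ≫ specAut k K σ) :
    a ≫ hpb.isoPullback.hom = hpb.isoPullback.hom ≫
      pullback.map _ _ _ _ (𝟙 X) (specAut k K σ) (𝟙 (Spec (CommRingCat.of k)))
      (by simp) (by rw [Category.comp_id, specAut_comp]) := by
  refine pullback.hom_ext ?_ ?_
  · rw [Category.assoc, Category.assoc, pullback.map, pullback.lift_fst, hpb.isoPullback_hom_fst,
      hpb.isoPullback_hom_fst_assoc, Category.comp_id, h1]
  · rw [Category.assoc, Category.assoc, pullback.map, pullback.lift_snd, hpb.isoPullback_hom_snd,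
      hpb.isoPullback_hom_snd_assoc, h2]

theorem qa_over {X : Scheme.{0}} {q : X ⟶ Spec (CommRingCat.of k)} (hq : QuasiProjectiveOver k q)
    [X.IsQuasiAffine] : QuasiAffineOver k q := by
  have := QP.compact hq
  refine ⟨QP.lft hq, quasiCompact_of_compactSpace q, Spec Γ(X, ⊤),
    Spec.map q.appTop ≫ inv (Scheme.toSpecΓ (Spec (CommRingCat.of k))), X.toSpecΓ, inferInstance,
    inferInstance, ?_⟩
  rw [← Category.assoc, ← Scheme.toSpecΓ_naturality, Category.assoc, IsIso.hom_inv_id,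
    Category.comp_id]

theorem qa_of_over (h : QuasiAffineOver K p) : Y.IsQuasiAffine := by
  obtain ⟨-, h2, Z, q, j, hZ, hj, rfl⟩ := h
  have : CompactSpace Y := QuasiCompact.compactSpace_of_compactSpace (j ≫ q)
  exact Scheme.IsQuasiAffine.of_isImmersion j
end
end WD
end

namespace Paper

/-- Weil's descent theorem (quasi-projective case): a continuous descent datum
with respect to `K/k` on an integral quasi-projective scheme over `K` is effective, the
descended scheme is quasi-projective over `k`, and it may be taken affine (resp. quasi-affine
of finite type) whenever `Y` is affine (resp. quasi-affine) over `K`. -/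
theorem weil_descent_theorem
    (k K : Type) [Field k] [CharZero k] [Field K] [IsAlgClosed K] [Algebra k K]
    -- `K` has infinite transcendence degree over `k`
    (htr : ∀ L : IntermediateField k K, L.FG → ∃ x : K, Transcendental L x)
    (Y : Scheme) [IsIntegral Y] (p : Y ⟶ Spec (CommRingCat.of K))
    -- `Y` is quasi-projective over `K`
    (hqp : QuasiProjectiveOver K p)
    -- a continuous descent datum on `Y` with respect to `K/k`
    (D : DescentDatum k K Y p) (hcont : D.IsContinuous) :
    ∃ (X : Scheme) (q : X ⟶ Spec (CommRingCat.of k)) (e : Y ≅ baseChange k K q),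
      -- the isomorphism is over `Spec K`
      e.hom ≫ pullback.snd q (Spec.map (CommRingCat.ofHom (algebraMap k K))) = p ∧
      -- the action of each `σ` corresponds to `id_X × Spec (σ⁻¹)`
      (∀ σ : K ≃ₐ[k] K, (D.act σ).hom ≫ e.hom = e.hom ≫ baseChangeAut k K q σ) ∧
      -- `X` is quasi-projective over `k`
      QuasiProjectiveOver k q ∧
      -- `X` may be taken affine whenever `Y` is affine
      (IsAffine Y → IsAffine X) ∧
      -- `X` may be taken quasi-affine of finite type whenever `Y` is quasi-affine
      (QuasiAffineOver K p → QuasiAffineOver k q) := by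
  obtain ⟨X, q, t, hpb, hact, hQ, h1, h2⟩ := WD.final htr hqp D hcont
  refine ⟨X, q, hpb.isoPullback, hpb.isoPullback_hom_snd, fun σ => ?_, hQ, h2, fun h => ?_⟩
  · exact WD.equivar hpb σ _ (hact σ) (D.compat σ)
  · have := WD.qa_of_over h
    have := h1 this
    exact WD.qa_over hQ

end Paper
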